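/- arXiv:math/0608330 — 4 statements merged into one kernel-verified Lean document; each statement's English description precedes it below -/
import Mathlib

section
/- Suppose that κ and λ are regular cardinals such that κ⁺ < λ. Then there is a sequence ⟨C_δ : δ ∈ S^λ_κ⟩ such that each C_δ is a closed unbounded subset of δ, and for every closed unbounded set E ⊆ λ there is δ ∈ S^λ_κ with C_δ ⊆ E. -/
/-- `C` is a closed unbounded subset of the ordinal `δ`: it is a set of ordinals below `δ`,
closed under suprema of its bounded nonempty subsets, and unbounded in `δ`. -/
def IsClubIn (C : Set Ordinal.{0}) (δ : Ordinal.{0}) : Prop :=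
  C ⊆ Set.Iio δ ∧
  (∀ s : Set Ordinal.{0}, s ⊆ C → s.Nonempty → sSup s < δ → sSup s ∈ C) ∧
  (∀ α < δ, ∃ β ∈ C, α ≤ β)

open Set Order

theorem isClubIn_Iio (δ : Ordinal.{0}) : IsClubIn (Iio δ) δ :=
  ⟨subset_rfl, fun _ _ _ h => h, fun α hα => ⟨α, hα, le_rfl⟩⟩

theorem IsClubIn.mem_of_mem_closure {C : Set Ordinal.{0}} {δ x : Ordinal.{0}} (hC : IsClubIn C δ)
    (hx : x ∈ closure C) (hxδ : x < δ) : x ∈ C := by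
  obtain ⟨t, ht, hne, -, rfl⟩ := ((Ordinal.mem_closure_tfae x C).out 0 3).1 hx
  exact hC.2.1 t ht hne hxδ

theorem Cardinal.IsRegular.iSup_Iio_lt_ord {c : Cardinal.{0}} (hc : c.IsRegular) {i : Ordinal.{0}}
    (hi : i.card < c) {f : Iio i → Ordinal.{0}} (hf : ∀ j, f j < c.ord) : ⨆ j, f j < c.ord := by
  refine Ordinal.lift_iSup_lt_of_lt_cof ?_ hf
  rw [Cardinal.mk_Iio_ordinal, ← Ordinal.lift_cof, hc.cof_ord]
  simpa [← Ordinal.lift_card] using hi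

/-- The intersection of fewer than `c` clubs of a regular uncountable cardinal `c` is a club. -/
theorem IsClubIn.iInter {c : Cardinal.{0}} (hc : c.IsRegular) (hω : Cardinal.aleph0 < c)
    {i : Ordinal.{0}} (hi : i.card < c) {F : Iio i → Set Ordinal.{0}}
    (hF : ∀ j, IsClubIn (F j) c.ord) : IsClubIn (Iio c.ord ∩ ⋂ j, F j) c.ord := by
  refine ⟨inter_subset_left, fun s hs hne hlt => ⟨hlt, mem_iInter.2 fun j =>
    (hF j).2.1 s (fun x hx => mem_iInter.1 (hs hx).2 j) hne hlt⟩, fun α hα => ?_⟩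
  have hnext : ∀ (j : Iio i) (x : Ordinal.{0}), ∃ y, x < c.ord → y ∈ F j ∧ x ≤ y := by
    intro j x
    by_cases hx : x < c.ord
    · obtain ⟨y, hy⟩ := (hF j).2.2 x hx
      exact ⟨y, fun _ => hy⟩
    · exact ⟨0, fun h => absurd h hx⟩
  choose g hg using hnext
  let u : ℕ → Ordinal.{0} := fun n => (fun x => ⨆ j, g j x)^[n] α
  have hu_succ (n : ℕ) : u (n + 1) = ⨆ j, g j (u n) := Function.iterate_succ_apply' _ _ _
  have hu (n : ℕ) : u n < c.ord := by
    induction n with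
    | zero => exact hα
    | succ n ih =>
      rw [hu_succ]
      exact hc.iSup_Iio_lt_ord hi fun j => (hF j).1 (hg j _ ih).1
  have hsup : ⨆ n, u n < c.ord := by
    refine Ordinal.iSup_lt_of_lt_cof ?_ hu
    rwa [hc.cof_ord, Cardinal.mk_nat]
  refine ⟨⨆ n, u n, ⟨hsup, mem_iInter.2 fun j => ?_⟩, Ordinal.le_iSup u 0⟩
  have heq : ⨆ n, g j (u n) = ⨆ n, u n := by
    refine le_antisymm (Ordinal.iSup_le fun n => ?_) (Ordinal.iSup_le fun n => ?_)
    · refine le_trans ?_ (Ordinal.le_iSup u (n + 1))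
      rw [hu_succ]
      exact Ordinal.le_iSup (fun j => g j (u n)) j
    · exact (hg j _ (hu n)).2.trans (Ordinal.le_iSup (fun n => g j (u n)) n)
  rw [← heq] at hsup ⊢
  exact (hF j).2.1 _ (range_subset_iff.2 fun n => (hg j _ (hu n)).1) (range_nonempty _) hsup

/-- Every club of a regular cardinal `c` has a limit point of any regular cofinality below `c`. -/
theorem IsClubIn.exists_limit_cof_eq {κ c : Cardinal.{0}} (hκ : κ.IsRegular) (hc : c.IsRegular)
    (h : κ < c) {E : Set Ordinal.{0}} (hE : IsClubIn E c.ord) :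
    ∃ δ < c.ord, δ.cof = κ ∧ ∀ β < δ, ∃ z ∈ E, β < z ∧ z < δ := by
  let S := E ∪ Ici c.ord
  have hS : ¬ BddAbove S := fun hb =>
    not_bddAbove_Ici (a := c.ord) (hb.mono subset_union_right)
  have hclosed : ∀ t ⊆ S, t.Nonempty → BddAbove t → sSup t ∈ S := by
    intro t ht hne hb
    by_cases hlt : sSup t < c.ord
    · refine Or.inl (hE.2.1 t (fun x hx => (ht hx).resolve_right fun hx' => ?_) hne hlt)
      exact ((le_csSup hb hx).trans_lt hlt).not_ge hx'
    · exact Or.inr (not_lt.1 hlt)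
  have hnormal := Ordinal.isNormal_enumOrd hclosed hS
  have hmono := Ordinal.enumOrd_strictMono hS
  have hlt (i : Ordinal.{0}) (hi : i < c.ord) : Ordinal.enumOrd S i < c.ord := by
    induction i using WellFoundedLT.induction with
    | ind i ih =>
      have hsup : ⨆ j : Iio i, Ordinal.enumOrd S j < c.ord :=
        hc.iSup_Iio_lt_ord (Cardinal.lt_ord.1 hi) fun j => ih j j.2 (j.2.trans hi)
      obtain ⟨b, hb, hle⟩ := hE.2.2 _ ((Cardinal.isSuccLimit_ord hc.1).succ_lt hsup)
      refine (Ordinal.enumOrd_le_of_forall_lt (Or.inl hb) fun j hj => ?_).trans_lt (hE.1 hb)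
      exact ((Ordinal.le_iSup (fun j : Iio i => Ordinal.enumOrd S j) ⟨j, hj⟩).trans_lt
        (lt_succ _)).trans_le hle
  have hlim : IsSuccLimit κ.ord := Cardinal.isSuccLimit_ord hκ.1
  have hδ := hlt _ (Cardinal.ord_lt_ord.2 h)
  refine ⟨Ordinal.enumOrd S κ.ord, hδ, ?_, fun β hβ => ?_⟩
  · rw [Ordinal.cof_map_of_isNormal hnormal hlim, hκ.cof_ord]
  · obtain ⟨i, hi, hβi⟩ := (hnormal.lt_iff_exists_lt hlim).1 hβ
    exact ⟨_, (Ordinal.enumOrd_mem hS i).resolve_right (hlt i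
      (hi.trans (Cardinal.ord_lt_ord.2 h))).not_ge, hβi, hmono hi⟩

/-- The closure below `δ` of the set of nonzero projections `sup (E ∩ (a k + 1))` to `E`. -/
def projSet {ι : Type*} (E : Set Ordinal.{0}) (δ : Ordinal.{0}) (a : ι → Ordinal.{0}) :
    Set Ordinal.{0} :=
  closure {x | x ≠ 0 ∧ ∃ k, sSup (E ∩ Iic (a k)) = x} ∩ Iio δ

theorem isClubIn_projSet {ι : Type*} {E : Set Ordinal.{0}} {δ : Ordinal.{0}} {a : ι → Ordinal.{0}}
    (ha : ∀ k, a k < δ) (hcof : ∀ β < δ, ∃ k, β ≤ a k)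
    (hlim : ∀ β < δ, ∃ z ∈ E, β < z ∧ z < δ) : IsClubIn (projSet E δ a) δ := by
  refine ⟨inter_subset_right, fun s hs hne hlt => ⟨?_, hlt⟩, fun β hβ => ?_⟩
  · refine closure_minimal (fun x hx => (hs hx).1) isClosed_closure
      (csSup_mem_closure hne ⟨δ, fun x hx => (hs hx).2.le⟩)
  · obtain ⟨z, hz, hβz, hzδ⟩ := hlim β hβ
    obtain ⟨k, hk⟩ := hcof z hzδ
    have hzs : z ≤ sSup (E ∩ Iic (a k)) :=
      le_csSup (bddAbove_Iic.mono inter_subset_right) ⟨hz, hk⟩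
    refine ⟨sSup (E ∩ Iic (a k)), ⟨subset_closure ⟨?_, k, rfl⟩, ?_⟩, hβz.le.trans hzs⟩
    · exact (hβz.trans_le hzs).ne_bot
    · have hne : (E ∩ Iic (a k)).Nonempty := ⟨z, hz, hk⟩
      exact (csSup_le hne fun x hx => hx.2).trans_lt (ha k)

/-- The decreasing sequence of sets obtained by iterating `D` and intersecting. -/
def iterInter (D : Set Ordinal.{0} → Set Ordinal.{0}) (o i : Ordinal.{0}) : Set Ordinal.{0} :=
  Iio o ∩ ⋂ j : Iio i, D (iterInter D o j)
termination_by i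
decreasing_by exact j.2

theorem iterInter_antitone (D : Set Ordinal.{0} → Set Ordinal.{0}) (o : Ordinal.{0}) :
    Antitone (iterInter D o) := by
  intro i j hij x hx
  rw [iterInter] at hx ⊢
  exact ⟨hx.1, mem_iInter.2 fun k => mem_iInter.1 hx.2 ⟨k, k.2.trans_le hij⟩⟩

theorem iterInter_subset (D : Set Ordinal.{0} → Set Ordinal.{0}) {o i j : Ordinal.{0}}
    (hij : i < j) : iterInter D o j ⊆ D (iterInter D o i) := by
  intro x hx
  rw [iterInter] at hx
  exact mem_iInter.1 hx.2 ⟨i, hij⟩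

/-- An antitone ordinal-valued function is eventually constant below any nonzero ordinal. -/
theorem Antitone.exists_eq_of_le_of_lt {f : Ordinal.{0} → Ordinal.{0}} (hf : Antitone f)
    {o : Ordinal.{0}} (ho : 0 < o) : ∃ i < o, ∀ j, i ≤ j → j < o → f j = f i := by
  obtain ⟨i, hi, hmin⟩ := exists_minimalFor_of_wellFoundedLT (· < o) f ⟨0, ho⟩
  exact ⟨i, hi, fun j hij hj => le_antisymm (hf hij) (hmin hj (hf hij))⟩

/-- Some club `E` is such that the projections to `E` of the sets `a δ` guess every club. -/
theorem exists_guessing_club {κ lam : Cardinal.{0}} (hκ : κ.IsRegular) (hlam : lam.IsRegular)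
    (h : succ κ < lam) (a : Ordinal.{0} → Iio κ.ord → Ordinal.{0})
    (ha : ∀ δ : Ordinal.{0}, δ.cof = κ → ∀ k, a δ k < δ) :
    ∃ E, IsClubIn E lam.ord ∧ ∀ D, IsClubIn D lam.ord → ∃ δ < lam.ord, δ.cof = κ ∧
      (∀ β < δ, ∃ z ∈ E, β < z ∧ z < δ) ∧ projSet E δ (a δ) ⊆ D := by
  by_contra! hcon
  have hD : ∀ E : Set Ordinal.{0}, ∃ D, IsClubIn D lam.ord ∧ (IsClubIn E lam.ord →
      ∀ δ < lam.ord, δ.cof = κ → (∀ β < δ, ∃ z ∈ E, β < z ∧ z < δ) →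
        ¬ projSet E δ (a δ) ⊆ D) := by
    intro E
    by_cases hE : IsClubIn E lam.ord
    · obtain ⟨D, hD, hD'⟩ := hcon E hE
      exact ⟨D, hD, fun _ => hD'⟩
    · exact ⟨Iio lam.ord, isClubIn_Iio _, fun h => absurd h hE⟩
  choose D hD hbad using hD
  have hreg : (succ κ).IsRegular := Cardinal.isRegular_succ hκ.1
  let E := iterInter D lam.ord
  have hE (i : Ordinal.{0}) (hi : i.card < lam) : IsClubIn (E i) lam.ord := by
    change IsClubIn (iterInter D lam.ord i) lam.ord
    rw [iterInter]
    exact .iInter hlam ((hκ.1.trans_lt (lt_succ κ)).trans h) hi fun j => hD _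
  have hanti : Antitone E := iterInter_antitone D lam.ord
  obtain ⟨δ, hδ, hcof, hlim⟩ := (hE (succ κ).ord (by simpa using h)).exists_limit_cof_eq hκ hlam
    ((lt_succ κ).trans h)
  have hstab (k : Iio κ.ord) : ∃ i < (succ κ).ord, ∀ j, i ≤ j → j < (succ κ).ord →
      sSup (E j ∩ Iic (a δ k)) = sSup (E i ∩ Iic (a δ k)) := by
    refine Antitone.exists_eq_of_le_of_lt (f := fun i => sSup (E i ∩ Iic (a δ k)))
      (fun i j hij => ?_) hreg.ord_pos
    exact csSup_le_csSup' (bddAbove_Iic.mono inter_subset_right)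
      (inter_subset_inter_left _ (hanti hij))
  choose m hm hstab using hstab
  have hi : ⨆ k, m k < (succ κ).ord := hreg.iSup_Iio_lt_ord (by simp) hm
  set i := ⨆ k, m k
  have hi' : succ i < (succ κ).ord := (Cardinal.isSuccLimit_ord hreg.1).succ_lt hi
  have hmi (k) : m k ≤ i := Ordinal.le_iSup m k
  refine hbad (E i) (hE i ((Cardinal.lt_ord.1 hi).trans h)) δ hδ hcof (fun β hβ => ?_) ?_
  · obtain ⟨z, hz, hz'⟩ := hlim β hβ
    exact ⟨z, hanti hi.le hz, hz'⟩
  · rintro x ⟨hx, hxδ⟩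
    refine (hD (E i)).mem_of_mem_closure (closure_mono ?_ hx) (lt_trans hxδ hδ)
    rintro _ ⟨h0, k, rfl⟩
    rw [hstab k i (hmi k) hi, ← hstab k (succ i) ((hmi k).trans (le_succ i)) hi'] at h0 ⊢
    have hne : (E (succ i) ∩ Iic (a δ k)).Nonempty := by
      by_contra hempty
      rw [not_nonempty_iff_eq_empty] at hempty
      exact h0 (by rw [hempty, csSup_empty, Ordinal.bot_eq_zero])
    refine iterInter_subset D (lt_succ i) ?_
    refine (hE (succ i) ((Cardinal.lt_ord.1 hi').trans h)).2.1 _ inter_subset_left hne ?_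
    exact (csSup_le hne fun x hx => hx.2).trans_lt ((ha δ hcof k).trans hδ)

/-- For regular cardinals `κ⁺ < lam` there is a club guessing sequence
`⟨C_δ : δ ∈ S^lam_κ⟩`. -/
theorem stmt_1 (κ lam : Cardinal.{0}) (hκ : κ.IsRegular) (hlam : lam.IsRegular)
    (h : Order.succ κ < lam) :
    ∃ C : Ordinal.{0} → Set Ordinal.{0},
      (∀ δ : Ordinal.{0}, δ < lam.ord → δ.cof = κ → IsClubIn (C δ) δ) ∧
      (∀ E : Set Ordinal.{0}, IsClubIn E lam.ord →
        ∃ δ : Ordinal.{0}, δ < lam.ord ∧ δ.cof = κ ∧ C δ ⊆ E) := by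
  classical
  have ha : ∀ δ : Ordinal.{0}, ∃ a : Iio κ.ord → Ordinal.{0}, δ.cof = κ →
      (∀ k, a k < δ) ∧ ∀ β < δ, ∃ k, β ≤ a k := by
    intro δ
    by_cases hδ : δ.cof = κ
    · obtain ⟨f, hf⟩ := Ordinal.exists_isFundamentalSeq (o := δ) (congrArg Cardinal.ord hδ)
      refine ⟨fun k => f k, fun _ => ⟨fun k => (f k).2, fun β hβ => ?_⟩⟩
      obtain ⟨_, ⟨k, rfl⟩, hk⟩ := hf.isCofinal_range ⟨β, hβ⟩
      exact ⟨k, hk⟩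
    · exact ⟨fun _ => 0, fun h => absurd h hδ⟩
  choose a ha using ha
  obtain ⟨E, -, hE⟩ := exists_guessing_club hκ hlam h a fun δ hδ k => (ha δ hδ).1 k
  refine ⟨fun δ => if ∀ β < δ, ∃ z ∈ E, β < z ∧ z < δ then projSet E δ (a δ) else Iio δ,
    fun δ _ hδ => ?_, fun D hD => ?_⟩
  · dsimp only
    split_ifs with hlim
    · exact isClubIn_projSet (ha δ hδ).1 (ha δ hδ).2 hlim
    · exact isClubIn_Iio δ
  · obtain ⟨δ, hδ, hcof, hlim, hsub⟩ := hE D hD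
    refine ⟨δ, hδ, hcof, ?_⟩
    dsimp only
    rwa [if_pos hlim]
end

section
/- Suppose that κ and λ are regular cardinals such that κ⁺ < λ. Then there exist a stationary set S ⊆ S^λ_κ, a club guessing sequence ⟨C_δ : δ ∈ S⟩ (each C_δ a club of δ, and for every club E of λ some δ ∈ S has C_δ ⊆ E), and a sequence ⟨P_α : α < λ⟩ with each P_α a family of subsets of α of cardinality less than λ, such that for every δ ∈ S and every α ∈ C_δ with sup(C_δ ∩ α) < α, the set C_δ ∩ α belongs to ⋃_{β<α} P_β. -/
namespace TightClub

open Ordinal Cardinal Set Order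

theorem sSup_lt_ord {c : Cardinal.{0}} (hc : c.IsRegular) {s : Set Ordinal.{0}}
    (hs : #s < Cardinal.lift.{1} c) (h : ∀ i ∈ s, i < c.ord) : sSup s < c.ord := by
  refine Ordinal.sSup_lt_of_lt_cof ?_ h
  rwa [← Ordinal.lift_cof, hc.cof_ord]

theorem mk_Iio_lt {c : Cardinal.{0}} {i : Ordinal.{0}} (hi : i < c.ord) :
    #(Iio i) < Cardinal.lift.{1} c := by
  rw [Cardinal.mk_Iio_ordinal, Cardinal.lift_lt]
  exact Cardinal.lt_ord.1 hi

theorem mk_image_Iio_lt {c : Cardinal.{0}} {i : Ordinal.{0}} (hi : i < c.ord)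
    (f : Ordinal.{0} → Ordinal.{0}) : #(f '' Iio i) < Cardinal.lift.{1} c :=
  mk_image_le.trans_lt (mk_Iio_lt hi)

theorem succ_lt_ord {c : Cardinal.{0}} (hc : c.IsRegular) {i : Ordinal.{0}} (hi : i < c.ord) :
    i + 1 < c.ord := by
  have := (Cardinal.isSuccLimit_ord hc.1).succ_lt hi
  simpa using this

theorem bddAbove_of_subset_Iio {s : Set Ordinal.{0}} {δ : Ordinal.{0}} (h : s ⊆ Iio δ) :
    BddAbove s := ⟨δ, fun _ hx => (h hx).le⟩

/-- `γ` is a limit of points of `E` strictly below it. -/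
def IsAcc (E : Set Ordinal.{0}) (γ : Ordinal.{0}) : Prop :=
  0 < γ ∧ ∀ η < γ, ∃ e ∈ E, η < e ∧ e < γ

theorem IsAcc.isSuccLimit {E : Set Ordinal.{0}} {γ : Ordinal.{0}} (h : IsAcc E γ) : IsSuccLimit γ := by
  rw [Ordinal.isSuccLimit_iff, isSuccPrelimit_iff_succ_lt]
  refine ⟨h.1.ne', fun a ha => ?_⟩
  obtain ⟨e, -, h1, h2⟩ := h.2 a ha
  exact (succ_le_of_lt h1).trans_lt h2

theorem IsAcc.mono {E D : Set Ordinal.{0}} {γ : Ordinal.{0}} (h : IsAcc E γ) (hED : E ⊆ D) :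
    IsAcc D γ :=
  ⟨h.1, fun η hη => let ⟨e, he, h1⟩ := h.2 η hη; ⟨e, hED he, h1⟩⟩

theorem mem_of_acc {E : Set Ordinal.{0}} {γ δ : Ordinal.{0}} (hE : IsClubIn E δ) (hγ : γ < δ)
    (h : IsAcc E γ) : γ ∈ E := by
  have h1 : sSup (E ∩ Iio γ) = γ := by
    apply le_antisymm
    · exact csSup_le' fun x hx => hx.2.le
    · by_contra! hlt
      obtain ⟨e, he, h1, h2⟩ := h.2 _ hlt
      exact h1.not_ge (le_csSup (bddAbove_of_subset_Iio inter_subset_right) ⟨he, h2⟩)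
  obtain ⟨e, he, -, h2⟩ := h.2 0 h.1
  have := hE.2.1 (E ∩ Iio γ) inter_subset_left ⟨e, he, h2⟩ (by rwa [h1])
  rwa [h1] at this

theorem isClubIn_closed {c : Cardinal.{0}} (hc : c.IsRegular) (hc' : c ≠ ℵ₀)
    (h : Ordinal.{0} → Ordinal.{0} → Ordinal.{0})
    (hh : ∀ i < c.ord, ∀ k < c.ord, h i k < c.ord) :
    IsClubIn {γ | γ < c.ord ∧ ∀ i < γ, ∀ k < γ, h i k < γ} c.ord := by
  refine ⟨fun x hx => hx.1, fun s hs hne hlt => ⟨hlt, fun i hi k hk => ?_⟩, fun α hα => ?_⟩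
  · obtain ⟨γ, hγ, hm⟩ := exists_lt_of_lt_csSup' (max_lt hi hk)
    have hb : BddAbove s := bddAbove_of_subset_Iio (δ := c.ord) fun x hx => (hs hx).1
    exact ((hs hγ).2 i ((le_max_left _ _).trans_lt hm) k
      ((le_max_right _ _).trans_lt hm)).trans_le (le_csSup hb hγ)
  · let G : Ordinal.{0} → Ordinal.{0} := fun x =>
      max x (sSup (Function.uncurry h '' (Iio x ×ˢ Iio x))) + 1
    have hG : ∀ x < c.ord, G x < c.ord := fun x hx => by
      refine succ_lt_ord hc (max_lt hx (sSup_lt_ord hc ?_ ?_))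
      · refine mk_image_le.trans_lt ?_
        rw [mk_setProd]
        exact Cardinal.mul_lt_of_lt (by simpa using hc.1) (mk_Iio_lt hx) (mk_Iio_lt hx)
      · rintro _ ⟨⟨i, k⟩, ⟨hi, hk⟩, rfl⟩
        exact hh i (lt_trans hi hx) k (lt_trans hk hx)
    have hGm : ∀ x, x < G x := fun x => by
      simp [G]
    have hGh : ∀ x, ∀ i < x, ∀ k < x, h i k < G x := fun x i hi k hk => by
      have : h i k ≤ sSup (Function.uncurry h '' (Iio x ×ˢ Iio x)) :=
        le_csSup (Ordinal.bddAbove_of_small) ⟨(i, k), ⟨hi, hk⟩, rfl⟩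
      simpa [G] using Or.inr this
    refine ⟨nfp G α, ⟨nfp_lt_ord_of_isRegular hc hc' hG hα, fun i hi k hk => ?_⟩, le_nfp _ _⟩
    obtain ⟨n, hn⟩ := lt_nfp_iff.1 (max_lt hi hk)
    calc h i k < G (G^[n] α) := hGh _ i ((le_max_left _ _).trans_lt hn) k
          ((le_max_right _ _).trans_lt hn)
      _ = G^[n+1] α := by rw [Function.iterate_succ_apply']
      _ ≤ nfp G α := iterate_le_nfp _ _ _

theorem exists_next {E : Set Ordinal.{0}} {δ : Ordinal.{0}} (hE : IsClubIn E δ) :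
    ∃ n : Ordinal.{0} → Ordinal.{0}, ∀ α < δ, n α ∈ E ∧ α ≤ n α ∧ n α < δ := by
  choose! n h1 h2 using hE.2.2
  exact ⟨n, fun α hα => ⟨h1 α hα, h2 α hα, hE.1 (h1 α hα)⟩⟩

theorem isClubIn_acc {c : Cardinal.{0}} (hc : c.IsRegular) (hc' : c ≠ ℵ₀) {E : Set Ordinal.{0}}
    (hE : IsClubIn E c.ord) : IsClubIn {γ | γ < c.ord ∧ IsAcc E γ} c.ord := by
  refine ⟨fun x hx => hx.1, fun s hs hne hlt => ⟨hlt, ?_⟩, fun α hα => ?_⟩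
  · have hb : BddAbove s := bddAbove_of_subset_Iio (δ := c.ord) fun x hx => (hs hx).1
    obtain ⟨x, hx⟩ := hne
    refine ⟨(hs hx).2.1.trans_le (le_csSup hb hx), fun η hη => ?_⟩
    obtain ⟨γ, hγ, hm⟩ := exists_lt_of_lt_csSup' hη
    obtain ⟨e, he, h1, h2⟩ := (hs hγ).2.2 η hm
    exact ⟨e, he, h1, h2.trans_le (le_csSup hb hγ)⟩
  · obtain ⟨n, hn⟩ := exists_next hE
    obtain ⟨γ, hγ, hle⟩ := (isClubIn_closed hc hc' (fun i _ => n (i + 1))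
      (fun i hi _ _ => (hn _ (succ_lt_ord hc hi)).2.2)).2.2 (α + 1) (succ_lt_ord hc hα)
    have hα' : α < γ := (lt_add_one α).trans_le hle
    refine ⟨γ, ⟨hγ.1, zero_le.trans_lt hα', fun η hη => ?_⟩, hα'.le⟩
    have := hn (η + 1) (succ_lt_ord hc (hη.trans hγ.1))
    exact ⟨_, this.1, (lt_add_one η).trans_le this.2.1, hγ.2 η hη η hη⟩

theorem isClubIn_iInter {c : Cardinal.{0}} (hc : c.IsRegular) (hc' : c ≠ ℵ₀) {ζ : Ordinal.{0}}
    (hζ : ζ < c.ord) {D : Ordinal.{0} → Set Ordinal.{0}} (hD : ∀ ξ < ζ, IsClubIn (D ξ) c.ord) :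
    IsClubIn {γ | γ < c.ord ∧ ∀ ξ < ζ, γ ∈ D ξ} c.ord := by
  refine ⟨fun x hx => hx.1, fun s hs hne hlt => ⟨hlt, fun ξ hξ => ?_⟩, fun α hα => ?_⟩
  · exact (hD ξ hξ).2.1 s (fun x hx => (hs hx).2 ξ hξ) hne hlt
  · have : ∀ ξ, ∃ n : Ordinal.{0} → Ordinal.{0}, ξ < ζ → ∀ α < c.ord,
        n α ∈ D ξ ∧ α ≤ n α ∧ n α < c.ord := fun ξ => by
      by_cases h : ξ < ζ
      · obtain ⟨n, hn⟩ := exists_next (hD ξ h)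
        exact ⟨n, fun _ => hn⟩
      · exact ⟨id, fun h' => (h h').elim⟩
    choose n hn using this
    let f : Ordinal.{0} → Ordinal.{0} → Ordinal.{0} := fun i k => if k < ζ then n k (i + 1) else 0
    obtain ⟨γ, hγ, hle⟩ := (isClubIn_closed hc hc' f (fun i hi k hk => by
      by_cases h : k < ζ
      · simpa [f, h] using (hn k h _ (succ_lt_ord hc hi)).2.2
      · simpa [f, h] using hc.ord_pos)).2.2 (max α ζ + 1) (succ_lt_ord hc (max_lt hα hζ))
    have hm : max α ζ < γ := (lt_add_one _).trans_le hle
    refine ⟨γ, ⟨hγ.1, fun ξ hξ => ?_⟩, (le_max_left _ _).trans hm.le⟩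
    refine mem_of_acc (hD ξ hξ) hγ.1 ⟨zero_le.trans_lt hm, fun η hη => ?_⟩
    have := hn ξ hξ (η + 1) (succ_lt_ord hc (hη.trans hγ.1))
    refine ⟨_, this.1, (lt_add_one η).trans_le this.2.1, ?_⟩
    simpa [f, hξ] using hγ.2 η hη ξ (hξ.trans ((le_max_right _ _).trans_lt hm))

theorem isClubIn_inter {c : Cardinal.{0}} (hc : c.IsRegular) (hc' : c ≠ ℵ₀)
    {D E : Set Ordinal.{0}} (hD : IsClubIn D c.ord) (hE : IsClubIn E c.ord) :
    IsClubIn (D ∩ E) c.ord := by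
  have h1 : (0 : Ordinal.{0}) + 1 < c.ord := succ_lt_ord hc hc.ord_pos
  have := isClubIn_iInter hc hc' (succ_lt_ord hc h1) (D := fun ξ => if ξ = 0 then D else E)
    (fun ξ _ => by split_ifs <;> assumption)
  convert this using 1
  ext γ
  constructor
  · rintro ⟨h1, h2⟩
    refine ⟨hD.1 h1, fun ξ _ => ?_⟩
    split_ifs <;> assumption
  · rintro ⟨-, h⟩
    exact ⟨by simpa using h 0 (by simp), by simpa using h 1 (by simp)⟩

theorem isClubIn_Iio {c : Cardinal.{0}} : IsClubIn (Iio c.ord) c.ord :=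
  ⟨subset_rfl, fun _ _ _ h => h, fun α hα => ⟨α, hα, le_rfl⟩⟩

theorem isClubIn_Ioo {c : Cardinal.{0}} (hc : c.IsRegular) {α : Ordinal.{0}} (hα : α < c.ord) :
    IsClubIn (Ioo α c.ord) c.ord := by
  refine ⟨fun x hx => hx.2, fun s hs hne hlt => ⟨?_, hlt⟩, fun β hβ => ?_⟩
  · obtain ⟨x, hx⟩ := hne
    exact (hs hx).1.trans_le (le_csSup (bddAbove_of_subset_Iio (δ := c.ord) fun x hx => (hs hx).2) hx)
  · exact ⟨max α β + 1, ⟨(le_max_left _ _).trans_lt (lt_add_one _),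
      succ_lt_ord hc (max_lt hα hβ)⟩, (le_max_right _ _).trans (lt_add_one _).le⟩

/-- The supremum of the values of `ξ` below `i`. -/
noncomputable def lsup (ξ : Ordinal.{0} → Ordinal.{0}) (i : Ordinal.{0}) : Ordinal.{0} :=
  sSup (ξ '' Iio i)

theorem le_lsup (ξ : Ordinal.{0} → Ordinal.{0}) {j i : Ordinal.{0}} (h : j < i) :
    ξ j ≤ lsup ξ i :=
  le_csSup Ordinal.bddAbove_of_small ⟨j, h, rfl⟩

theorem lsup_le {ξ : Ordinal.{0} → Ordinal.{0}} {i b : Ordinal.{0}} (h : ∀ j < i, ξ j ≤ b) :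
    lsup ξ i ≤ b :=
  csSup_le' (by rintro _ ⟨j, hj, rfl⟩; exact h j hj)

theorem exists_of_lt_lsup {ξ : Ordinal.{0} → Ordinal.{0}} {i a : Ordinal.{0}} (h : a < lsup ξ i) :
    ∃ j < i, a < ξ j := by
  obtain ⟨_, ⟨j, hj, rfl⟩, h⟩ := exists_lt_of_lt_csSup' h
  exact ⟨j, hj, h⟩

theorem lsup_mono (ξ : Ordinal.{0} → Ordinal.{0}) : Monotone (lsup ξ) := fun _ _ h =>
  lsup_le fun _ hj => le_lsup ξ (lt_of_lt_of_le hj h)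

theorem lsup_congr {ξ ξ' : Ordinal.{0} → Ordinal.{0}} {i : Ordinal.{0}} (h : ∀ j < i, ξ j = ξ' j) :
    lsup ξ i = lsup ξ' i := by
  unfold lsup
  congr 1
  exact image_congr h

theorem lsup_lt_ord {c : Cardinal.{0}} (hc : c.IsRegular) {ξ : Ordinal.{0} → Ordinal.{0}}
    {i : Ordinal.{0}} (hi : i < c.ord) (h : ∀ j < i, ξ j < c.ord) : lsup ξ i < c.ord :=
  sSup_lt_ord hc (mk_image_Iio_lt hi ξ) (by rintro _ ⟨j, hj, rfl⟩; exact h j hj)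

theorem lsup_mem {E : Set Ordinal.{0}} {c : Cardinal.{0}} (hc : c.IsRegular)
    (hE : IsClubIn E c.ord) {ξ : Ordinal.{0} → Ordinal.{0}} {i : Ordinal.{0}} (hi : i < c.ord)
    (h0 : 0 < i) (h : ∀ j < i, ξ j ∈ E) : lsup ξ i ∈ E :=
  hE.2.1 _ (by rintro _ ⟨j, hj, rfl⟩; exact h j hj) ⟨_, 0, h0, rfl⟩
    (lsup_lt_ord hc hi fun j hj => hE.1 (h j hj))

theorem cof_lsup {ξ : Ordinal.{0} → Ordinal.{0}} {i : Ordinal.{0}} (hi : IsSuccLimit i)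
    (h : ∀ k < i, ∀ j < k, ξ j < ξ k) : (lsup ξ i).cof = i.cof := by
  have : StrictMono fun j : Iio i => ξ j := fun j k hjk => h k k.2 j hjk
  rw [← cof_iSup_Iio this hi.isSuccPrelimit, lsup, sSup_image']

theorem lt_lsup {ξ : Ordinal.{0} → Ordinal.{0}} {i j : Ordinal.{0}} (hi : IsSuccLimit i)
    (h : ∀ k < i, ∀ j < k, ξ j < ξ k) (hj : j < i) : ξ j < lsup ξ i :=
  (h _ (hi.succ_lt hj) j (lt_succ j)).trans_le (le_lsup ξ (hi.succ_lt hj))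

theorem exists_fast_seq {c : Cardinal.{0}} (hc : c.IsRegular) {E : Set Ordinal.{0}}
    (hE : IsClubIn E c.ord) (B : Ordinal.{0} → (Ordinal.{0} → Ordinal.{0}) → Ordinal.{0})
    (hB : ∀ i < c.ord, ∀ f, (∀ j < i, f j < c.ord) → B i f < c.ord) :
    ∃ ξ : Ordinal.{0} → Ordinal.{0}, ∀ i < c.ord, ξ i ∈ E ∧ (∀ j < i, ξ j < ξ i) ∧
      lsup ξ i < ξ i ∧ B i (fun j => if j < i then ξ j else 0) < ξ i := by
  classical
  obtain ⟨n, hn⟩ := exists_next hE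
  let G : Ordinal.{0} → (Ordinal.{0} → Ordinal.{0}) → Ordinal.{0} := fun i f =>
    n (max (lsup f i) (B i f) + 1)
  let ξ : Ordinal.{0} → Ordinal.{0} := WellFounded.fix lt_wf fun i ih =>
    G i fun j => if h : j < i then ih j h else 0
  have hξ : ∀ i, ξ i = G i fun j => if j < i then ξ j else 0 := fun i => by
    change WellFounded.fix _ _ _ = _
    rw [WellFounded.fix_eq]
    simp only [dite_eq_ite]
    rfl
  have hls : ∀ i, lsup (fun j => if j < i then ξ j else 0) i = lsup ξ i := fun i =>
    lsup_congr fun j hj => if_pos hj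
  have key : ∀ i < c.ord, ξ i < c.ord ∧
      n (max (lsup ξ i) (B i fun j => if j < i then ξ j else 0) + 1) = ξ i ∧
      max (lsup ξ i) (B i fun j => if j < i then ξ j else 0) + 1 < c.ord := by
    intro i
    induction i using WellFoundedLT.induction with
    | ind i ih =>
      intro hi
      have h1 : max (lsup ξ i) (B i fun j => if j < i then ξ j else 0) + 1 < c.ord := by
        refine succ_lt_ord hc (max_lt ?_ ?_)
        · exact lsup_lt_ord hc hi fun j hj => (ih j hj (hj.trans hi)).1
        · refine hB i hi _ fun j hj => ?_
          simpa [hj] using (ih j hj (hj.trans hi)).1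
      have h2 : n (max (lsup ξ i) (B i fun j => if j < i then ξ j else 0) + 1) = ξ i := by
        rw [hξ i]
        simp only [G, hls]
      exact ⟨h2 ▸ (hn _ h1).2.2, h2, h1⟩
  refine ⟨ξ, fun i hi => ?_⟩
  obtain ⟨-, h2, h1⟩ := key i hi
  have h3 := hn _ h1
  rw [h2] at h3
  have h4 := (lt_add_one _).trans_le h3.2.1
  have h5 := (le_max_left _ _).trans_lt h4
  exact ⟨h3.1, fun j hj => (le_lsup ξ hj).trans_lt h5, h5, (le_max_right _ _).trans_lt h4⟩

theorem exists_mem_cof_eq {κ c : Cardinal.{0}} (hκ : κ.IsRegular) (hc : c.IsRegular) (h : κ < c)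
    {E : Set Ordinal.{0}} (hE : IsClubIn E c.ord) : ∃ δ ∈ E, δ.cof = κ := by
  obtain ⟨ξ, hξ⟩ := exists_fast_seq hc hE (fun _ _ => 0) fun _ _ _ _ => hc.ord_pos
  have hl : κ.ord < c.ord := Cardinal.ord_lt_ord.2 h
  refine ⟨lsup ξ κ.ord, lsup_mem hc hE hl hκ.ord_pos fun j hj => (hξ j (hj.trans hl)).1, ?_⟩
  rw [cof_lsup (Cardinal.isSuccLimit_ord hκ.1) fun k hk j hj => (hξ k (hk.trans hl)).2.1 j hj,
    hκ.cof_ord]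

/-- The result of gluing the set `A` to the club `E`: every `α ∈ A` is replaced by
`sup (E ∩ α)`. -/
def glue (E A : Set Ordinal.{0}) : Set Ordinal.{0} :=
  {γ | ∃ α ∈ A, (E ∩ Iio α).Nonempty ∧ sSup (E ∩ Iio α) = γ}

theorem sSup_inter_Iio_mem {E : Set Ordinal.{0}} {c α : Ordinal.{0}} (hE : IsClubIn E c)
    (hα : α < c) (h : (E ∩ Iio α).Nonempty) : sSup (E ∩ Iio α) ∈ E :=
  hE.2.1 _ inter_subset_left h ((csSup_le' fun _ hx => hx.2.le).trans_lt hα)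

theorem glue_subset {E A : Set Ordinal.{0}} {c δ : Ordinal.{0}} (hE : IsClubIn E c) (hδ : δ ≤ c)
    (hA : A ⊆ Iio δ) : glue E A ⊆ E := by
  rintro _ ⟨α, hα, h, rfl⟩
  exact sSup_inter_Iio_mem hE ((hA hα).trans_le hδ) h

theorem mk_glue_le (E A : Set Ordinal.{0}) : #(glue E A) ≤ #A := by
  refine (mk_le_mk_of_subset (t := (fun α => sSup (E ∩ Iio α)) '' A) ?_).trans mk_image_le
  rintro _ ⟨α, hα, -, rfl⟩
  exact ⟨α, hα, rfl⟩

theorem glue_cofinal {E A : Set Ordinal.{0}} {δ : Ordinal.{0}} (hE : IsAcc E δ)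
    (hA : ∀ η < δ, ∃ a ∈ A, η < a) : ∀ η < δ, ∃ a ∈ glue E A, η < a := fun η hη => by
  obtain ⟨e, he, h1, h2⟩ := hE.2 η hη
  obtain ⟨a, ha, hea⟩ := hA e h2
  exact ⟨_, ⟨a, ha, ⟨e, he, hea⟩, rfl⟩,
    h1.trans_le (le_csSup (bddAbove_of_subset_Iio inter_subset_right) ⟨he, hea⟩)⟩

theorem glue_subset_Iio {E A : Set Ordinal.{0}} {δ : Ordinal.{0}} (hA : A ⊆ Iio δ) :
    glue E A ⊆ Iio δ := by
  rintro _ ⟨α, hα, -, rfl⟩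
  have h1 : sSup (E ∩ Iio α) ≤ α := csSup_le' fun _ hx => hx.2.le
  exact h1.trans_lt (hA hα)

theorem exists_glue_guess {κ c : Cardinal.{0}} (hκ : κ.IsRegular) (hc : c.IsRegular)
    (hlt : succ κ < c) {S : Set Ordinal.{0}}
    (hS : ∀ E, IsClubIn E c.ord → ∃ δ ∈ S, δ ∈ E)
    {A : Ordinal.{0} → Set Ordinal.{0}} (hA : ∀ δ ∈ S, A δ ⊆ Iio δ)
    (hAc : ∀ δ ∈ S, #(A δ) ≤ Cardinal.lift.{1} κ) :
    ∃ E, IsClubIn E c.ord ∧ (∀ γ ∈ E, IsSuccLimit γ) ∧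
      ∀ D, IsClubIn D c.ord → ∃ δ ∈ S, δ < c.ord ∧ IsAcc E δ ∧ glue E (A δ) ⊆ D := by
  have hc' : c ≠ ℵ₀ := ((hκ.1.trans_lt (lt_succ κ)).trans hlt).ne'
  by_contra! hcon
  choose! Φ hΦ using hcon
  let Es : Ordinal.{0} → Set Ordinal.{0} := WellFounded.fix lt_wf fun ζ ih =>
    {γ | (γ < c.ord ∧ IsAcc (Iio c.ord) γ) ∧ ∀ ξ (h : ξ < ζ), γ ∈ Φ (ih ξ h)}
  have hEs : ∀ ζ, Es ζ = {γ | (γ < c.ord ∧ IsAcc (Iio c.ord) γ) ∧ ∀ ξ < ζ, γ ∈ Φ (Es ξ)} :=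
    fun ζ => by
      change WellFounded.fix _ _ _ = _
      rw [WellFounded.fix_eq]
  have hlim : ∀ ζ, ∀ γ ∈ Es ζ, IsSuccLimit γ := fun ζ γ hγ => by
    rw [hEs] at hγ
    exact hγ.1.2.isSuccLimit
  have hclub : ∀ ζ < c.ord, IsClubIn (Es ζ) c.ord := by
    intro ζ
    induction ζ using WellFoundedLT.induction with
    | ind ζ ih =>
      intro hζ
      have h1 := isClubIn_inter hc hc' (isClubIn_acc hc hc' (isClubIn_Iio (c := c)))
        (isClubIn_iInter hc hc' hζ (D := fun ξ => Φ (Es ξ))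
          fun ξ hξ => (hΦ _ (ih ξ hξ (hξ.trans hζ)) (hlim ξ)).1)
      convert h1 using 1
      rw [hEs]
      ext γ
      exact ⟨fun h => ⟨h.1, h.1.1, h.2⟩, fun h => ⟨h.1, h.2.2⟩⟩
  have hanti : ∀ ζ ζ', ζ ≤ ζ' → Es ζ' ⊆ Es ζ := fun ζ ζ' h γ hγ => by
    rw [hEs] at hγ ⊢
    exact ⟨hγ.1, fun ξ hξ => hγ.2 ξ (hξ.trans_le h)⟩
  have hκ' := isRegular_succ hκ.1
  have hl : (succ κ).ord < c.ord := Cardinal.ord_lt_ord.2 hlt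
  obtain ⟨δ, hδS, hδ, hacc⟩ := hS _ (isClubIn_acc hc hc' (hclub _ hl))
  have hmin : ∀ α, ∃ ζ < (succ κ).ord, ∀ ζ' < (succ κ).ord,
      sSup (Es ζ ∩ Iio α) ≤ sSup (Es ζ' ∩ Iio α) := fun α => by
    obtain ⟨ζ, h1, h2⟩ := exists_minimalFor_of_wellFoundedLT (· < (succ κ).ord)
      (fun ζ => sSup (Es ζ ∩ Iio α)) ⟨0, hκ'.ord_pos⟩
    exact ⟨ζ, h1, fun ζ' h' => (le_total _ _).elim id fun h => h2 h' h⟩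
  choose Z hZ hZm using hmin
  have hz : sSup (Z '' A δ) < (succ κ).ord := by
    refine sSup_lt_ord hκ' ?_ (by rintro _ ⟨α, -, rfl⟩; exact hZ α)
    refine (mk_image_le.trans (hAc δ hδS)).trans_lt ?_
    rw [Cardinal.lift_lt]
    exact lt_succ κ
  set z := sSup (Z '' A δ) with hz_def
  have hz1 := succ_lt_ord hκ' hz
  have hcz := hclub z (hz.trans hl)
  refine (hΦ (Es z) hcz (hlim z)).2 δ hδS hδ (hacc.mono (hanti _ _ hz.le)) ?_
  rintro _ ⟨α, hα, ⟨x, hx⟩, rfl⟩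
  have hαδ : α < c.ord := (hA δ hδS hα).trans hδ
  have hb : ∀ s : Set Ordinal.{0}, BddAbove (s ∩ Iio α) := fun s =>
    bddAbove_of_subset_Iio inter_subset_right
  have hZz : Z α ≤ z := le_csSup
    (bddAbove_of_subset_Iio (δ := (succ κ).ord) (by rintro _ ⟨α, -, rfl⟩; exact hZ α)) ⟨α, hα, rfl⟩
  have h0 : 0 < sSup (Es z ∩ Iio α) :=
    (hlim z x hx.1).bot_lt.trans_le (le_csSup (hb _) hx)
  have h1 : sSup (Es z ∩ Iio α) ≤ sSup (Es (z + 1) ∩ Iio α) := by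
    refine le_trans ?_ (hZm α _ hz1)
    exact csSup_le' fun y hy => le_csSup (hb _) ⟨hanti _ _ hZz hy.1, hy.2⟩
  have h2 : sSup (Es (z + 1) ∩ Iio α) ≤ sSup (Es z ∩ Iio α) :=
    csSup_le' fun y hy => le_csSup (hb _) ⟨hanti _ _ (lt_add_one z).le hy.1, hy.2⟩
  have hne : (Es (z + 1) ∩ Iio α).Nonempty := by
    by_contra hne
    rw [not_nonempty_iff_eq_empty] at hne
    rw [hne, csSup_empty] at h1
    exact h0.not_ge h1
  have h3 := sSup_inter_Iio_mem (hclub _ (hz1.trans hl)) hαδ hne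
  rw [le_antisymm h1 h2]
  generalize sSup (Es (z + 1) ∩ Iio α) = γ at h3
  rw [hEs (z + 1)] at h3
  exact h3.2 z (lt_add_one z)

/-- `A` is a cofinal subset of `δ` all of whose proper initial segments are coded, via `F`, by
finite lists of ordinals below `δ`. -/
def ApproxAt (F : List Ordinal.{0} → Set Ordinal.{0}) (δ : Ordinal.{0}) (A : Set Ordinal.{0}) :
    Prop :=
  A ⊆ Iio δ ∧ (∀ η < δ, ∃ a ∈ A, η < a) ∧
    ∀ γ < δ, ∃ l : List Ordinal.{0}, (∀ x ∈ l, x < δ) ∧ A ∩ Iio γ = F l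

theorem exists_list_bound {δ : Ordinal.{0}} (h0 : 0 < δ) (l : List Ordinal.{0})
    (hl : ∀ x ∈ l, x < δ) : ∃ m < δ, ∀ x ∈ l, x ≤ m := by
  induction l with
  | nil => exact ⟨0, h0, by simp⟩
  | cons a l ih =>
    obtain ⟨m, hm, h⟩ := ih fun x hx => hl x (List.mem_cons_of_mem _ hx)
    refine ⟨max a m, max_lt (hl a List.mem_cons_self) hm, fun x hx => ?_⟩
    rcases List.mem_cons.1 hx with rfl | hx
    · exact le_max_left _ _
    · exact (h x hx).trans (le_max_right _ _)

/-- Codes for the initial segments of glued sets. -/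
def glueCode (E : Set Ordinal.{0}) (F : List Ordinal.{0} → Set Ordinal.{0}) :
    List Ordinal.{0} → Set Ordinal.{0}
  | [] => ∅
  | η :: l => glue E (F l) ∩ Iio η

theorem ApproxAt.glue {F : List Ordinal.{0} → Set Ordinal.{0}} {δ : Ordinal.{0}}
    {A E : Set Ordinal.{0}} (h : ApproxAt F δ A) (hE : IsAcc E δ) :
    ApproxAt (glueCode E F) δ (glue E A) := by
  have hb : ∀ α, BddAbove (E ∩ Iio α) := fun α => bddAbove_of_subset_Iio inter_subset_right
  refine ⟨glue_subset_Iio h.1, glue_cofinal hE h.2.1, fun γ hγ => ?_⟩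
  · obtain ⟨e, he, h1, h2⟩ := hE.2 γ hγ
    obtain ⟨l, hl, hlA⟩ := h.2.2 (succ e) (hE.isSuccLimit.succ_lt h2)
    refine ⟨γ :: l, by simpa using ⟨hγ, hl⟩, ?_⟩
    rw [glueCode, ← hlA]
    ext x
    constructor
    · rintro ⟨⟨α, hα, hne, rfl⟩, hx⟩
      refine ⟨⟨α, ⟨hα, mem_Iio.2 (lt_succ_of_le ?_)⟩, hne, rfl⟩, hx⟩
      by_contra! hlt
      exact ((le_csSup (hb α) ⟨he, hlt⟩).trans_lt hx).not_ge h1.le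
    · rintro ⟨⟨α, hα, hne, rfl⟩, hx⟩
      exact ⟨⟨α, hα.1, hne, rfl⟩, hx⟩

/-- The points `γ` of `a` such that the part below `γ` of the thinned out set is coded
below `γ`. -/
def ThinMem (F : List Ordinal.{0} → Set Ordinal.{0}) : Ordinal.{0} → Set Ordinal.{0} → Prop :=
  WellFounded.fix lt_wf fun γ ih a =>
    γ ∈ a ∧ ∃ l : List Ordinal.{0}, (∀ x ∈ l, x < γ) ∧ ∃ η < γ,
      {x | ∃ h : x < γ, ih x h a} = {x | ∃ h : x < γ, ih x h (F l) ∧ x < η}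

/-- The set of `γ ∈ a` such that the part below `γ` of the thinned out set is coded
below `γ`. -/
def thin (F : List Ordinal.{0} → Set Ordinal.{0}) (a : Set Ordinal.{0}) : Set Ordinal.{0} :=
  {γ | ThinMem F γ a}

theorem mem_thin {F : List Ordinal.{0} → Set Ordinal.{0}} {a : Set Ordinal.{0}} {γ : Ordinal.{0}} :
    γ ∈ thin F a ↔ γ ∈ a ∧ ∃ l : List Ordinal.{0}, (∀ x ∈ l, x < γ) ∧ ∃ η < γ,
      thin F a ∩ Iio γ = thin F (F l) ∩ Iio η := by
  have h : ∀ l, ∀ η < γ, ({x | ∃ _ : x < γ, ThinMem F x a} =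
      {x | ∃ _ : x < γ, ThinMem F x (F l) ∧ x < η} ↔
      thin F a ∩ Iio γ = thin F (F l) ∩ Iio η) := fun l η hη => by
    have h1 : {x | ∃ _ : x < γ, ThinMem F x a} = thin F a ∩ Iio γ := by
      ext x; simp [thin, and_comm]
    have h2 : {x | ∃ _ : x < γ, ThinMem F x (F l) ∧ x < η} = thin F (F l) ∩ Iio η := by
      ext x
      simp only [exists_prop, mem_ofPred_eq, thin, mem_inter_iff, mem_Iio]
      exact ⟨fun h => h.2, fun h => ⟨h.2.trans hη, h⟩⟩
    rw [h1, h2]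
  change ThinMem F γ a ↔ _
  rw [ThinMem, WellFounded.fix_eq]
  change (_ ∧ ∃ l : List Ordinal.{0}, _ ∧ ∃ η < γ, {x | ∃ _ : x < γ, ThinMem F x a} =
      {x | ∃ _ : x < γ, ThinMem F x (F l) ∧ x < η}) ↔ _
  refine and_congr_right fun _ => exists_congr fun l => and_congr_right fun _ =>
    exists_congr fun η => and_congr_right fun hη => h l η hη

theorem thin_subset (F : List Ordinal.{0} → Set Ordinal.{0}) (a : Set Ordinal.{0}) :
    thin F a ⊆ a := fun _ h => (mem_thin.1 h).1

theorem thin_inter_Iio (F : List Ordinal.{0} → Set Ordinal.{0}) (a : Set Ordinal.{0})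
    (η : Ordinal.{0}) : thin F (a ∩ Iio η) ∩ Iio η = thin F a ∩ Iio η := by
  have key : ∀ γ < η, (γ ∈ thin F (a ∩ Iio η) ↔ γ ∈ thin F a) := by
    intro γ
    induction γ using WellFoundedLT.induction with
    | ind γ ih =>
      intro hγ
      have h1 : thin F (a ∩ Iio η) ∩ Iio γ = thin F a ∩ Iio γ := by
        ext x
        exact and_congr_left fun hx => ih x hx (lt_trans hx hγ)
      rw [mem_thin, mem_thin, h1]
      exact and_congr_left fun _ => ⟨fun h => h.1, fun h => ⟨h, hγ⟩⟩
  ext x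
  exact and_congr_left fun hx => key x hx

theorem ApproxAt.thin_cofinal {F : List Ordinal.{0} → Set Ordinal.{0}} {δ : Ordinal.{0}}
    {A : Set Ordinal.{0}} (h : ApproxAt F δ A) : ∀ η < δ, ∃ a ∈ thin F A, η < a := by
  by_contra! hcon
  obtain ⟨η, hη, hb⟩ := hcon
  obtain ⟨a, ha, h1⟩ := h.2.1 η hη
  have hη1 : succ η < δ := (succ_le_of_lt h1).trans_lt (h.1 ha)
  obtain ⟨l, hl, hlA⟩ := h.2.2 _ hη1
  obtain ⟨m, hm, hlm⟩ := exists_list_bound (zero_le.trans_lt hη) l hl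
  obtain ⟨γ, hγ, hlt⟩ := h.2.1 (max (succ η) m) (max_lt hη1 hm)
  have h2 : succ η < γ := (le_max_left _ _).trans_lt hlt
  refine (hb γ (mem_thin.2 ⟨hγ, l, fun x hx => (hlm x hx).trans_lt
    ((le_max_right _ _).trans_lt hlt), _, h2, ?_⟩)).not_gt ((lt_succ η).trans h2)
  rw [← hlA, thin_inter_Iio]
  ext x
  exact ⟨fun hx => ⟨hx.1, lt_succ_of_le (hb x hx.1)⟩, fun hx => ⟨hx.1, lt_trans hx.2 h2⟩⟩

/-- `X` together with its limit points. -/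
def limClosure (X : Set Ordinal.{0}) : Set Ordinal.{0} := {γ | γ ∈ X ∨ IsAcc X γ}

theorem isClubIn_limClosure {X : Set Ordinal.{0}} {δ : Ordinal.{0}}
    (h : ∀ η < δ, ∃ a ∈ X, η < a) (hX : X ⊆ Iio δ) :
    IsClubIn (limClosure X ∩ Iio δ) δ := by
  refine ⟨inter_subset_right, fun s hs hne hlt => ⟨?_, hlt⟩, fun α hα => ?_⟩
  · by_cases hm : sSup s ∈ s
    · exact (hs hm).1
    have hb : BddAbove s := bddAbove_of_subset_Iio (hs.trans inter_subset_right)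
    have hlt : ∀ x ∈ s, x < sSup s := fun x hx =>
      (le_csSup hb hx).lt_of_ne fun h => hm (h ▸ hx)
    right
    obtain ⟨x, hx⟩ := hne
    refine ⟨zero_le.trans_lt (hlt x hx), fun η hη => ?_⟩
    obtain ⟨y, hy, hηy⟩ := exists_lt_of_lt_csSup' hη
    rcases (hs hy).1 with h1 | h1
    · exact ⟨y, h1, hηy, hlt y hy⟩
    · obtain ⟨e, he, h2, h3⟩ := h1.2 η hηy
      exact ⟨e, he, h2, h3.trans (hlt y hy)⟩
  · obtain ⟨a, ha, h1⟩ := h α hα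
    exact ⟨a, ⟨Or.inl ha, hX ha⟩, h1.le⟩

theorem limClosure_mono {X Y : Set Ordinal.{0}} (h : X ⊆ Y) : limClosure X ⊆ limClosure Y :=
  fun _ hx => hx.imp (fun hx => h hx) fun hx => hx.mono h

theorem limClosure_inter_Iio (X : Set Ordinal.{0}) (γ : Ordinal.{0}) :
    limClosure (X ∩ Iio γ) ∩ Iio γ = limClosure X ∩ Iio γ := by
  refine subset_antisymm (inter_subset_inter_left _ (limClosure_mono inter_subset_left)) ?_
  rintro x ⟨hx | hx, hxγ⟩
  · exact ⟨Or.inl ⟨hx, hxγ⟩, hxγ⟩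
  · refine ⟨Or.inr ⟨hx.1, fun η hη => ?_⟩, hxγ⟩
    obtain ⟨e, he, h1, h2⟩ := hx.2 η hη
    exact ⟨e, ⟨he, h2.trans hxγ⟩, h1, h2⟩

/-- The family of sets coded by ordinals below `θ`. -/
def codedFamily (F : List Ordinal.{0} → Set Ordinal.{0}) (θ : Ordinal.{0}) :
    Set (Set Ordinal.{0}) :=
  range fun p : List (Iio θ) × Iio θ =>
    limClosure (thin F (F (p.1.map Subtype.val)) ∩ Iio p.2.1) ∩ Iio θ

theorem mk_codedFamily_lt {c : Cardinal.{0}} (hc : ℵ₀ < c)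
    (F : List Ordinal.{0} → Set Ordinal.{0}) {θ : Ordinal.{0}} (hθ : θ < c.ord) :
    #(codedFamily F θ) < Cardinal.lift.{1} c := by
  have hc' : ℵ₀ < Cardinal.lift.{1} c := by simpa using hc
  refine mk_range_le.trans_lt ?_
  rw [mk_prod, Cardinal.lift_id, Cardinal.lift_id]
  exact Cardinal.mul_lt_of_lt hc'.le
    ((mk_list_le_max _).trans_lt (max_lt hc' (mk_Iio_lt hθ))) (mk_Iio_lt hθ)

theorem ApproxAt.inter_mem_codedFamily {F : List Ordinal.{0} → Set Ordinal.{0}}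
    {δ : Ordinal.{0}} {A : Set Ordinal.{0}} (hA : ∀ a ∈ A, IsSuccLimit a) {C : Set Ordinal.{0}}
    (hC : C = limClosure (thin F A) ∩ Iio δ) {γ : Ordinal.{0}} (hγ : γ ∈ C)
    (hlt : sSup (C ∩ Iio γ) < γ) : ∃ θ < γ, C ∩ Iio γ ∈ codedFamily F θ := by
  have hb : BddAbove (C ∩ Iio γ) := bddAbove_of_subset_Iio inter_subset_right
  have hγδ : γ < δ := by rw [hC] at hγ; exact hγ.2
  have hT : γ ∈ thin F A := by
    have h1 := hγ
    rw [hC] at h1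
    refine h1.1.resolve_right fun h2 => ?_
    obtain ⟨e, he, h3, h4⟩ := h2.2 _ hlt
    refine h3.not_ge (le_csSup hb ⟨?_, h4⟩)
    rw [hC]
    exact ⟨Or.inl he, h4.trans hγδ⟩
  obtain ⟨hγA, l, hl, η, hη, heq⟩ := mem_thin.1 hT
  have hlim := hA γ hγA
  obtain ⟨m, hm, hlm⟩ := exists_list_bound (zero_le.trans_lt hlt) l hl
  have hM := max_lt (max_lt hm hη) hlt
  set M := max (max m η) (sSup (C ∩ Iio γ)) with hMdef
  have hlt' : ∀ x ∈ l, x < succ M := fun x hx => lt_succ_of_le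
    ((hlm x hx).trans ((le_max_left _ _).trans (le_max_left _ _)))
  refine ⟨succ M, hlim.succ_lt hM, ⟨⟨l.attach.map fun x => ⟨x.1, hlt' x.1 x.2⟩, ⟨η, mem_Iio.2 <| lt_succ_of_le
    ((le_max_right _ _).trans (le_max_left _ _))⟩⟩, ?_⟩⟩
  have hl' : (l.attach.map fun x => (⟨x.1, hlt' x.1 x.2⟩ : Iio (succ M))).map Subtype.val = l := by
    simp [List.map_map, Function.comp_def]
  dsimp only
  rw [hl', ← heq]
  have h1 : limClosure (thin F A ∩ Iio γ) ∩ Iio γ = C ∩ Iio γ := by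
    rw [limClosure_inter_Iio, hC, inter_assoc, Iio_inter_Iio, min_eq_right hγδ.le]
  ext x
  constructor
  · rintro ⟨hx, hxM⟩
    rw [← h1]
    exact ⟨hx, lt_trans hxM (hlim.succ_lt hM)⟩
  · intro hx
    refine ⟨?_, lt_succ_of_le ((le_csSup hb hx).trans (le_max_right _ _))⟩
    rw [← h1] at hx
    exact hx.1

/-- The conclusion of the main theorem follows from a family of sets with coded initial
segments. -/
theorem exists_tight_of_approx {κ c : Cardinal.{0}} (hκ : κ.IsRegular) (hc : c.IsRegular)
    (hlt : succ κ < c) {F : List Ordinal.{0} → Set Ordinal.{0}}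
    (hF : ∀ E, IsClubIn E c.ord → ∃ δ ∈ E, δ.cof = κ ∧
      ∃ A : Set Ordinal.{0}, #A ≤ Cardinal.lift.{1} κ ∧ ApproxAt F δ A) :
    ∃ (S : Set Ordinal.{0}) (C : Ordinal.{0} → Set Ordinal.{0})
      (P : Ordinal.{0} → Set (Set Ordinal.{0})),
      (∀ δ ∈ S, δ < c.ord ∧ δ.cof = κ) ∧
      (∀ E : Set Ordinal.{0}, IsClubIn E c.ord → (S ∩ E).Nonempty) ∧
      (∀ δ ∈ S, IsClubIn (C δ) δ) ∧
      (∀ E : Set Ordinal.{0}, IsClubIn E c.ord → ∃ δ ∈ S, C δ ⊆ E) ∧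
      (∀ α : Ordinal.{0}, α < c.ord →
        (∀ x ∈ P α, x ⊆ Set.Iio α) ∧ Cardinal.mk ↥(P α) < Cardinal.lift.{1} c) ∧
      (∀ δ ∈ S, ∀ α ∈ C δ, sSup (C δ ∩ Set.Iio α) < α →
        ∃ β < α, (C δ ∩ Set.Iio α) ∈ P β) := by
  have hunc : ℵ₀ < c := (hκ.1.trans_lt (lt_succ κ)).trans hlt
  let S₀ : Set Ordinal.{0} := {δ | δ.cof = κ ∧ ∃ A : Set Ordinal.{0}, #A ≤ Cardinal.lift.{1} κ ∧ ApproxAt F δ A}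
  have hS₀ : ∀ δ ∈ S₀, ∃ A : Set Ordinal.{0}, #A ≤ Cardinal.lift.{1} κ ∧ ApproxAt F δ A := fun δ h => h.2
  choose! A hAc hA using hS₀
  obtain ⟨E, hE, hElim, hguess⟩ := exists_glue_guess hκ hc hlt (S := S₀)
    (fun D hD => let ⟨δ, h1, h2⟩ := hF D hD; ⟨δ, h2, h1⟩) (fun δ hδ => (hA δ hδ).1) hAc
  let G := glueCode E F
  let B : Ordinal.{0} → Set Ordinal.{0} := fun δ => glue E (A δ)
  let S : Set Ordinal.{0} := {δ | δ ∈ S₀ ∧ δ < c.ord ∧ IsAcc E δ}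
  let C : Ordinal.{0} → Set Ordinal.{0} := fun δ => limClosure (thin G (B δ)) ∩ Iio δ
  have hB : ∀ δ ∈ S, ApproxAt G δ (B δ) := fun δ hδ => (hA δ hδ.1).glue hδ.2.2
  have hBlim : ∀ δ ∈ S, ∀ b ∈ B δ, IsSuccLimit b := fun δ hδ b hb =>
    hElim b (glue_subset hE hδ.2.1.le (hA δ hδ.1).1 hb)
  have hClub : ∀ δ ∈ S, IsClubIn (C δ) δ := fun δ hδ =>
    isClubIn_limClosure (hB δ hδ).thin_cofinal ((thin_subset _ _).trans (hB δ hδ).1)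
  have hG : ∀ D : Set Ordinal.{0}, IsClubIn D c.ord → ∃ δ ∈ S, C δ ⊆ D := fun D hD => by
    obtain ⟨δ, h1, h2, h3, h4⟩ := hguess D hD
    refine ⟨δ, ⟨h1, h2, h3⟩, ?_⟩
    rintro x ⟨hx | hx, hxδ⟩
    · exact h4 (thin_subset _ _ hx)
    · exact mem_of_acc hD (lt_trans hxδ h2) (hx.mono ((thin_subset _ _).trans h4))
  refine ⟨S, C, codedFamily G, fun δ hδ => ⟨hδ.2.1, hδ.1.1⟩, fun D hD => ?_, hClub, hG,
    fun α hα => ⟨?_, mk_codedFamily_lt hunc G hα⟩, fun δ hδ α hα hlt =>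
      ApproxAt.inter_mem_codedFamily (hBlim δ hδ) rfl hα hlt⟩
  · obtain ⟨δ, hδ, hCD⟩ := hG D hD
    refine ⟨δ, hδ, mem_of_acc hD hδ.2.1 ⟨hδ.2.2.1, fun η hη => ?_⟩⟩
    obtain ⟨β, hβ, h⟩ := (hClub δ hδ).2.2 (succ η) (hδ.2.2.isSuccLimit.succ_lt hη)
    exact ⟨β, hCD hβ, (lt_succ η).trans_le h, hβ.2⟩
  · rintro _ ⟨p, rfl⟩
    exact inter_subset_right

theorem exists_image_Iio_eq {c : Cardinal.{0}} {s : Set Ordinal.{0}} (hne : s.Nonempty)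
    (hs : #s ≤ Cardinal.lift.{1} c) : ∃ g : Ordinal.{0} → Ordinal.{0}, g '' Iio c.ord = s := by
  have h1 : #s ≤ #(Iio c.ord) := by rwa [Cardinal.mk_Iio_ordinal, card_ord]
  obtain ⟨f⟩ := Cardinal.le_def _ _ |>.1 h1
  have : Nonempty s := hne.to_subtype
  classical
  refine ⟨fun x => if h : x < c.ord then (Function.invFun f ⟨x, h⟩ : s) else 0, ?_⟩
  ext x
  constructor
  · rintro ⟨y, hy, rfl⟩
    simp [mem_Iio.1 hy]
  · intro hx
    refine ⟨f ⟨x, hx⟩, (f ⟨x, hx⟩).2, ?_⟩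
    have : (f ⟨x, hx⟩ : Ordinal.{0}) < c.ord := (f ⟨x, hx⟩).2
    simp [this, Function.leftInverse_invFun f.injective _]

theorem exists_cofinal (δ : Ordinal.{0}) : ∃ A : Set Ordinal.{0}, A ⊆ Iio δ ∧
    (∀ η < δ, ∃ a ∈ A, η ≤ a) ∧ #A ≤ Cardinal.lift.{1} δ.cof := by
  obtain ⟨s, hs, hc⟩ := Order.exists_cof_eq (Iio δ)
  refine ⟨Subtype.val '' s, by rintro _ ⟨x, -, rfl⟩; exact x.2, fun η hη => ?_, ?_⟩
  · obtain ⟨a, ha, h⟩ := hs ⟨η, hη⟩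
    exact ⟨a, ⟨a, ha, rfl⟩, h⟩
  · rw [Ordinal.lift_cof, ← Ordinal.cof_Iio, ← hc]
    exact mk_image_le

theorem exists_cofinal_guess {κ μ : Cardinal.{0}} (hκ : κ.IsRegular) (hμ : μ.IsRegular)
    (hlt : succ κ < μ) : ∃ (S : Set Ordinal.{0}) (A : Ordinal.{0} → Set Ordinal.{0}),
      (∀ α ∈ S, α < μ.ord ∧ α.cof = κ ∧ A α ⊆ Iio α ∧ (∀ η < α, ∃ a ∈ A α, η < a) ∧
        #(A α) ≤ Cardinal.lift.{1} κ) ∧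
      ∀ D, IsClubIn D μ.ord → ∃ α ∈ S, A α ⊆ D := by
  choose A hA hcof hcard using exists_cofinal
  obtain ⟨E, hE, -, hg⟩ := exists_glue_guess hκ hμ hlt (S := {α | α.cof = κ}) (A := A)
    (fun D hD => let ⟨δ, h1, h2⟩ := exists_mem_cof_eq hκ hμ ((lt_succ κ).trans hlt) hD
      ⟨δ, h2, h1⟩) (fun δ _ => hA δ) (fun δ hδ => by
        have := hcard δ
        rwa [show δ.cof = κ from hδ] at this)
  refine ⟨{α | α.cof = κ ∧ α < μ.ord ∧ IsAcc E α}, fun α => glue E (A α), fun α hα =>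
    ⟨hα.2.1, hα.1, glue_subset_Iio (hA α), glue_cofinal hα.2.2 fun η hη => ?_, ?_⟩,
    fun D hD => ?_⟩
  · obtain ⟨a, ha, h⟩ := hcof α _ (hα.2.2.isSuccLimit.succ_lt hη)
    exact ⟨a, ha, (lt_succ η).trans_le h⟩
  · have := hcard α
    rw [hα.1] at this
    exact (mk_glue_le _ _).trans this
  · obtain ⟨δ, h1, h2, h3, h4⟩ := hg D hD
    exact ⟨δ, ⟨h1, h2, h3⟩, h4⟩

/-- Codes for initial segments in the case of a double successor. -/
def succCode (g : Ordinal.{0} → Ordinal.{0} → Ordinal.{0}) : List Ordinal.{0} → Set Ordinal.{0}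
  | [β, j, η] => g β '' Iio j ∩ Iio β ∩ Iio η
  | _ => ∅

theorem exists_approx_of_eq_succ {κ : Cardinal.{0}} (hκ : κ.IsRegular) :
    ∃ F, ∀ E, IsClubIn E (succ (succ κ)).ord → ∃ δ ∈ E, δ.cof = κ ∧
      ∃ A : Set Ordinal.{0}, #A ≤ Cardinal.lift.{1} κ ∧ ApproxAt F δ A := by
  have hρ := isRegular_succ hκ.1
  set ρ := succ κ with hρdef
  have hρ' : ρ ≠ ℵ₀ := (hκ.1.trans_lt (lt_succ κ)).ne'
  have hc := isRegular_succ hρ.1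
  set c := succ ρ with hcdef
  have hc' : c ≠ ℵ₀ := (hρ.1.trans_lt (lt_succ ρ)).ne'
  have hl : ρ.ord < c.ord := Cardinal.ord_lt_ord.2 (lt_succ ρ)
  have hg : ∀ β : Ordinal.{0}, ∃ g : Ordinal.{0} → Ordinal.{0}, 0 < β → β < c.ord →
      g '' Iio ρ.ord = Iio β := fun β => by
    by_cases h : 0 < β ∧ β < c.ord
    · obtain ⟨g, hg⟩ := exists_image_Iio_eq (c := ρ) (s := Iio β) ⟨0, h.1⟩ (by
        rw [Cardinal.mk_Iio_ordinal, Cardinal.lift_le]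
        exact lt_succ_iff.1 (Cardinal.lt_ord.1 h.2))
      exact ⟨g, fun _ _ => hg⟩
    · exact ⟨id, fun h1 h2 => (h ⟨h1, h2⟩).elim⟩
  choose g hg using hg
  refine ⟨succCode g, fun E₀ hE₀ => ?_⟩
  have hE := isClubIn_inter hc hc' hE₀ (isClubIn_Ioo hc hl)
  set E := E₀ ∩ Ioo ρ.ord c.ord with hEdef
  obtain ⟨ξ, hξ⟩ := exists_fast_seq hc hE (fun _ _ => 0) fun _ _ _ _ => hc.ord_pos
  have hmono : ∀ k < ρ.ord, ∀ j < k, ξ j < ξ k := fun k hk => (hξ k (hk.trans hl)).2.1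
  have hρlim := Cardinal.isSuccLimit_ord hρ.1
  set δ := lsup ξ ρ.ord with hδ
  have hδE : δ ∈ E := lsup_mem hc hE hl hρ.ord_pos fun j hj => (hξ j (hj.trans hl)).1
  have hδc : δ < c.ord := hE.1 hδE
  have hξδ : ∀ i < ρ.ord, ξ i < δ := fun i hi => lt_lsup hρlim hmono hi
  have hgδ := hg δ (zero_le.trans_lt hδE.2.1) hδc
  have hmemδ : ∀ x < δ, ∃ i < ρ.ord, g δ i = x := fun x hx => by
    have : x ∈ g δ '' Iio ρ.ord := hgδ ▸ hx
    exact this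
  have hltδ : ∀ i < ρ.ord, g δ i < δ := fun i hi => by
    have : g δ i ∈ Iio δ := hgδ ▸ ⟨i, hi, rfl⟩
    exact this
  have hex : ∀ i k, ∃ m, i < ρ.ord → k < ρ.ord → m < ρ.ord ∧
      (0 < g δ i → ∃ i' ≤ m, g δ i' = g (g δ i) k) ∧
      (g δ k < g δ i → ∃ k' ≤ m, g (g δ i) k' = g δ k) ∧
      (∃ p ≤ m, g δ p = ξ i) ∧ ∃ q ≤ m, g δ i ≤ ξ q := by
    intro i k
    by_cases hik : i < ρ.ord ∧ k < ρ.ord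
    · obtain ⟨hi, hk⟩ := hik
      have hgi : 0 < g δ i → g (g δ i) '' Iio ρ.ord = Iio (g δ i) := fun h =>
        hg _ h ((hltδ i hi).trans hδc)
      obtain ⟨a, ha, ha'⟩ : ∃ a < ρ.ord, 0 < g δ i → g δ a = g (g δ i) k := by
        by_cases h : 0 < g δ i
        · have h1 : g (g δ i) k ∈ Iio (g δ i) := hgi h ▸ ⟨k, hk, rfl⟩
          obtain ⟨a, ha, h2⟩ := hmemδ _ (lt_trans h1 (hltδ i hi))
          exact ⟨a, ha, fun _ => h2⟩
        · exact ⟨0, hρ.ord_pos, fun h' => (h h').elim⟩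
      obtain ⟨b, hb, hb'⟩ : ∃ b < ρ.ord, g δ k < g δ i → g (g δ i) b = g δ k := by
        by_cases h : g δ k < g δ i
        · have h1 : g δ k ∈ g (g δ i) '' Iio ρ.ord := hgi (zero_le.trans_lt h) ▸ h
          obtain ⟨b, hb, h2⟩ := h1
          exact ⟨b, hb, fun _ => h2⟩
        · exact ⟨0, hρ.ord_pos, fun h' => (h h').elim⟩
      obtain ⟨p, hp, hp'⟩ := hmemδ _ (hξδ i hi)
      obtain ⟨q, hq, hq'⟩ := exists_of_lt_lsup (hltδ i hi)
      exact ⟨max (max a b) (max p q), fun _ _ => ⟨max_lt (max_lt ha hb) (max_lt hp hq),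
        fun h => ⟨a, by simp, ha' h⟩, fun h => ⟨b, by simp, hb' h⟩, ⟨p, by simp, hp'⟩,
        ⟨q, by simp, hq'.le⟩⟩⟩
    · exact ⟨0, fun h1 h2 => (hik ⟨h1, h2⟩).elim⟩
  choose H hH using hex
  obtain ⟨j, ⟨hjρ, hj⟩, hjcof⟩ := exists_mem_cof_eq hκ hρ (lt_succ κ)
    (isClubIn_closed hρ hρ' H fun i hi k hk => (hH i k hi hk).1)
  have hjlim : IsSuccLimit j := by rw [← Ordinal.one_lt_cof_iff, hjcof]; exact one_lt_aleph0.trans_le hκ.1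
  have hjc := hjρ.trans hl
  have hδ'E : lsup ξ j ∈ E :=
    lsup_mem hc hE hjc hjlim.bot_lt fun i hi => (hξ i (hi.trans hjc)).1
  have hmonoj : ∀ k < j, ∀ i < k, ξ i < ξ k := fun k hk => hmono k (hk.trans hjρ)
  have hcofinal : ∀ η < lsup ξ j, ∃ i < j, η < g δ i := fun η hη => by
    obtain ⟨i, hi, h⟩ := exists_of_lt_lsup hη
    obtain ⟨p, hp, hp'⟩ := (hH i i (hi.trans hjρ) (hi.trans hjρ)).2.2.2.1
    exact ⟨p, hp.trans_lt (hj i hi i hi), hp' ▸ h⟩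
  have hsub : ∀ i < j, g δ i < lsup ξ j := fun i hi => by
    obtain ⟨q, hq, hq'⟩ := (hH i i (hi.trans hjρ) (hi.trans hjρ)).2.2.2.2
    exact hq'.trans_lt (lt_lsup hjlim hmonoj (hq.trans_lt (hj i hi i hi)))
  refine ⟨lsup ξ j, hδ'E.1, by rw [cof_lsup hjlim hmonoj, hjcof], g δ '' Iio j, ?_, ?_, ?_, ?_⟩
  · refine mk_image_le.trans ?_
    rw [Cardinal.mk_Iio_ordinal, Cardinal.lift_le]
    exact lt_succ_iff.1 (Cardinal.lt_ord.1 hjρ)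
  · rintro _ ⟨i, hi, rfl⟩
    exact hsub i hi
  · intro η hη
    obtain ⟨i, hi, h⟩ := hcofinal η hη
    exact ⟨_, ⟨i, hi, rfl⟩, h⟩
  · intro γ hγ
    obtain ⟨i, hi, h⟩ := hcofinal γ hγ
    refine ⟨[g δ i, j, γ], ?_, ?_⟩
    · simpa using ⟨hsub i hi, hjρ.trans hδ'E.2.1, hγ⟩
    rw [succCode]
    ext x
    constructor
    · rintro ⟨⟨k, hk, rfl⟩, hx⟩
      have hlt := lt_trans (mem_Iio.1 hx) h
      obtain ⟨k', hk', h2⟩ := (hH i k (hi.trans hjρ) (lt_trans hk hjρ)).2.2.1 hlt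
      exact ⟨⟨⟨k', hk'.trans_lt (hj i hi k hk), h2⟩, hlt⟩, hx⟩
    · rintro ⟨⟨⟨k, hk, rfl⟩, -⟩, hx⟩
      obtain ⟨i', hi', h2⟩ := (hH i k (hi.trans hjρ) (lt_trans hk hjρ)).2.1 (zero_le.trans_lt h)
      exact ⟨⟨i', hi'.trans_lt (hj i hi k hk), h2⟩, hx⟩

/-- Codes for initial segments obtained by transferring the sets `A α` along the cofinal maps
`e δ`. -/
def transferCode (e : Ordinal.{0} → Ordinal.{0} → Ordinal.{0})
    (A : Ordinal.{0} → Set Ordinal.{0}) : List Ordinal.{0} → Set Ordinal.{0}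
  | [δ, α, j] => lsup (e δ) '' (A α ∩ Iio j)
  | _ => ∅

theorem exists_approx_of_lt {κ c : Cardinal.{0}} (hκ : κ.IsRegular) (hc : c.IsRegular)
    (hlt : succ (succ κ) < c) :
    ∃ F, ∀ E, IsClubIn E c.ord → ∃ δ ∈ E, δ.cof = κ ∧
      ∃ A : Set Ordinal.{0}, #A ≤ Cardinal.lift.{1} κ ∧ ApproxAt F δ A := by
  have hρ := isRegular_succ hκ.1
  have hμ := isRegular_succ hρ.1
  obtain ⟨S, A, hS, hguess⟩ := exists_cofinal_guess hκ hμ (lt_succ _)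
  set μ := succ (succ κ) with hμdef
  have hμ' : μ ≠ ℵ₀ := (hρ.1.trans_lt (lt_succ _)).ne'
  have hc' : c ≠ ℵ₀ := (hμ.1.trans_lt hlt).ne'
  have hl : μ.ord < c.ord := Cardinal.ord_lt_ord.2 hlt
  have he : ∀ δ : Ordinal.{0}, ∃ e : Ordinal.{0} → Ordinal.{0}, δ.cof = μ →
      (∀ i < μ.ord, e i < δ) ∧ ∀ η < δ, ∃ i < μ.ord, η ≤ e i := fun δ => by
    by_cases hδ : δ.cof = μ
    · obtain ⟨s, hs, hcof, hcard⟩ := exists_cofinal δ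
      rw [hδ] at hcard
      have h0 : 0 < δ := by
        rw [← Ordinal.cof_pos, hδ]
        exact hμ.pos
      obtain ⟨a, ha, -⟩ := hcof 0 h0
      obtain ⟨e, he⟩ := exists_image_Iio_eq ⟨a, ha⟩ hcard
      refine ⟨e, fun _ => ⟨fun i hi => hs (he ▸ ⟨i, hi, rfl⟩), fun η hη => ?_⟩⟩
      obtain ⟨b, hb, hηb⟩ := hcof η hη
      rw [← he] at hb
      obtain ⟨i, hi, rfl⟩ := hb
      exact ⟨i, hi, hηb⟩
    · exact ⟨id, fun h => (hδ h).elim⟩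
  choose e he using he
  set F := transferCode e A with hF
  refine ⟨F, fun E₀ hE₀ => ?_⟩
  have hE := isClubIn_inter hc hc' hE₀ (isClubIn_Ioo hc hl)
  set E := E₀ ∩ Ioo μ.ord c.ord with hEdef
  have hN : ∀ x : Set Ordinal.{0}, ∃ n < c.ord,
      (∃ l : List Ordinal.{0}, (∀ y ∈ l, y < c.ord) ∧ F l = x) →
        ∃ l : List Ordinal.{0}, (∀ y ∈ l, y < n) ∧ F l = x := fun x => by
    by_cases h : ∃ l : List Ordinal.{0}, (∀ y ∈ l, y < c.ord) ∧ F l = x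
    · obtain ⟨l, hl, hlx⟩ := h
      obtain ⟨m, hm, hlm⟩ := exists_list_bound hc.ord_pos l hl
      exact ⟨m + 1, succ_lt_ord hc hm, fun _ => ⟨l, fun y hy =>
        (hlm y hy).trans_lt (lt_add_one m), hlx⟩⟩
    · exact ⟨0, hc.ord_pos, fun h' => (h h').elim⟩
  choose N hNc hN using hN
  let T : (Ordinal.{0} → Ordinal.{0}) → Ordinal.{0} × Ordinal.{0} → Ordinal.{0} := fun f p =>
    N (lsup f '' (A p.1 ∩ Iio p.2))
  obtain ⟨ξ, hξ⟩ := exists_fast_seq hc hE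
    (fun i f => sSup (T f '' (Iio μ.ord ×ˢ Iio (i + 1)))) fun i hi f _ => by
      refine sSup_lt_ord hc (mk_image_le.trans_lt ?_) ?_
      · rw [mk_setProd]
        exact Cardinal.mul_lt_of_lt (by simpa using hc.1) (mk_Iio_lt hl)
          (mk_Iio_lt (succ_lt_ord hc hi))
      · rintro _ ⟨p, -, rfl⟩
        exact hNc _
  have hmono : ∀ k < μ.ord, ∀ j < k, ξ j < ξ k := fun k hk => (hξ k (hk.trans hl)).2.1
  have hμlim := Cardinal.isSuccLimit_ord hμ.1
  set δ := lsup ξ μ.ord with hδ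
  have hδE : δ ∈ E := lsup_mem hc hE hl hμ.ord_pos fun j hj => (hξ j (hj.trans hl)).1
  have hδc : δ < c.ord := hE.1 hδE
  have hξδ : ∀ i < μ.ord, ξ i < δ := fun i hi => lt_lsup hμlim hmono hi
  have hδcof : δ.cof = μ := by rw [hδ, cof_lsup hμlim hmono, hμ.cof_ord]
  obtain ⟨he1, he2⟩ := he δ hδcof
  choose! p hp hp' using fun i (hi : i < μ.ord) => he2 _ (hξδ i hi)
  choose! q hq hq' using fun i (hi : i < μ.ord) => exists_of_lt_lsup (he1 i hi)
  obtain ⟨α, hαS, hαD⟩ := hguess _ (isClubIn_closed hμ hμ' (fun i _ => max (p i) (q i))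
    fun i hi _ _ => max_lt (hp i hi) (hq i hi))
  obtain ⟨hαμ, hαcof, hAα, hAcof, hAcard⟩ := hS α hαS
  have hagree : ∀ k ∈ A α, lsup (e δ) k = lsup ξ k := fun k hk => by
    obtain ⟨hkμ, hk'⟩ := hαD hk
    refine le_antisymm (lsup_le fun i hi => ?_) (lsup_le fun i hi => ?_)
    · exact (hq' i (hi.trans hkμ)).le.trans
        (le_lsup ξ ((le_max_right _ _).trans_lt (hk' i hi i hi)))
    · exact (hp' i (hi.trans hkμ)).trans
        (le_lsup (e δ) ((le_max_left _ _).trans_lt (hk' i hi i hi)))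
  have hαlim : IsSuccLimit α := by rw [← Ordinal.one_lt_cof_iff, hαcof]; exact one_lt_aleph0.trans_le hκ.1
  have hαc := hαμ.trans hl
  have hmonoα : ∀ k < α, ∀ i < k, ξ i < ξ k := fun k hk => hmono k (hk.trans hαμ)
  have hδ'E : lsup ξ α ∈ E :=
    lsup_mem hc hE hαc hαlim.bot_lt fun i hi => (hξ i (hi.trans hαc)).1
  refine ⟨lsup ξ α, hδ'E.1, by rw [cof_lsup hαlim hmonoα, hαcof], lsup ξ '' A α,
    mk_image_le.trans hAcard, ?_, ?_, ?_⟩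
  · rintro _ ⟨k, hk, rfl⟩
    exact (hξ k (lt_trans (hAα hk) hαc)).2.2.1.trans_le (le_lsup ξ (hAα hk))
  · intro η hη
    obtain ⟨i, hi, h⟩ := exists_of_lt_lsup hη
    obtain ⟨k, hk, hik⟩ := hAcof i hi
    exact ⟨_, ⟨k, hk, rfl⟩, h.trans_le (le_lsup ξ hik)⟩
  · intro γ hγ
    obtain ⟨j, hjα, hγj, hjmin⟩ : ∃ j < α, γ ≤ lsup ξ j ∧ ∀ k < j, lsup ξ k < γ := by
      obtain ⟨i, hi, h⟩ := exists_of_lt_lsup hγ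
      have hi1 : γ ≤ lsup ξ (succ i) := h.le.trans (le_lsup ξ (lt_succ i))
      obtain ⟨j, hj⟩ := exists_minimal_of_wellFoundedLT (fun j => γ ≤ lsup ξ j) ⟨_, hi1⟩
      refine ⟨j, ?_, hj.1, fun k hk => ?_⟩
      · refine lt_of_le_of_lt ?_ (hαlim.succ_lt hi)
        exact (le_total _ _).elim id fun h => hj.2 hi1 h
      · by_contra! hle
        exact hk.not_ge (hj.2 hle hk.le)
    have heq : lsup ξ '' A α ∩ Iio γ = lsup ξ '' (A α ∩ Iio j) := by
      ext x
      constructor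
      · rintro ⟨⟨k, hk, rfl⟩, hx⟩
        refine ⟨k, ⟨hk, ?_⟩, rfl⟩
        by_contra! hjk
        exact (hγj.trans (lsup_mono ξ (not_lt.1 hjk))).not_gt hx
      · rintro ⟨k, hk, rfl⟩
        exact ⟨⟨k, hk.1, rfl⟩, hjmin k hk.2⟩
    have hFeq : F [δ, α, j] = lsup ξ '' (A α ∩ Iio j) :=
      image_congr fun k hk => hagree k hk.1
    obtain ⟨l, hl, hlF⟩ := hN (lsup ξ '' (A α ∩ Iio j))
      ⟨[δ, α, j], by simpa using ⟨hδc, hαc, hjα.trans hαc⟩, hFeq⟩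
    refine ⟨l, fun x hx => ?_, heq.trans hlF.symm⟩
    have hB := (hξ j (hjα.trans hαc)).2.2.2
    have hcongr : lsup (fun i => if i < j then ξ i else 0) '' (A α ∩ Iio j) =
        lsup ξ '' (A α ∩ Iio j) := image_congr fun k hk =>
      lsup_congr fun i hi => if_pos (lt_trans hi hk.2)
    have hle : N (lsup ξ '' (A α ∩ Iio j)) ≤
        sSup (T (fun i => if i < j then ξ i else 0) '' (Iio μ.ord ×ˢ Iio (j + 1))) := by
      rw [← hcongr]
      exact le_csSup ⟨c.ord, by rintro _ ⟨p, -, rfl⟩; exact (hNc _).le⟩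
        ⟨(α, j), ⟨hαμ, lt_add_one j⟩, rfl⟩
    exact (hl x hx).trans ((hle.trans_lt hB).trans (lt_lsup hαlim hmonoα hjα))

end TightClub

/-- For regular cardinals `κ⁺ < lam` there is a truly tight `(κ, lam)` club
guessing sequence: a stationary `S ⊆ S^lam_κ`, a club guessing sequence `⟨C_δ : δ ∈ S⟩`
and a sequence `⟨P_α : α < lam⟩` of families of subsets of `α`, each of cardinality `< lam`,
such that whenever `δ ∈ S` and `α ∈ C_δ` with `sup(C_δ ∩ α) < α`, the set `C_δ ∩ α`
belongs to `⋃_{β<α} P_β`. -/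
theorem stmt_2 (κ lam : Cardinal.{0}) (hκ : κ.IsRegular) (hlam : lam.IsRegular)
    (h : Order.succ κ < lam) :
    ∃ (S : Set Ordinal.{0}) (C : Ordinal.{0} → Set Ordinal.{0})
      (P : Ordinal.{0} → Set (Set Ordinal.{0})),
      (∀ δ ∈ S, δ < lam.ord ∧ δ.cof = κ) ∧
      (∀ E : Set Ordinal.{0}, IsClubIn E lam.ord → (S ∩ E).Nonempty) ∧
      (∀ δ ∈ S, IsClubIn (C δ) δ) ∧
      (∀ E : Set Ordinal.{0}, IsClubIn E lam.ord → ∃ δ ∈ S, C δ ⊆ E) ∧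
      (∀ α : Ordinal.{0}, α < lam.ord →
        (∀ x ∈ P α, x ⊆ Set.Iio α) ∧ Cardinal.mk ↥(P α) < Cardinal.lift.{1} lam) ∧
      (∀ δ ∈ S, ∀ α ∈ C δ, sSup (C δ ∩ Set.Iio α) < α →
        ∃ β < α, (C δ ∩ Set.Iio α) ∈ P β) := by
  obtain rfl | h' := (Order.succ_le_of_lt h).eq_or_lt
  · obtain ⟨F, hF⟩ := TightClub.exists_approx_of_eq_succ hκ
    exact TightClub.exists_tight_of_approx hκ hlam h hF
  · obtain ⟨F, hF⟩ := TightClub.exists_approx_of_lt hκ hlam h'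
    exact TightClub.exists_tight_of_approx hκ hlam h hF
end

section
/- Suppose that κ and λ are regular cardinals with λ < 2^κ, and that either (a) κ = ℵ₀, λ = ℵ₁ and there exists a club guessing sequence ⟨C_δ : δ ∈ S^{ℵ₁}_{ℵ₀}⟩, or (b) κ⁺ < λ. Then for every family {L_i : i < i*} of linear orders, each of cardinality λ, with i* < 2^κ, there exists a linear order of cardinality λ that admits no order-preserving injection into any L_i. In particular there is no universal linear order of cardinality λ, and the universality number of the class of linear orders of cardinality λ is at least 2^κ. -/
/-- There is a club guessing sequence `⟨C_δ : δ ∈ S^{ℵ₁}_{ℵ₀}⟩` on `ω₁`. -/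
def ExistsClubGuessingOnOmega1 : Prop :=
  ∃ C : Ordinal.{0} → Set Ordinal.{0},
    (∀ δ : Ordinal.{0}, δ < (Cardinal.aleph 1).ord → δ.cof = Cardinal.aleph0 →
      IsClubIn (C δ) δ) ∧
    (∀ E : Set Ordinal.{0}, IsClubIn E (Cardinal.aleph 1).ord →
      ∃ δ : Ordinal.{0}, δ < (Cardinal.aleph 1).ord ∧ δ.cof = Cardinal.aleph0 ∧ C δ ⊆ E)

namespace KojmanShelah

open Cardinal Set

/-- A linear order that looks like the initial ordinal of the regular cardinal `c`. -/
structure RegLike (c : Cardinal.{0}) (Λ : Type) [LinearOrder Λ] : Prop where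
  reg : c.IsRegular
  iio : ∀ a : Λ, #(Iio a) < c
  bdd : ∀ s : Set Λ, #s < c → ∃ b, ∀ x ∈ s, x < b
  card : #Λ = c

section Basic

variable {Λ : Type} [LinearOrder Λ]

/-- `γ` is a limit point of `E` from below. -/
def LimPt (E : Set Λ) (γ : Λ) : Prop :=
  (∃ x, x < γ) ∧ ∀ x < γ, ∃ y ∈ E, x < y ∧ y < γ

/-- `E` is closed and unbounded. -/
def Club (E : Set Λ) : Prop :=
  (∀ x, ∃ y ∈ E, x < y) ∧ ∀ γ, LimPt E γ → γ ∈ E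

/-- All fibers of the level function `l` below a given level have cardinality less than `c`. -/
def SmallFibers (c : Cardinal.{0}) {X : Type} (l : X → Λ) : Prop :=
  ∀ γ, #{x | l x < γ} < c

/-- `R` is a cofinal subset of `δ` of order type `k`, where `k` is the cofinality of `δ`. -/
structure Ladder (k : Cardinal.{0}) (δ : Λ) (R : Set Λ) : Prop where
  pos : ∃ x, x < δ
  sub : ∀ x ∈ R, x < δ
  cofinal : ∀ x < δ, ∃ y ∈ R, x < y
  init : ∀ γ < δ, #(R ∩ Iio γ : Set Λ) < k
  card : #R ≤ k
  cofge : ∀ s : Set Λ, (∀ x ∈ s, x < δ) → #s < k → ∃ b < δ, ∀ x ∈ s, x < b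

theorem LimPt.mono {E F : Set Λ} {γ : Λ} (h : LimPt E γ) (hEF : E ⊆ F) : LimPt F γ :=
  ⟨h.1, fun x hx => let ⟨y, hy, h1⟩ := h.2 x hx; ⟨y, hEF hy, h1⟩⟩

theorem LimPt.acc {E : Set Λ} {γ : Λ} (h : LimPt {x | LimPt E x} γ) : LimPt E γ := by
  refine ⟨h.1, fun x hx => ?_⟩
  obtain ⟨y, hy, hxy, hyg⟩ := h.2 x hx
  obtain ⟨z, hz, h1, h2⟩ := hy.2 x hxy
  exact ⟨z, hz, h1, h2.trans hyg⟩

theorem Ladder.limPt {k : Cardinal.{0}} {δ : Λ} {R : Set Λ} (h : Ladder k δ R) : LimPt R δ :=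
  ⟨h.pos, fun x hx => let ⟨y, hy, h1⟩ := h.cofinal x hx; ⟨y, hy, h1, h.sub y hy⟩⟩

theorem SmallFibers.id {c : Cardinal.{0}} (hΛ : RegLike c Λ) : SmallFibers c (fun x : Λ => x) :=
  fun γ => hΛ.iio γ

theorem SmallFibers.const {c : Cardinal.{0}} {X : Type} (hX : #X < c) (a : Λ) :
    SmallFibers c (fun _ : X => a) :=
  fun _ => (mk_set_le _).trans_lt hX

theorem RegLike.exists_gt {c : Cardinal.{0}} (hΛ : RegLike c Λ) (a : Λ) : ∃ b, a < b := by
  obtain ⟨b, hb⟩ := hΛ.bdd {a} (by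
    rw [mk_singleton]; exact one_lt_aleph0.trans_le hΛ.reg.aleph0_le)
  exact ⟨b, hb a rfl⟩

theorem RegLike.bdd_range {c : Cardinal.{0}} (hΛ : RegLike c Λ) {X : Type} (f : X → Λ)
    (hX : #X < c) : ∃ b, ∀ x, f x < b := by
  obtain ⟨b, hb⟩ := hΛ.bdd (range f) (mk_range_le.trans_lt hX)
  exact ⟨b, fun x => hb _ ⟨x, rfl⟩⟩

variable [WellFoundedLT Λ]

theorem exists_least {s : Set Λ} (hs : s.Nonempty) : ∃ m ∈ s, ∀ x ∈ s, m ≤ x := by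
  obtain ⟨m, hm, h⟩ := WellFounded.has_min (wellFounded_lt (α := Λ)) s hs
  exact ⟨m, hm, fun x hx => not_lt.1 (h x hx)⟩

theorem exists_isLUB_of_le {s : Set Λ} {b : Λ} (hb : ∀ x ∈ s, x ≤ b) : ∃ l, IsLUB s l := by
  obtain ⟨m, hm, h⟩ := exists_least (s := upperBounds s) ⟨b, fun x hx => hb x hx⟩
  exact ⟨m, hm, fun x hx => h x hx⟩

theorem exists_rec {K V : Type} [LinearOrder K] [WellFoundedLT K] [Nonempty V]
    (P : ∀ i : K, (∀ j, j < i → V) → V → Prop) :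
    ∃ f : K → V, ∀ i, (∃ y, P i (fun j _ => f j) y) → P i (fun j _ => f j) (f i) := by
  classical
  let F : ∀ i : K, (∀ j, j < i → V) → V := fun i h =>
    if hy : ∃ y, P i h y then hy.choose else Classical.arbitrary V
  let f : K → V := (wellFounded_lt (α := K)).fix F
  refine ⟨f, fun i hi => ?_⟩
  have hf : f i = F i (fun j _ => f j) := WellFounded.fix_eq _ _ _
  rw [hf]
  simp only [F, dif_pos hi]
  exact hi.choose_spec

variable {c : Cardinal.{0}}

theorem club_closed (hΛ : RegLike c Λ) (hc : ℵ₀ < c) {X Y Z : Type} {lX : X → Λ} {lY : Y → Λ}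
    (lZ : Z → Λ) (hX : SmallFibers c lX) (hY : SmallFibers c lY) (w : X → Y → Z) :
    Club {γ | ∀ x y, lX x < γ → lY y < γ → lZ (w x y) < γ} := by
  constructor
  · intro x0
    have step : ∀ a : Λ, ∃ b, a < b ∧ ∀ x y, lX x < a → lY y < a → lZ (w x y) < b := by
      intro a
      obtain ⟨b1, h1⟩ := hΛ.exists_gt a
      obtain ⟨b2, h2⟩ := hΛ.bdd_range
        (fun p : {x | lX x < a} × {y | lY y < a} => lZ (w p.1 p.2)) (by
          rw [mk_prod, lift_id, lift_id]
          exact mul_lt_of_lt hc.le (hX a) (hY a))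
      refine ⟨max b1 b2, lt_max_of_lt_left h1, fun x y hx hy => lt_max_of_lt_right ?_⟩
      exact h2 (⟨x, hx⟩, ⟨y, hy⟩)
    choose g hg1 hg2 using step
    obtain ⟨x1, hx1⟩ := hΛ.exists_gt x0
    let s : ℕ → Λ := fun n => g^[n] x1
    have hs : ∀ n, s (n + 1) = g (s n) := fun n => Function.iterate_succ_apply' g n x1
    have hmono : StrictMono s := strictMono_nat_of_lt_succ fun n => by rw [hs]; exact hg1 _
    obtain ⟨b, hb⟩ := hΛ.bdd_range s (by simpa using hc)
    obtain ⟨γ, hγ⟩ := exists_isLUB_of_le (s := range s) (b := b)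
      (by rintro _ ⟨n, rfl⟩; exact (hb n).le)
    have hlt : ∀ n, s n < γ := fun n => (hmono n.lt_succ_self).trans_le (hγ.1 ⟨_, rfl⟩)
    have hex : ∀ x < γ, ∃ n, x < s n := fun x hx => by
      obtain ⟨_, ⟨n, rfl⟩, h⟩ := (lt_isLUB_iff hγ).1 hx
      exact ⟨n, h⟩
    refine ⟨γ, fun x y hx hy => ?_, hx1.trans (hlt 0)⟩
    obtain ⟨n, hn⟩ := hex _ hx
    obtain ⟨m, hm⟩ := hex _ hy
    have := hg2 (s (max n m)) x y (hn.trans_le (hmono.monotone (le_max_left _ _)))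
      (hm.trans_le (hmono.monotone (le_max_right _ _)))
    rw [← hs] at this
    exact this.trans (hlt _)
  · intro γ hγ x y hx hy
    obtain ⟨z, hz, h1, h2⟩ := hγ.2 _ (max_lt hx hy)
    exact (hz x y ((le_max_left _ _).trans_lt h1) ((le_max_right _ _).trans_lt h1)).trans h2

omit [WellFoundedLT Λ] in
theorem club_univ (hΛ : RegLike c Λ) : Club (univ : Set Λ) :=
  ⟨fun x => let ⟨y, hy⟩ := hΛ.exists_gt x; ⟨y, mem_univ _, hy⟩, fun _ _ => mem_univ _⟩

theorem club_iInter (hΛ : RegLike c Λ) (hc : ℵ₀ < c) {I : Type} (hI : #I < c) {E : I → Set Λ}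
    (hE : ∀ i, Club (E i)) : Club (⋂ i, E i) := by
  refine ⟨fun x => ?_, fun γ hγ => mem_iInter.2 fun i =>
    (hE i).2 γ (hγ.mono (iInter_subset _ i))⟩
  choose next h1 h2 using fun (a : Λ) (i : I) => (hE i).1 a
  obtain ⟨γ, hγ, hx⟩ := (club_closed hΛ hc (lX := fun x : Λ => x) (lY := fun _ : I => x)
    (fun x : Λ => x) (SmallFibers.id hΛ) (SmallFibers.const hI x) next).1 x
  exact ⟨γ, mem_iInter.2 fun i => (hE i).2 γ ⟨⟨x, hx⟩, fun a ha =>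
    ⟨next a i, h1 a i, h2 a i, hγ a i ha hx⟩⟩, hx⟩

theorem club_inter (hΛ : RegLike c Λ) (hc : ℵ₀ < c) {E F : Set Λ}
    (hE : Club E) (hF : Club F) : Club (E ∩ F) := by
  have := club_iInter hΛ hc (I := Bool) (E := fun b => cond b E F)
    ((mk_lt_aleph0).trans hc) (by rintro (_ | _) <;> assumption)
  rwa [show (⋂ b : Bool, cond b E F) = E ∩ F by ext; simp [and_comm]] at this

theorem club_acc (hΛ : RegLike c Λ) (hc : ℵ₀ < c) {E : Set Λ} (hE : Club E) :
    Club {γ | LimPt E γ} := by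
  refine ⟨fun x => ?_, fun γ hγ => hγ.acc⟩
  choose next h1 h2 using hE.1
  obtain ⟨γ, hγ, hx⟩ := (club_closed hΛ hc (lX := fun x : Λ => x) (lY := fun _ : Unit => x)
    (fun x : Λ => x) (SmallFibers.id hΛ)
    (SmallFibers.const (by simpa using one_lt_aleph0.trans hc) x) (fun a _ => next a)).1 x
  exact ⟨γ, ⟨⟨x, hx⟩, fun a ha => ⟨next a, h1 a, h2 a, hγ a () ha hx⟩⟩, hx⟩

omit [WellFoundedLT Λ] in
theorem club_insert_bot [OrderBot Λ] {E : Set Λ} (hE : Club E) : Club (insert ⊥ E) := by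
  refine ⟨fun x => let ⟨y, hy, h⟩ := hE.1 x; ⟨y, Or.inr hy, h⟩, fun γ hγ => Or.inr (hE.2 γ ⟨hγ.1,
    fun x hx => ?_⟩)⟩
  obtain ⟨y, rfl | hy, h1, h2⟩ := hγ.2 x hx
  · exact absurd h1 not_lt_bot
  · exact ⟨y, hy, h1, h2⟩

section Ladders

variable {k : Cardinal.{0}} {K : Type} [LinearOrder K]

omit [WellFoundedLT Λ] in
theorem ladder_of_strictMono (hK : RegLike k K) {a : K → Λ} (ha : StrictMono a) {δ : Λ}
    (hδ : IsLUB (range a) δ) : Ladder k δ (range a) := by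
  have hlt : ∀ i, a i < δ := fun i =>
    let ⟨j, hj⟩ := hK.exists_gt i
    (ha hj).trans_le (hδ.1 ⟨j, rfl⟩)
  have hex : ∀ x < δ, ∃ i, x < a i := fun x hx => by
    obtain ⟨_, ⟨n, rfl⟩, h⟩ := (lt_isLUB_iff hδ).1 hx
    exact ⟨n, h⟩
  have hKne : Nonempty K := mk_ne_zero_iff.1 (by rw [hK.card]; exact hK.reg.pos.ne')
  refine ⟨⟨_, hlt hKne.some⟩, ?_, ?_, ?_, ?_, ?_⟩
  · rintro _ ⟨i, rfl⟩
    exact hlt i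
  · intro x hx
    obtain ⟨i, hi⟩ := hex x hx
    exact ⟨_, ⟨i, rfl⟩, hi⟩
  · intro γ hγ
    obtain ⟨i, hi⟩ := hex γ hγ
    refine lt_of_le_of_lt (mk_le_mk_of_subset (t := a '' Iio i) ?_)
      (mk_image_le.trans_lt (hK.iio i))
    rintro _ ⟨⟨j, rfl⟩, hj⟩
    exact ⟨j, ha.lt_iff_lt.1 (lt_trans hj hi), rfl⟩
  · exact mk_range_le.trans hK.card.le
  · intro s hs hsk
    choose i hi using fun x : s => hex x (hs x x.2)
    obtain ⟨b, hb⟩ := hK.bdd_range i hsk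
    exact ⟨a b, hlt b, fun x hx => (hi ⟨x, hx⟩).trans (ha (hb _))⟩

variable [WellFoundedLT K]

omit [WellFoundedLT Λ] in
theorem exists_ladder_subset (hK : RegLike k K) {δ : Λ} (hpos : ∃ x, x < δ) {S : Set Λ}
    (hS : ∀ x ∈ S, x < δ) (hSk : #S ≤ k) (hScof : ∀ x < δ, ∃ y ∈ S, x ≤ y)
    (hge : ∀ s : Set Λ, (∀ x ∈ s, x < δ) → #s < k → ∃ b < δ, ∀ x ∈ s, x < b)
    {C : Set Λ} (hC : ∀ x < δ, ∃ y ∈ C, x < y ∧ y < δ) : ∃ R ⊆ C, Ladder k δ R := by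
  obtain ⟨x0, hx0⟩ := hpos
  have hSne : Nonempty S := let ⟨y, hy, _⟩ := hScof x0 hx0; ⟨⟨y, hy⟩⟩
  obtain ⟨e⟩ : Nonempty (S ↪ K) := by rw [← le_def, hK.card]; exact hSk
  let g : K → S := Function.invFun e
  have hg : Function.Surjective g := Function.invFun_surjective e.injective
  have : Nonempty Λ := ⟨x0⟩
  obtain ⟨a, ha⟩ := exists_rec (K := K) (V := Λ) (fun i h y =>
    y ∈ C ∧ y < δ ∧ (g i : Λ) < y ∧ ∀ j (hj : j < i), h j hj < y)
  have ha' : ∀ i, a i ∈ C ∧ a i < δ ∧ (g i : Λ) < a i ∧ ∀ j, j < i → a j < a i := by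
    intro i
    induction i using WellFoundedLT.induction with
    | ind i ih =>
      refine ha i ?_
      obtain ⟨b, hb, hb'⟩ := hge (a '' Iio i) (by
        rintro _ ⟨j, hj, rfl⟩
        exact (ih j hj).2.1) (mk_image_le.trans_lt (hK.iio i))
      obtain ⟨y, hy, h1, h2⟩ := hC (max b (g i)) (max_lt hb (hS _ (g i).2))
      exact ⟨y, hy, h2, (le_max_right _ _).trans_lt h1, fun j hj =>
        (hb' _ ⟨j, hj, rfl⟩).trans ((le_max_left _ _).trans_lt h1)⟩
  refine ⟨range a, by rintro _ ⟨i, rfl⟩; exact (ha' i).1, ladder_of_strictMono hK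
    (fun j i hji => (ha' i).2.2.2 j hji) ⟨?_, ?_⟩⟩
  · rintro _ ⟨i, rfl⟩
    exact (ha' i).2.1.le
  · intro b hb
    by_contra! hbδ
    obtain ⟨y, hy, hby⟩ := hScof b hbδ
    obtain ⟨i, hi⟩ := hg ⟨y, hy⟩
    have h1 := (ha' i).2.2.1
    rw [hi] at h1
    exact absurd (hb ⟨i, rfl⟩) (not_le.2 (hby.trans_lt h1))

theorem exists_ladder_in_club (hΛ : RegLike c Λ) (hK : RegLike k K) (hkc : k < c) {E : Set Λ}
    (hE : Club E) : ∃ δ ∈ E, LimPt E δ ∧ ∃ R ⊆ E, Ladder k δ R := by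
  have hKne : Nonempty K := mk_ne_zero_iff.1 (by rw [hK.card]; exact hK.reg.pos.ne')
  have hne : Nonempty Λ := mk_ne_zero_iff.1 (by rw [hΛ.card]; exact hΛ.reg.pos.ne')
  obtain ⟨a, ha⟩ := exists_rec (K := K) (V := Λ) (fun i h y =>
    y ∈ E ∧ ∀ j (hj : j < i), h j hj < y)
  have ha' : ∀ i, a i ∈ E ∧ ∀ j, j < i → a j < a i := by
    intro i
    refine ha i ?_
    obtain ⟨b, hb⟩ := hΛ.bdd (a '' Iio i) (mk_image_le.trans_lt ((hK.iio i).trans hkc))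
    obtain ⟨y, hy, h⟩ := hE.1 b
    exact ⟨y, hy, fun j hj => (hb _ ⟨j, hj, rfl⟩).trans h⟩
  obtain ⟨b, hb⟩ := hΛ.bdd_range a (by rw [hK.card]; exact hkc)
  obtain ⟨δ, hδ⟩ := exists_isLUB_of_le (s := range a) (b := b)
    (by rintro _ ⟨n, rfl⟩; exact (hb n).le)
  have hsub : range a ⊆ E := by rintro _ ⟨i, rfl⟩; exact (ha' i).1
  have hl := ladder_of_strictMono hK (fun j i hji => (ha' i).2 j hji) hδ
  have hlim := hl.limPt.mono hsub
  exact ⟨δ, hE.2 δ hlim, hlim, _, hsub, hl⟩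

end Ladders

end Basic

theorem regLike_toType {c : Cardinal.{0}} (hc : c.IsRegular) : RegLike c c.ord.ToType where
  reg := hc
  iio a := (mk_Iio_lt a (by simp)).trans_eq (mk_ord_toType c)
  bdd s hs := by
    by_contra! h
    have h1 : IsCofinal s := fun a => let ⟨x, hx, hax⟩ := h a; ⟨x, hx, hax⟩
    have h2 := Order.cof_le h1
    rw [Ordinal.cof_toType, hc.cof_ord] at h2
    exact absurd hs (not_lt.2 h2)
  card := mk_ord_toType c

/-- There is a family `P` of small sets of sets such that stationarily many points have a ladder
whose initial segments are enumerated by `P` in time. -/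
def Approach (k c : Cardinal.{0}) (Λ : Type) [LinearOrder Λ] : Prop :=
  ∃ P : Λ → Set (Set Λ), (∀ γ, #(P γ) < c) ∧ ∀ E, Club E → ∃ δ ∈ E, ∃ R, Ladder k δ R ∧
    ∀ γ ∈ R, ∀ ε ∈ R, γ < ε → R ∩ Iio γ ∈ P ε

/-- A club guessing sequence of ladders whose initial segments are enumerated in time by `P`. -/
def Guess (k c : Cardinal.{0}) (Λ : Type) [LinearOrder Λ] : Prop :=
  ∃ (P : Λ → Set (Set Λ)) (C : Λ → Set Λ), (∀ γ, #(P γ) < c) ∧ ∀ E, Club E → ∃ δ,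
    Ladder k δ (C δ) ∧ C δ ⊆ E ∧ ∀ γ ∈ C δ, ∀ γ' ∈ C δ, γ < γ' → C δ ∩ Iio γ ∈ P γ'

section Drop

variable {Λ : Type} [LinearOrder Λ] {E F : Set Λ}

open Classical in
/-- The supremum of the elements of `E` that are at most `α`. -/
noncomputable def drop (E : Set Λ) (α : Λ) : Λ :=
  if h : ∃ l, IsLUB (E ∩ Iic α) l then h.choose else α

variable [WellFoundedLT Λ]

theorem isLUB_drop (E : Set Λ) (α : Λ) : IsLUB (E ∩ Iic α) (drop E α) := by
  have h : ∃ l, IsLUB (E ∩ Iic α) l := exists_isLUB_of_le (b := α) fun x hx => hx.2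
  rw [drop, dif_pos h]
  exact h.choose_spec

theorem drop_le (E : Set Λ) (α : Λ) : drop E α ≤ α :=
  (isLUB_drop E α).2 fun _ hx => hx.2

theorem le_drop {α β : Λ} (h : β ∈ E) (hβ : β ≤ α) : β ≤ drop E α :=
  (isLUB_drop E α).1 ⟨h, hβ⟩

theorem lt_of_drop_lt {α β : Λ} (h : β ∈ E) (hβ : drop E α < β) : α < β :=
  not_le.1 fun h' => (le_drop h h').not_gt hβ

theorem drop_anti (hEF : E ⊆ F) (α : Λ) : drop E α ≤ drop F α :=
  (isLUB_drop E α).2 fun _ hx => le_drop (hEF hx.1) hx.2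

theorem drop_mono (E : Set Λ) : Monotone (drop E) := fun α _ hαβ =>
  (isLUB_drop E α).2 fun _ hx => le_drop hx.1 (hx.2.trans hαβ)

theorem drop_mem [OrderBot Λ] (hE : Club E) (hbot : ⊥ ∈ E) (α : Λ) : drop E α ∈ E := by
  by_contra hn
  refine hn (hE.2 _ ⟨⟨⊥, bot_lt_iff_ne_bot.2 fun h => hn (h ▸ hbot)⟩, fun x hx => ?_⟩)
  obtain ⟨y, hy, hxy⟩ := (lt_isLUB_iff (isLUB_drop E α)).1 hx
  exact ⟨y, hy.1, hxy, lt_of_le_of_ne ((isLUB_drop E α).1 hy) fun h => hn (h ▸ hy.1)⟩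

theorem exists_drop_guess [OrderBot Λ] {k c : Cardinal.{0}} (hΛ : RegLike c Λ)
    (hk : k.IsRegular) (hkc : Order.succ k < c) (S : Set Λ) (R : Λ → Set Λ)
    (hR : ∀ δ ∈ S, Ladder k δ (R δ)) (hS : ∀ E, Club E → ∃ δ ∈ S, δ ∈ E) :
    ∃ E : Set Λ, Club E ∧ ⊥ ∈ E ∧ ∀ D, Club D → ⊥ ∈ D →
      ∃ δ ∈ S, LimPt E δ ∧ ∀ α ∈ R δ, drop E α ∈ D := by
  by_contra! hcon
  have hc : ℵ₀ < c := hk.aleph0_le.trans_lt ((Order.lt_succ k).trans hkc)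
  have hcon' : ∀ E : Set Λ, ∃ D, (Club E → ⊥ ∈ E → Club D ∧ ⊥ ∈ D ∧ ∀ δ ∈ S, LimPt E δ →
      ∃ α ∈ R δ, drop E α ∉ D) := by
    intro E
    by_cases h : Club E ∧ ⊥ ∈ E
    · obtain ⟨D, hD⟩ := hcon E h.1 h.2
      exact ⟨D, fun _ _ => hD⟩
    · exact ⟨∅, fun h1 h2 => absurd ⟨h1, h2⟩ h⟩
  choose D hD using hcon'
  have hΘ := regLike_toType (isRegular_succ hk.aleph0_le)
  let Θ := (Order.succ k).ord.ToType
  obtain ⟨G, hG⟩ := exists_rec (K := Θ) (V := Set Λ)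
    (fun i h y => y = ⋂ j : Iio i, D (h j.1 j.2))
  replace hG : ∀ i, G i = ⋂ j : Iio i, D (G j) := fun i => hG i ⟨_, rfl⟩
  have hclub : ∀ i, Club (G i) ∧ ⊥ ∈ G i := by
    intro i
    induction i using WellFoundedLT.induction with
    | ind i ih =>
      rw [hG]
      have h1 : ∀ j : Iio i, Club (D (G j)) ∧ ⊥ ∈ D (G j) := fun j =>
        have h := hD (G j) (ih j j.2).1 (ih j j.2).2
        ⟨h.1, h.2.1⟩
      exact ⟨club_iInter hΛ hc ((hΘ.iio i).trans hkc) fun j => (h1 j).1,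
        mem_iInter.2 fun j => (h1 j).2⟩
  have hanti : Antitone G := fun i j hij => by
    rw [hG i, hG j]
    exact fun x hx => mem_iInter.2 fun l => mem_iInter.1 hx ⟨l, l.2.trans_le hij⟩
  obtain ⟨δ, hδS, hδ⟩ := hS _ (club_acc hΛ hc
    (club_iInter hΛ hc (by rw [hΘ.card]; exact hkc) fun i => (hclub i).1))
  have hlim : ∀ i, LimPt (G i) δ := fun i => LimPt.mono hδ (iInter_subset _ i)
  have hev : ∀ α : Λ, ∃ i, ∀ j, i ≤ j → drop (G j) α = drop (G i) α := by
    intro α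
    have hne : Nonempty Θ := mk_ne_zero_iff.1 (by rw [hΘ.card]; exact hΘ.reg.pos.ne')
    obtain ⟨_, ⟨i, rfl⟩, hi⟩ := exists_least (range_nonempty fun i => drop (G i) α)
    exact ⟨i, fun j hij => le_antisymm (drop_anti (hanti hij) α) (hi _ ⟨j, rfl⟩)⟩
  choose ev hev using hev
  obtain ⟨i, hi⟩ := hΘ.bdd_range (fun α : R δ => ev α)
    ((hR δ hδS).card.trans_lt (Order.lt_succ k))
  obtain ⟨α, hα, hαD⟩ := (hD (G i) (hclub i).1 (hclub i).2).2.2 δ hδS (hlim i)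
  obtain ⟨j, hj⟩ := hΘ.exists_gt i
  have h1 : drop (G j) α = drop (G i) α := by
    rw [hev α j ((hi ⟨α, hα⟩).le.trans hj.le), hev α i (hi ⟨α, hα⟩).le]
  have h2 := drop_mem (hclub j).1 (hclub j).2 α
  rw [h1, hG j] at h2
  exact hαD (mem_iInter.1 h2 ⟨i, hj⟩)

theorem Approach.guess [OrderBot Λ] {k c : Cardinal.{0}} (hΛ : RegLike c Λ)
    (hk : k.IsRegular) (hkc : Order.succ k < c) (h : Approach k c Λ) : Guess k c Λ := by
  obtain ⟨P, hP, hA⟩ := h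
  have hex : ∀ δ, ∃ R, (∃ R, Ladder k δ R ∧ ∀ γ ∈ R, ∀ γ' ∈ R, γ < γ' → R ∩ Iio γ ∈ P γ') →
      (Ladder k δ R ∧ ∀ γ ∈ R, ∀ γ' ∈ R, γ < γ' → R ∩ Iio γ ∈ P γ') := by
    intro δ
    by_cases h : ∃ R, Ladder k δ R ∧ ∀ γ ∈ R, ∀ γ' ∈ R, γ < γ' → R ∩ Iio γ ∈ P γ'
    · exact ⟨h.choose, fun _ => h.choose_spec⟩
    · exact ⟨∅, fun h' => absurd h' h⟩
  choose R hR using hex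
  obtain ⟨E, hE, hbot, hEg⟩ := exists_drop_guess hΛ hk hkc
    {δ | ∃ R, Ladder k δ R ∧ ∀ γ ∈ R, ∀ γ' ∈ R, γ < γ' → R ∩ Iio γ ∈ P γ'} R
    (fun δ hδ => (hR δ hδ).1) (fun E hE => let ⟨δ, h1, h2⟩ := hA E hE; ⟨δ, h2, h1⟩)
  choose ν hνE hν using hE.1
  refine ⟨fun γ' => ⋃ α : Iio (ν γ'), (fun X => (drop E '' X) \ {⊥}) '' P α,
    fun δ => (drop E '' R δ) \ {⊥}, fun γ => ?_, fun D hD => ?_⟩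
  · rw [card_iUnion_lt_iff_forall_of_isRegular hΛ.reg (hΛ.iio _)]
    exact fun α => mk_image_le.trans_lt (hP α)
  obtain ⟨δ, hδ, hlim, hδD⟩ := hEg _ (club_insert_bot hD) (Or.inl rfl)
  obtain ⟨hlad, hW⟩ := hR δ hδ
  refine ⟨δ, ⟨hlad.pos, ?_, ?_, ?_, ?_, hlad.cofge⟩, ?_, ?_⟩
  · rintro _ ⟨⟨α, hα, rfl⟩, -⟩
    exact (drop_le E α).trans_lt (hlad.sub α hα)
  · intro x hx
    obtain ⟨y, hy, hxy, hyδ⟩ := hlim.2 x hx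
    obtain ⟨α, hα, hyα⟩ := hlad.cofinal y hyδ
    have h1 := hxy.trans_le (le_drop hy hyα.le)
    exact ⟨_, ⟨⟨α, hα, rfl⟩, (bot_le.trans_lt h1).ne'⟩, h1⟩
  · intro γ hγ
    obtain ⟨y, hy, hγy, hyδ⟩ := hlim.2 γ hγ
    refine lt_of_le_of_lt (mk_le_mk_of_subset (t := drop E '' (R δ ∩ Iio y)) ?_)
      (mk_image_le.trans_lt (hlad.init y hyδ))
    rintro _ ⟨⟨⟨α, hα, rfl⟩, -⟩, h⟩
    exact ⟨α, ⟨hα, lt_of_drop_lt hy (lt_trans h hγy)⟩, rfl⟩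
  · exact (mk_le_mk_of_subset sdiff_subset).trans (mk_image_le.trans hlad.card)
  · rintro _ ⟨⟨α, hα, rfl⟩, h⟩
    exact (hδD α hα).resolve_left h
  · rintro γ ⟨⟨α, hα, rfl⟩, hαb⟩ _ ⟨⟨α', hα', rfl⟩, hα'b⟩ hlt
    obtain ⟨β, ⟨hβR, hβ⟩, hmin⟩ := exists_least (s := {β | β ∈ R δ ∧ drop E β = drop E α})
      ⟨α, hα, rfl⟩
    have hββ' : β < α' := (drop_mono E).reflect_lt (hβ.trans_lt hlt)
    refine mem_iUnion.2 ⟨⟨α', lt_of_drop_lt (hνE _) (hν _)⟩, R δ ∩ Iio β,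
      hW β hβR α' hα' hββ', ?_⟩
    ext x
    constructor
    · rintro ⟨⟨t, ⟨ht, htβ⟩, rfl⟩, hb⟩
      refine ⟨⟨⟨t, ht, rfl⟩, hb⟩, lt_of_le_of_ne ?_ fun h => ?_⟩
      · rw [← hβ]; exact drop_mono E (le_of_lt htβ)
      · exact (hmin t ⟨ht, h⟩).not_gt htβ
    · rintro ⟨⟨⟨t, ht, rfl⟩, hb⟩, h⟩
      exact ⟨⟨t, ⟨ht, (drop_mono E).reflect_lt (lt_of_lt_of_eq h hβ.symm)⟩, rfl⟩, hb⟩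

end Drop

theorem Ladder.map {Λ₁ Λ₂ : Type} [LinearOrder Λ₁] [LinearOrder Λ₂] {k : Cardinal.{0}} {δ : Λ₁}
    {τ : Λ₂} {R X : Set Λ₁} (hR : Ladder k δ R) (hX : ∀ x ∈ X, x < δ) (hRX : R ⊆ X) {φ : Λ₁ → Λ₂}
    (hφ : StrictMonoOn φ X) (hτ : ∀ x ∈ X, φ x < τ) (hcof : ∀ y < τ, ∃ x ∈ X, y < φ x) :
    Ladder k τ (φ '' R) := by
  have hex : ∀ x < δ, ∃ r ∈ R, x < r := hR.cofinal
  refine ⟨?_, ?_, ?_, ?_, mk_image_le.trans hR.card, ?_⟩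
  · obtain ⟨x, hx⟩ := hR.pos
    obtain ⟨r, hr, -⟩ := hex x hx
    exact ⟨_, hτ r (hRX hr)⟩
  · rintro _ ⟨r, hr, rfl⟩
    exact hτ r (hRX hr)
  · intro y hy
    obtain ⟨x, hx, hyx⟩ := hcof y hy
    obtain ⟨r, hr, hxr⟩ := hex x (hX x hx)
    exact ⟨_, ⟨r, hr, rfl⟩, hyx.trans (hφ hx (hRX hr) hxr)⟩
  · intro y hy
    obtain ⟨x, hx, hyx⟩ := hcof y hy
    refine lt_of_le_of_lt (mk_le_mk_of_subset (t := φ '' (R ∩ Iio x)) ?_)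
      (mk_image_le.trans_lt (hR.init x (hX x hx)))
    rintro _ ⟨⟨r, hr, rfl⟩, h⟩
    exact ⟨r, ⟨hr, (hφ.lt_iff_lt (hRX hr) hx).1 (lt_trans h hyx)⟩, rfl⟩
  · intro s hs hsk
    choose g hgX hg using fun y : s => hcof y (hs y y.2)
    obtain ⟨b, hb, hgb⟩ := hR.cofge (range g) (by rintro _ ⟨y, rfl⟩; exact hX _ (hgX y))
      (mk_range_le.trans_lt hsk)
    obtain ⟨r, hr, hbr⟩ := hex b hb
    exact ⟨φ r, hτ r (hRX hr), fun y hy => (hg ⟨y, hy⟩).trans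
      (hφ (hgX _) (hRX hr) ((hgb _ ⟨_, rfl⟩).trans hbr))⟩

section Rank

variable {Λ Θ : Type} [LinearOrder Λ] [WellFoundedLT Λ] [LinearOrder Θ] [WellFoundedLT Θ]
  {c : Cardinal.{0}}

/-- A rank function into `Θ` for every set of size less than `c`, compatible with initial
segments. -/
theorem exists_rank (hΘ : RegLike c Θ) : ∃ ρ : Set Λ → Λ → Θ,
    (∀ X : Set Λ, #X < c → StrictMonoOn (ρ X) X) ∧
    (∀ X : Set Λ, #X < c → ∃ τ, ρ X '' X = Iio τ) ∧
    ∀ (X : Set Λ) (γ t : Λ), #X < c → t < γ → ρ (X ∩ Iio γ) t = ρ X t := by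
  have hne : Nonempty Θ := mk_ne_zero_iff.1 (by rw [hΘ.card]; exact hΘ.reg.pos.ne')
  choose ρ hρ using fun X : Set Λ => exists_rec (K := Λ) (V := Θ)
    (fun t h y => IsLeast {y | ∀ t' (ht : t' < t), t' ∈ X → h t' ht < y} y)
  replace hρ : ∀ (X : Set Λ) t, #X < c →
      IsLeast {y | ∀ t', t' < t → t' ∈ X → ρ X t' < y} (ρ X t) := by
    intro X t hX
    refine hρ X t ?_
    obtain ⟨b, hb⟩ := hΘ.bdd (ρ X '' X) (mk_image_le.trans_lt hX)
    obtain ⟨y, hy, hmin⟩ := exists_least (s := {y | ∀ t', t' < t → t' ∈ X → ρ X t' < y})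
      ⟨b, fun t' _ ht' => hb _ ⟨t', ht', rfl⟩⟩
    exact ⟨y, hy, fun z hz => hmin z hz⟩
  refine ⟨ρ, fun X hX t ht t' _ htt' => (hρ X t' hX).1 t htt' ht, fun X hX => ?_,
    fun X γ t hX => ?_⟩
  · obtain ⟨b, hb⟩ := hΘ.bdd (ρ X '' X) (mk_image_le.trans_lt hX)
    obtain ⟨τ, hτ, hmin⟩ := exists_least (s := {y | ∀ t ∈ X, ρ X t < y})
      ⟨b, fun t ht => hb _ ⟨t, ht, rfl⟩⟩
    refine ⟨τ, Subset.antisymm ?_ fun y hy => ?_⟩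
    · rintro _ ⟨t, ht, rfl⟩
      exact hτ t ht
    · have h1 : ∃ t ∈ X, y ≤ ρ X t := by
        by_contra! h
        exact (hmin y h).not_gt hy
      obtain ⟨t, ⟨ht, hyt⟩, htmin⟩ := exists_least (s := {t | t ∈ X ∧ y ≤ ρ X t}) h1
      refine ⟨t, ht, le_antisymm ((hρ X t hX).2 fun t' ht' hX' => ?_) hyt⟩
      by_contra! h
      exact (htmin t' ⟨hX', h⟩).not_gt ht'
  · have hX' : #(X ∩ Iio γ : Set Λ) < c := (mk_le_mk_of_subset inter_subset_left).trans_lt hX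
    induction t using WellFoundedLT.induction with
    | ind t ih =>
      intro htγ
      refine (hρ _ t hX').unique ?_
      have := hρ X t hX
      have hset : {y | ∀ t', t' < t → t' ∈ X ∩ Iio γ → ρ (X ∩ Iio γ) t' < y} =
          {y | ∀ t', t' < t → t' ∈ X → ρ X t' < y} := by
        ext y
        refine forall₂_congr fun t' ht' => ?_
        rw [ih t' ht' (ht'.trans htγ)]
        exact ⟨fun h ht => h ⟨ht, ht'.trans htγ⟩, fun h ht => h ht.1⟩
      rwa [hset]

theorem approach_succ_succ {k : Cardinal.{0}} {K : Type} [LinearOrder K] [WellFoundedLT K]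
    (hK : RegLike k K) [OrderBot Θ]
    (hΛ : RegLike (Order.succ (Order.succ k)) Λ) (hΘ : RegLike (Order.succ k) Θ) :
    Approach k (Order.succ (Order.succ k)) Λ := by
  have hinj : ∀ γ : Λ, ∃ f : Λ → Θ, InjOn f (Iio γ) := by
    intro γ
    have h := Order.lt_succ_iff.1 (hΛ.iio γ)
    rw [← hΘ.card] at h
    obtain ⟨e⟩ := (le_def _ _).1 h
    classical
    exact ⟨fun α => if hα : α < γ then e ⟨α, hα⟩ else ⊥, fun α hα β hβ hab => by
      have hα' : α < γ := hα
      have hβ' : β < γ := hβ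
      have h := hab
      simp only [dif_pos hα', dif_pos hβ'] at h
      exact congrArg Subtype.val (e.injective h)⟩
  choose f hf using hinj
  let A : Λ → Θ → Set Λ := fun γ i => {α | α < γ ∧ f γ α < i}
  have hA : ∀ γ i, #(A γ i) < Order.succ k := fun γ i => by
    refine lt_of_le_of_lt ?_ (hΘ.iio i)
    refine mk_le_of_injective (f := fun α : A γ i => (⟨f γ α, α.2.2⟩ : Iio i)) ?_
    intro α β hab
    exact Subtype.ext (hf γ α.2.1 β.2.1 (congrArg Subtype.val hab))
  obtain ⟨ρ, hρmono, hρimg, hρcoh⟩ := exists_rank (Λ := Λ) hΘ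
  have hc : ∀ τ : Θ, ∃ s, (∃ s, Ladder k τ s) → Ladder k τ s := by
    intro τ
    by_cases h : ∃ s, Ladder k τ s
    · exact ⟨h.choose, fun _ => h.choose_spec⟩
    · exact ⟨∅, fun h' => absurd h' h⟩
  choose c hc using hc
  have hk := hK.reg
  have hkΘ : ℵ₀ < Order.succ k := hk.aleph0_le.trans_lt (Order.lt_succ k)
  have hΘΛ : #Θ < Order.succ (Order.succ k) := by rw [hΘ.card]; exact Order.lt_succ _
  refine ⟨fun γ' => ⋃ γ : Iio γ', range fun p : Θ × Θ =>
    {t | t ∈ A γ p.1 ∧ ρ (A γ p.1) t ∈ c p.2}, fun γ' => ?_, fun E hE => ?_⟩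
  · rw [card_iUnion_lt_iff_forall_of_isRegular hΛ.reg (hΛ.iio _)]
    refine fun γ => mk_range_le.trans_lt ?_
    simp only [mk_prod, lift_id]
    exact mul_lt_of_lt hΛ.reg.aleph0_le hΘΛ hΘΛ
  obtain ⟨δ, hδE, -, R₀, -, hR₀⟩ := exists_ladder_in_club hΛ hK
    ((Order.lt_succ k).trans (Order.lt_succ _)) hE
  obtain ⟨i₀, hi₀⟩ := hΘ.bdd (f δ '' R₀) (mk_image_le.trans_lt
    (hR₀.card.trans_lt (Order.lt_succ k)))
  have hsm : SmallFibers (Order.succ k) (fun α : Iio δ => f δ α) := fun i => by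
    refine lt_of_le_of_lt ?_ (hA δ i)
    refine mk_le_of_injective (f := fun α => (⟨α.1.1, α.1.2, α.2⟩ : A δ i)) ?_
    intro α β hab
    exact Subtype.ext (Subtype.ext (Subtype.mk.inj hab))
  classical
  obtain ⟨i, ⟨hi1, hi2⟩, hi₀i⟩ := (club_inter hΘ hkΘ
    (club_closed hΘ hkΘ (fun i : Θ => i) hsm hsm fun α β => f α β)
    (club_closed hΘ hkΘ (fun i : Θ => i) hsm (SmallFibers.id hΘ) fun α j =>
      if h : ∃ β < (α : Λ), f α β = j then f δ h.choose else ⊥)).1 i₀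
  have hcoh : ∀ α ∈ A δ i, A α i = A δ i ∩ Iio α := by
    rintro α ⟨hα, hαi⟩
    ext β
    constructor
    · rintro ⟨hβα, hβi⟩
      have h : ∃ β' < α, f α β' = f α β := ⟨β, hβα, rfl⟩
      have h1 := hi2 ⟨α, hα⟩ (f α β) hαi hβi
      rw [dif_pos h, hf α h.choose_spec.1 hβα h.choose_spec.2] at h1
      exact ⟨⟨hβα.trans hα, h1⟩, hβα⟩
    · rintro ⟨⟨hβδ, hβi⟩, hβα⟩
      exact ⟨hβα, hi1 ⟨α, hα⟩ ⟨β, hβδ⟩ hαi hβi⟩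
  obtain ⟨τ, hτ⟩ := hρimg (A δ i) (hA δ i)
  have hmono := hρmono (A δ i) (hA δ i)
  have hτlt : ∀ x ∈ A δ i, ρ (A δ i) x < τ := fun x hx => by
    have : ρ (A δ i) x ∈ Iio τ := hτ ▸ mem_image_of_mem _ hx
    exact this
  have hτex : ∀ y < τ, ∃ x ∈ A δ i, ρ (A δ i) x = y := fun y hy => by
    have : y ∈ ρ (A δ i) '' A δ i := hτ ▸ hy
    exact this
  have hR₀A : R₀ ⊆ A δ i := fun x hx =>
    ⟨hR₀.sub x hx, (hi₀ _ ⟨x, hx, rfl⟩).trans hi₀i⟩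
  have hcof : ∀ x < δ, ∃ y ∈ A δ i, x < y := fun x hx =>
    let ⟨y, hy, h⟩ := hR₀.cofinal x hx
    ⟨y, hR₀A hy, h⟩
  have hcτ := hc τ ⟨_, hR₀.map (fun x hx => hx.1) hR₀A hmono hτlt (fun y hy => by
    obtain ⟨x, hx, rfl⟩ := hτex y hy
    obtain ⟨x', hx', h⟩ := hcof x hx.1
    exact ⟨x', hx', hmono hx hx' h⟩)⟩
  have hneΛ : Nonempty Λ := ⟨δ⟩
  choose! g hgA hg using hτex
  have hgmono : StrictMonoOn g (Iio τ) := fun y hy y' hy' hyy' => by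
    rwa [← hmono.lt_iff_lt (hgA y hy) (hgA y' hy'), hg y hy, hg y' hy']
  have hlad := hcτ.map (φ := g) (X := Iio τ) (τ := δ) (fun y hy => hy) hcτ.sub hgmono
    (fun y hy => (hgA y hy).1) (fun x hx => by
      obtain ⟨y, hy, h⟩ := hcof x hx
      refine ⟨_, hτlt y hy, ?_⟩
      rwa [hmono.injOn (hgA _ (hτlt y hy)) hy (hg _ (hτlt y hy))])
  have himg : g '' c τ = {t | t ∈ A δ i ∧ ρ (A δ i) t ∈ c τ} := by
    ext t
    constructor
    · rintro ⟨y, hy, rfl⟩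
      have hy' := hcτ.sub y hy
      exact ⟨hgA y hy', by rwa [hg y hy']⟩
    · rintro ⟨ht, htc⟩
      exact ⟨_, htc, hmono.injOn (hgA _ (hτlt t ht)) ht (hg _ (hτlt t ht))⟩
  rw [himg] at hlad
  refine ⟨δ, hδE, _, hlad, ?_⟩
  rintro γ ⟨hγA, -⟩ γ' - hγγ'
  refine mem_iUnion.2 ⟨⟨γ, hγγ'⟩, (i, τ), ?_⟩
  ext t
  simp only [hcoh γ hγA]
  constructor
  · rintro ⟨⟨h1, h2⟩, h3⟩
    rw [hρcoh _ γ t (hA δ i) h2] at h3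
    exact ⟨⟨h1, h3⟩, h2⟩
  · rintro ⟨⟨h1, h3⟩, h2⟩
    refine ⟨⟨h1, h2⟩, ?_⟩
    rwa [hρcoh _ γ t (hA δ i) h2]

end Rank

theorem approach_of_guess {Λ Θ : Type} [LinearOrder Λ] [WellFoundedLT Λ] [OrderBot Λ]
    [LinearOrder Θ] [WellFoundedLT Θ] {k θ c : Cardinal.{0}} (hΛ : RegLike c Λ)
    (hΘ : RegLike θ Θ) (hθ : ℵ₀ < θ) (hθc : θ < c) (hG : Guess k θ Θ) : Approach k c Λ := by
  obtain ⟨_, C, _, hC⟩ := hG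
  replace hC : ∀ E, Club E → ∃ ε, Ladder k ε (C ε) ∧ C ε ⊆ E := fun E hE =>
    let ⟨ε, h1, h2, _⟩ := hC E hE
    ⟨ε, h1, h2⟩
  let Cont : (Θ → Λ) → Prop := fun d => StrictMono d ∧
    ∀ j, LimPt univ j → IsLUB (d '' Iio j) (d j)
  have hg : ∀ β : Λ, ∃ g : Θ → Λ, (∃ g, Cont g ∧ IsLUB (range g) β) →
      (Cont g ∧ IsLUB (range g) β) := by
    intro β
    by_cases h : ∃ g, Cont g ∧ IsLUB (range g) β
    · exact ⟨h.choose, fun _ => h.choose_spec⟩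
    · exact ⟨fun _ => ⊥, fun h' => absurd h' h⟩
  choose g hg using hg
  let Q : Λ → Set (Set Λ) := fun β => range fun p : Θ × Θ => g β '' (C p.1 ∩ Iio p.2)
  have hb : ∀ X, ∃ β, (∃ β, X ∈ Q β) → X ∈ Q β := by
    intro X
    by_cases h : ∃ β, X ∈ Q β
    · exact ⟨h.choose, fun _ => h.choose_spec⟩
    · exact ⟨⊥, fun h' => absurd h' h⟩
  choose b hb using hb
  refine ⟨fun γ => ⋃ β : Iio γ, Q β, fun γ => ?_, fun E hE => ?_⟩
  · rw [card_iUnion_lt_iff_forall_of_isRegular hΛ.reg (hΛ.iio _)]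
    refine fun β => mk_range_le.trans_lt ?_
    simp only [mk_prod, lift_id, hΘ.card]
    exact mul_lt_of_lt hΛ.reg.aleph0_le hθc hθc
  obtain ⟨d, hd⟩ := exists_rec (K := Θ) (V := Λ) (fun i h y => IsLeast {e | e ∈ E ∧
    ∀ j (hj : j < i), h j hj < e ∧
      ∀ ε, b {x | ∃ z, ∃ hz : z < i, z ∈ C ε ∧ z < j ∧ h z hz = x} < e} y)
  have hX : ∀ i j : Θ, j < i → ∀ ε,
      {x | ∃ z, ∃ _ : z < i, z ∈ C ε ∧ z < j ∧ d z = x} = d '' (C ε ∩ Iio j) := by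
    intro i j hj ε
    ext x
    constructor
    · rintro ⟨z, -, h1, h2, rfl⟩
      exact ⟨z, ⟨h1, h2⟩, rfl⟩
    · rintro ⟨z, ⟨h1, h2⟩, rfl⟩
      exact ⟨z, lt_trans h2 hj, h1, h2, rfl⟩
  have hiθ : ∀ i : Θ, #(Iio i) < c := fun i => (hΘ.iio i).trans hθc
  replace hd : ∀ i, IsLeast {e | e ∈ E ∧ ∀ j < i, d j < e ∧
      ∀ ε, b (d '' (C ε ∩ Iio j)) < e} (d i) := by
    intro i
    have hset : {e | e ∈ E ∧ ∀ j (hj : j < i), d j < e ∧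
        ∀ ε, b {x | ∃ z, ∃ hz : z < i, z ∈ C ε ∧ z < j ∧ d z = x} < e} =
        {e | e ∈ E ∧ ∀ j < i, d j < e ∧ ∀ ε, b (d '' (C ε ∩ Iio j)) < e} := by
      ext e
      refine and_congr_right fun _ => forall₂_congr fun j hj => and_congr_right fun _ =>
        forall_congr' fun ε => ?_
      rw [hX i j hj]
    rw [← hset]
    refine hd i ?_
    rw [hset]
    obtain ⟨b1, hb1⟩ := hΛ.bdd_range (fun j : Iio i => d j) (hiθ i)
    obtain ⟨b2, hb2⟩ := hΛ.bdd_range (fun p : Iio i × Θ => b (d '' (C p.2 ∩ Iio p.1))) (by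
      simp only [mk_prod, lift_id, hΘ.card]
      exact mul_lt_of_lt hΛ.reg.aleph0_le (hiθ i) hθc)
    obtain ⟨e, heE, he⟩ := hE.1 (max b1 b2)
    obtain ⟨y, hy, hmin⟩ := exists_least (s := {e | e ∈ E ∧ ∀ j < i, d j < e ∧
      ∀ ε, b (d '' (C ε ∩ Iio j)) < e}) ⟨e, heE, fun j hj =>
        ⟨(hb1 ⟨j, hj⟩).trans ((le_max_left _ _).trans_lt he), fun ε =>
          (hb2 (⟨j, hj⟩, ε)).trans ((le_max_right _ _).trans_lt he)⟩⟩
    exact ⟨y, hy, fun z hz => hmin z hz⟩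
  have hmono : StrictMono d := fun j i hji => ((hd i).1.2 j hji).1
  have hcont : Cont d := by
    refine ⟨hmono, fun j hj => ?_⟩
    obtain ⟨l, hl⟩ := exists_isLUB_of_le (s := d '' Iio j) (b := d j)
      (by rintro _ ⟨i, hi, rfl⟩; exact (hmono hi).le)
    have hlt : ∀ i < j, d i < l := fun i hi => by
      obtain ⟨i', -, h1, h2⟩ := hj.2 i hi
      exact (hmono h1).trans_le (hl.1 ⟨i', h2, rfl⟩)
    have hlE : l ∈ E := by
      obtain ⟨i, hi⟩ := hj.1
      refine hE.2 l ⟨⟨_, hlt i hi⟩, fun x hx => ?_⟩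
      obtain ⟨_, ⟨i, hi, rfl⟩, h⟩ := (lt_isLUB_iff hl).1 hx
      exact ⟨_, (hd i).1.1, h, hlt i hi⟩
    have : l = d j := by
      refine le_antisymm (hl.2 (by rintro _ ⟨i, hi, rfl⟩; exact (hmono hi).le)) ?_
      refine (hd j).2 ⟨hlE, fun i hi => ⟨hlt i hi, fun ε => ?_⟩⟩
      obtain ⟨i', -, h1, h2⟩ := hj.2 i hi
      exact (((hd i').1.2 i h1).2 ε).trans (hlt i' h2)
    rwa [← this]
  obtain ⟨b0, hb0⟩ := hΛ.bdd_range d (by rw [hΘ.card]; exact hθc)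
  obtain ⟨δ, hδ⟩ := exists_isLUB_of_le (s := range d) (b := b0)
    (by rintro _ ⟨n, rfl⟩; exact (hb0 n).le)
  obtain ⟨hgc, hgδ⟩ := hg δ ⟨d, hcont, hδ⟩
  have hlt : ∀ {u : Θ → Λ}, StrictMono u → IsLUB (range u) δ → ∀ i, u i < δ := fun hu h i =>
    let ⟨j, hj⟩ := hΘ.exists_gt i
    (hu hj).trans_le (h.1 ⟨j, rfl⟩)
  have hex : ∀ {u v : Θ → Λ}, StrictMono u → IsLUB (range u) δ → IsLUB (range v) δ →
      ∀ i, ∃ j, u i < v j := fun hu h h' i => by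
    obtain ⟨_, ⟨j, rfl⟩, h⟩ := (lt_isLUB_iff h').1 (hlt hu h i)
    exact ⟨j, h⟩
  choose h1 hh1 using hex hmono hδ hgδ
  choose h2 hh2 using hex hgc.1 hgδ hδ
  have hu1 : #Unit < θ := by simpa using one_lt_aleph0.trans hθ
  have hne : Nonempty Θ := mk_ne_zero_iff.1 (by rw [hΘ.card]; exact hΘ.reg.pos.ne')
  obtain ⟨o, -, ho⟩ := exists_least (s := (univ : Set Θ)) univ_nonempty
  obtain ⟨ε, hlad, hsub⟩ := hC _ (club_inter hΘ hθ (club_acc hΘ hθ (club_univ hΘ))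
    (club_inter hΘ hθ
      (club_closed hΘ hθ (fun j : Θ => j) (SmallFibers.id hΘ) (SmallFibers.const hu1 o)
        (fun j _ => h1 j))
      (club_closed hΘ hθ (fun j : Θ => j) (SmallFibers.id hΘ) (SmallFibers.const hu1 o)
        (fun j _ => h2 j))))
  have heq : ∀ j ∈ C ε, g δ j = d j := by
    intro j hj
    obtain ⟨hj, hj1, hj2⟩ := hsub hj
    have ho' : o < j := let ⟨x, hx⟩ := hj.1; (ho x (mem_univ _)).trans_lt hx
    have l1 := hgc.2 j hj
    have l2 := hcont.2 j hj
    refine le_antisymm (l1.2 ?_) (l2.2 ?_)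
    · rintro _ ⟨i, hi, rfl⟩
      exact (hh2 i).le.trans (hmono (hj2 i () hi ho')).le
    · rintro _ ⟨i, hi, rfl⟩
      exact (hh1 i).le.trans (hgc.1 (hj1 i () hi ho')).le
  refine ⟨d ε, (hd ε).1.1, d '' C ε, hlad.map (X := Iio ε) (fun _ hx => hx) hlad.sub
    (hmono.strictMonoOn _) (fun _ hx => hmono hx) (fun y hy => ?_), ?_⟩
  · obtain ⟨_, ⟨i, hi, rfl⟩, h⟩ := (lt_isLUB_iff
      (hcont.2 ε (hlad.limPt.mono (subset_univ _)))).1 hy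
    exact ⟨i, hi, h⟩
  · rintro _ ⟨ζ, hζ, rfl⟩ _ ⟨i, hi, rfl⟩ hζi
    have hζi' := hmono.lt_iff_lt.1 hζi
    have himg : d '' C ε ∩ Iio (d ζ) = d '' (C ε ∩ Iio ζ) := by
      ext x
      constructor
      · rintro ⟨⟨z, hz, rfl⟩, h⟩
        exact ⟨z, ⟨hz, hmono.lt_iff_lt.1 h⟩, rfl⟩
      · rintro ⟨z, ⟨hz, h⟩, rfl⟩
        exact ⟨⟨z, hz, rfl⟩, hmono h⟩
    rw [himg]
    have hQ : d '' (C ε ∩ Iio ζ) ∈ Q δ :=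
      ⟨(ε, ζ), image_congr fun z hz => heq z hz.1⟩
    exact mem_iUnion.2 ⟨⟨_, ((hd i).1.2 ζ hζi').2 ε⟩, hb _ ⟨_, hQ⟩⟩

/-- Club guessing for cofinality `k` in case `k⁺ < c`. -/
theorem guess_of_succ_lt {k c : Cardinal.{0}} (hk : k.IsRegular) (hkc : Order.succ k < c)
    {Λ : Type} [LinearOrder Λ] [WellFoundedLT Λ] [OrderBot Λ] (hΛ : RegLike c Λ) :
    Guess k c Λ := by
  have hne : ∀ {a : Cardinal.{0}}, a.IsRegular → Nonempty a.ord.ToType := fun {a} ha =>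
    mk_ne_zero_iff.1 (by rw [mk_ord_toType]; exact ha.pos.ne')
  have hr1 := isRegular_succ hk.aleph0_le
  have hr2 := isRegular_succ hr1.aleph0_le
  have := hne hr1
  have := hne hr2
  let _ : OrderBot (Order.succ k).ord.ToType := WellFoundedLT.toOrderBot _
  let _ : OrderBot (Order.succ (Order.succ k)).ord.ToType := WellFoundedLT.toOrderBot _
  rcases (Order.succ_le_of_lt hkc).eq_or_lt with h | h
  · subst h
    exact (approach_succ_succ (regLike_toType hk) hΛ (regLike_toType hr1)).guess hΛ hk hkc
  · have hΘ := regLike_toType hr2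
    have hs := Order.lt_succ (Order.succ k)
    refine (approach_of_guess hΛ hΘ ?_ h (Approach.guess hΘ hk hs
      (approach_succ_succ (regLike_toType hk) hΘ (regLike_toType hr1)))).guess hΛ hk hkc
    exact hr1.aleph0_le.trans_lt hs

theorem guess_omega_one (h : ExistsClubGuessingOnOmega1) :
    Guess ℵ₀ (aleph 1) (aleph 1).ord.ToType := by
  obtain ⟨C, hC, hguess⟩ := h
  have hΛ := regLike_toType isRegular_aleph_one
  let e : Iio (aleph 1).ord ≃o (aleph 1).ord.ToType := Ordinal.ToType.mk
  let C' : (aleph 1).ord.ToType → Set (aleph 1).ord.ToType := fun δ =>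
    {x | (e.symm x : Ordinal) ∈ C (e.symm δ)}
  have hctb : ∀ γ : (aleph 1).ord.ToType, #(Iio γ) ≤ ℵ₀ := fun γ =>
    Order.lt_succ_iff.1 ((hΛ.iio γ).trans_eq succ_aleph0.symm)
  have hR : ∀ δ, ∃ R, (∃ R ⊆ C' δ, Ladder ℵ₀ δ R) → (R ⊆ C' δ ∧ Ladder ℵ₀ δ R) := by
    intro δ
    by_cases h : ∃ R ⊆ C' δ, Ladder ℵ₀ δ R
    · exact ⟨h.choose, fun _ => h.choose_spec⟩
    · exact ⟨∅, fun h' => absurd h' h⟩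
  choose R hR using hR
  refine ⟨fun γ => {X | X.Finite ∧ X ⊆ Iio γ}, R, fun γ => ?_, fun E hE => ?_⟩
  · have h1 : ({X | X.Finite ∧ X ⊆ Iio γ} : Set (Set (aleph 1).ord.ToType)).Countable :=
      countable_ofPred_finite_subset (le_aleph0_iff_set_countable.1 (hctb γ))
    exact (le_aleph0_iff_set_countable.2 h1).trans_lt aleph0_lt_aleph_one
  have hE' : IsClubIn {o | ∃ h : o < (aleph 1).ord, e ⟨o, h⟩ ∈ E} (aleph 1).ord := by
    refine ⟨fun o ho => ho.1, fun s hs hne hlt => ?_, fun α hα => ?_⟩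
    · by_cases hmem : sSup s ∈ s
      · exact hs hmem
      have hlub : IsLUB s (sSup s) := isLUB_csSup hne ⟨_, fun x hx => (hs hx).1.le⟩
      have hlt' : ∀ y ∈ s, y < sSup s := fun y hy =>
        lt_of_le_of_ne (hlub.1 hy) fun h => hmem (h ▸ hy)
      refine ⟨hlt, hE.2 _ ⟨?_, fun x hx => ?_⟩⟩
      · obtain ⟨y, hy⟩ := hne
        exact ⟨e ⟨y, (hs hy).1⟩, e.lt_iff_lt.2 (hlt' y hy)⟩
      · have hx' : (e.symm x : Ordinal) < sSup s := by
          rw [← e.symm.lt_iff_lt, e.symm_apply_apply] at hx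
          exact hx
        obtain ⟨y, hy, hxy⟩ := (lt_isLUB_iff hlub).1 hx'
        obtain ⟨hy1, hyE⟩ := hs hy
        refine ⟨_, hyE, ?_, e.lt_iff_lt.2 (hlt' y hy)⟩
        rw [← e.symm.lt_iff_lt, e.symm_apply_apply]
        exact hxy
    · obtain ⟨y, hy, h⟩ := hE.1 (e ⟨α, hα⟩)
      refine ⟨e.symm y, ⟨(e.symm y).2, by simpa using hy⟩, ?_⟩
      rw [← e.symm.lt_iff_lt, e.symm_apply_apply] at h
      exact le_of_lt h
  obtain ⟨δ, hδ, hcof, hsub⟩ := hguess _ hE'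
  have hlim : Order.IsSuccLimit δ := Ordinal.one_lt_cof_iff.1 (hcof ▸ one_lt_aleph0)
  have hsucc : ∀ x < e ⟨δ, hδ⟩, ∃ y, x < y ∧ y < e ⟨δ, hδ⟩ ∧ ∀ o : Iio (aleph 1).ord,
      Order.succ (e.symm x : Ordinal) ≤ o → y ≤ e o := by
    intro x hx
    rw [← e.symm.lt_iff_lt, e.symm_apply_apply] at hx
    have h1 : Order.succ (e.symm x : Ordinal) < δ := hlim.succ_lt hx
    refine ⟨e ⟨_, h1.trans hδ⟩, ?_, e.lt_iff_lt.2 h1, fun o ho => e.le_iff_le.2 ho⟩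
    rw [← e.symm.lt_iff_lt, e.symm_apply_apply]
    exact Order.lt_succ (e.symm x : Ordinal)
  have hpos : ∃ x, x < e ⟨δ, hδ⟩ :=
    ⟨e ⟨0, hlim.bot_lt.trans hδ⟩, e.lt_iff_lt.2 hlim.bot_lt⟩
  have hclub := hC δ hδ hcof
  obtain ⟨hRC, hlad⟩ := hR (e ⟨δ, hδ⟩) (exists_ladder_subset
    (regLike_toType isRegular_aleph0) hpos (S := Iio (e ⟨δ, hδ⟩)) (fun _ hx => hx) (hctb _)
    (fun x hx => ⟨x, hx, le_rfl⟩) (fun s hs hfin => by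
      have hfin' : s.Finite := lt_aleph0_iff_set_finite.1 hfin
      rcases s.eq_empty_or_nonempty with rfl | hne
      · obtain ⟨x, hx⟩ := hpos
        exact ⟨x, hx, fun y hy => absurd hy (notMem_empty y)⟩
      · obtain ⟨m, hm, hmax⟩ := exists_max_image s id hfin' hne
        obtain ⟨y, h1, h2, -⟩ := hsucc m (hs m hm)
        exact ⟨y, h2, fun x hx => (hmax x hx).trans_lt h1⟩) (fun x hx => by
      obtain ⟨y, h1, h2, h3⟩ := hsucc x hx
      rw [← e.symm.lt_iff_lt, e.symm_apply_apply] at hx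
      obtain ⟨β, hβ, hle⟩ := hclub.2.2 _ (hlim.succ_lt (show (e.symm x : Ordinal) < δ from hx))
      have hβδ : β < δ := hclub.1 hβ
      refine ⟨e ⟨β, hβδ.trans hδ⟩, ?_, h1.trans_le (h3 _ hle), e.lt_iff_lt.2 hβδ⟩
      simpa [C'] using hβ))
  refine ⟨e ⟨δ, hδ⟩, hlad, fun x hx => ?_, fun γ hγ γ' _ hlt => ⟨?_, fun x hx => ?_⟩⟩
  · have h1 := hRC hx
    simp only [C', mem_ofPred_eq, e.symm_apply_apply] at h1
    obtain ⟨h2, h3⟩ := hsub h1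
    have h4 : e (e.symm x) ∈ E := h3
    rwa [e.apply_symm_apply] at h4
  · exact lt_aleph0_iff_set_finite.1 (hlad.init γ (hlad.sub γ hγ))
  · exact lt_trans hx.2 hlt

/-- The restriction of `a` to the indices below `i`, padded with `⊥`. -/
def res {K Λ : Type} [LinearOrder K] [LE Λ] [OrderBot Λ] (a : K → Λ) (i : K) : K → Λ :=
  fun j => if j < i then a j else ⊥

theorem res_of_lt {K Λ : Type} [LinearOrder K] [LE Λ] [OrderBot Λ] (a : K → Λ) {i j : K}
    (h : j < i) : res a i j = a j := if_pos h

/-- A guessing sequence of increasing functions on `K` whose restrictions are enumerated in time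
by `F`. -/
structure Guessing (c : Cardinal.{0}) {K Λ : Type} [LinearOrder K] [LinearOrder Λ] [OrderBot Λ]
    (F : Λ → Set (K → Λ)) (a : Λ → K → Λ) : Prop where
  small : ∀ γ, #(F γ) < c
  le : ∀ γ, ∀ h ∈ F γ, ∀ j, h j ≤ γ
  le_top : ∀ δ i, a δ i ≤ δ
  guess : ∀ E, Club E → ∃ δ, StrictMono (a δ) ∧ (∀ i, a δ i ∈ E) ∧ (∀ i, a δ i < δ) ∧
    ∀ i i', i < i' → res (a δ) i ∈ F (a δ i')

theorem Guess.exists_guessing {k c : Cardinal.{0}} {K Λ : Type} [LinearOrder K]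
    [WellFoundedLT K] [LinearOrder Λ] [WellFoundedLT Λ] [OrderBot Λ] (hK : RegLike k K)
    (hΛ : RegLike c Λ) (hkc : k < c) (h : Guess k c Λ) :
    ∃ (F : Λ → Set (K → Λ)) (a : Λ → K → Λ), Guessing c F a := by
  classical
  obtain ⟨P, C, hP, hC⟩ := h
  choose enum henum using fun X : Set Λ => exists_rec (K := K) (V := Λ)
    (fun i h y => IsLeast {y | y ∈ X ∧ ∀ j (hj : j < i), h j hj < y} y)
  have hlad : ∀ δ, Ladder k δ (C δ) → ∀ i,
      IsLeast {y | y ∈ C δ ∧ ∀ j < i, enum (C δ) j < y} (enum (C δ) i) := by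
    intro δ hδ i
    induction i using WellFoundedLT.induction with
    | ind i ih =>
      refine henum _ i ?_
      obtain ⟨b, hb, hb'⟩ := hδ.cofge (enum (C δ) '' Iio i) (by
        rintro _ ⟨j, hj, rfl⟩
        exact hδ.sub _ (ih j hj).1.1) (mk_image_le.trans_lt (hK.iio i))
      obtain ⟨y, hy, hby⟩ := hδ.cofinal b hb
      obtain ⟨m, hm, hmin⟩ := exists_least (s := {y | y ∈ C δ ∧ ∀ j < i, enum (C δ) j < y})
        ⟨y, hy, fun j hj => (hb' _ ⟨j, hj, rfl⟩).trans hby⟩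
      exact ⟨m, hm, fun z hz => hmin z hz⟩
  have hcoh : ∀ δ, Ladder k δ (C δ) → ∀ i j, j < i →
      enum (C δ ∩ Iio (enum (C δ) i)) j = enum (C δ) j := by
    intro δ hδ i j
    induction j using WellFoundedLT.induction with
    | ind j ih =>
      intro hji
      have h1 := hlad δ hδ j
      have h2 : enum (C δ) j < enum (C δ) i := (hlad δ hδ i).1.2 j hji
      have h3 : IsLeast {y | y ∈ C δ ∩ Iio (enum (C δ) i) ∧ ∀ j' (_ : j' < j),
          enum (C δ ∩ Iio (enum (C δ) i)) j' < y} (enum (C δ) j) := by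
        refine ⟨⟨⟨h1.1.1, h2⟩, fun j' hj' => ?_⟩, fun y hy => h1.2 ⟨hy.1.1, fun j' hj' => ?_⟩⟩
        · rw [ih j' hj' (hj'.trans hji)]
          exact h1.1.2 j' hj'
        · rw [← ih j' hj' (hj'.trans hji)]
          exact hy.2 j' hj'
      exact (henum _ j ⟨_, h3⟩).unique h3
  refine ⟨fun γ => {h | (∀ j, h j ≤ γ) ∧ ∃ X ∈ P γ, ∃ i, h = res (enum X) i},
    fun δ => if Ladder k δ (C δ) then enum (C δ) else fun _ => ⊥, ⟨fun γ => ?_,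
    fun γ h hh => hh.1, fun δ i => ?_, fun E hE => ?_⟩⟩
  · refine lt_of_le_of_lt (mk_le_mk_of_subset
      (t := range fun p : P γ × K => res (enum p.1) p.2) ?_) (mk_range_le.trans_lt ?_)
    · rintro h ⟨-, X, hX, i, rfl⟩
      exact ⟨(⟨X, hX⟩, i), rfl⟩
    · simp only [mk_prod, lift_id, hK.card]
      exact mul_lt_of_lt hΛ.reg.aleph0_le (hP γ) hkc
  · split_ifs with h
    · exact (h.sub _ (hlad δ h i).1.1).le
    · exact bot_le
  · obtain ⟨δ, hδ, hsub, hW⟩ := hC E hE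
    have hmono : StrictMono (enum (C δ)) := fun j i hji => (hlad δ hδ i).1.2 j hji
    have hmem : ∀ i, enum (C δ) i ∈ C δ := fun i => (hlad δ hδ i).1.1
    refine ⟨δ, ?_⟩
    simp only [if_pos hδ]
    refine ⟨hmono, fun i => hsub (hmem i), fun i => hδ.sub _ (hmem i), fun i i' hii' =>
      ⟨fun j => ?_, _, hW _ (hmem i) _ (hmem i') (hmono hii'), i, ?_⟩⟩
    · rw [res]
      split_ifs with h
      · exact (hmono (h.trans hii')).le
      · exact bot_le
    · ext j
      rw [res, res]
      split_ifs with h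
      · exact (hcoh δ hδ i j h).symm
      · rfl

/-- Four interleaved strictly increasing sequences of positions. -/
theorem exists_positions {k : Cardinal.{0}} {K : Type} [LinearOrder K] [WellFoundedLT K]
    (hK : RegLike k K) : ∃ p : Fin 4 → K → K, (∀ i, p 0 i < p 1 i ∧ p 1 i < p 2 i ∧ p 2 i < p 3 i) ∧
      ∀ i j, i < j → p 3 i < p 0 j := by
  choose s hs using hK.exists_gt
  have hne : Nonempty K := mk_ne_zero_iff.1 (by rw [hK.card]; exact hK.reg.pos.ne')
  obtain ⟨f, hf⟩ := exists_rec (K := K) (V := K) (fun i h y => ∀ j (hj : j < i),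
    s (s (s (h j hj))) < y)
  refine ⟨![f, fun i => s (f i), fun i => s (s (f i)), fun i => s (s (s (f i)))],
    fun i => ⟨hs _, hs _, hs _⟩, fun i j hij => hf j ?_ i hij⟩
  obtain ⟨b, hb⟩ := hK.bdd_range (fun i : Iio j => s (s (s (f i)))) (hK.iio j)
  exact ⟨b, fun i hi => hb ⟨i, hi⟩⟩

/-- The points `b ξ` of `B` are separated by the fewer than `c` points of `Q`. -/
structure Separated (c : Cardinal.{0}) {Λ B : Type} [LinearOrder B] (b : Λ → B) (Q : Set B) :
    Prop where
  inj : Function.Injective b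
  small : #Q < c
  disj : ∀ q ∈ Q, ∀ ξ, b ξ ≠ q
  sep : ∀ ξ ξ', b ξ < b ξ' → ∃ q ∈ Q, b ξ < q ∧ q < b ξ'

theorem exists_separated {k c : Cardinal.{0}} (hc : c.IsRegular) (hkc : k < c) (hck : c ≤ 2 ^ k)
    {Λ : Type} (hΛ : #Λ = c) :
    ∃ (B : Type) (_ : LinearOrder B) (b : Λ → B) (Q : Set B), Separated c b Q := by
  classical
  obtain ⟨μ, hμ, hmin⟩ : ∃ μ : Cardinal.{0}, c ≤ 2 ^ μ ∧ ∀ ν < μ, (2 : Cardinal.{0}) ^ ν < c := by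
    obtain ⟨μ, hμ, hmin⟩ := WellFounded.has_min (wellFounded_lt (α := Cardinal.{0}))
      {μ | c ≤ 2 ^ μ} ⟨k, hck⟩
    exact ⟨μ, hμ, fun ν hν => not_le.1 fun h => hmin ν h hν⟩
  have hμc : μ < c := lt_of_le_of_lt (not_lt.1 fun h => (hmin k h).not_ge hck) hkc
  let I := μ.ord.ToType
  have hI : #I = μ := mk_ord_toType μ
  obtain ⟨e⟩ : Nonempty (Λ ↪ (I → Bool)) := by
    rw [← le_def, hΛ]
    simpa [hI] using hμ
  let u : (I → Bool) → I → Fin 3 := fun g j => if g j then 2 else 0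
  let q : (i : I) → (Iio i → Bool) → I → Fin 3 := fun i g j =>
    if h : j < i then (if g ⟨j, h⟩ then 2 else 0) else if j = i then 1 else 0
  have hu1 : ∀ g j, u g j ≠ 1 := fun g j => by
    simp only [u]
    split_ifs <;> decide
  refine ⟨Lex (I → Fin 3), inferInstance, fun ξ => toLex (u (e ξ)),
    ⋃ i : I, range fun g : Iio i → Bool => toLex (q i g), ⟨?_, ?_, ?_, ?_⟩⟩
  · intro ξ ξ' h
    refine e.injective (funext fun j => ?_)
    have h1 : u (e ξ) j = u (e ξ') j := congrFun (toLex_inj.1 h) j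
    simp only [u] at h1
    cases h2 : e ξ j <;> cases h3 : e ξ' j <;> simp [h2, h3] at h1 ⊢
  · rw [card_iUnion_lt_iff_forall_of_isRegular hc (by rwa [hI])]
    intro i
    refine mk_range_le.trans_lt ?_
    have h1 : #(Iio i) < μ := by
      have := mk_Iio_lt i (by rw [hI]; simp [I])
      rwa [hI] at this
    simpa using hmin _ h1
  · intro x hx ξ h
    obtain ⟨i, g, rfl⟩ := mem_iUnion.1 hx
    have h1 : u (e ξ) i = q i g i := congrFun (toLex_inj.1 h) i
    refine hu1 (e ξ) i (h1.trans ?_)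
    simp [q]
  · rintro ξ ξ' ⟨i, heq, hlt⟩
    have heq' : ∀ j < i, u (e ξ) j = u (e ξ') j := heq
    have hlt' : u (e ξ) i < u (e ξ') i := hlt
    have hq : ∀ j < i, q i (fun j => e ξ j) j = u (e ξ) j := fun j hj => by simp [q, u, hj]
    have hqi : q i (fun j => e ξ j) i = 1 := by simp [q]
    have h1 : u (e ξ) i < 1 ∧ 1 < u (e ξ') i := by
      have := hu1 (e ξ) i
      have := hu1 (e ξ') i
      omega
    refine ⟨_, mem_iUnion.2 ⟨i, fun j => e ξ j, rfl⟩, ⟨i, fun j hj => (hq j hj).symm, ?_⟩,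
      ⟨i, fun j hj => (hq j hj).trans (heq' j hj), ?_⟩⟩
    · exact h1.1.trans_eq hqi.symm
    · exact hqi.trans_lt h1.2

section Lex

variable {K V : Type} [LinearOrder K] [WellFoundedLT K] [LinearOrder V] {u v z : K → V}

omit [LinearOrder V] in
theorem exists_first_diff (h : u ≠ v) : ∃ i, (∀ j < i, u j = v j) ∧ u i ≠ v i := by
  obtain ⟨i, hi⟩ := Function.ne_iff.1 h
  obtain ⟨m, hm, hmin⟩ := exists_least (s := {i | u i ≠ v i}) ⟨i, hi⟩
  exact ⟨m, fun j hj => by_contra fun h => (hmin j h).not_gt hj, hm⟩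

omit [WellFoundedLT K] in
theorem toLex_lt_of {i : K} (h : ∀ j < i, u j = v j) (hlt : u i < v i) : toLex u < toLex v :=
  ⟨i, h, hlt⟩

omit [WellFoundedLT K] in
theorem toLex_lt_iff {i : K} (h : ∀ j < i, u j = v j) (hne : u i ≠ v i) :
    toLex u < toLex v ↔ u i < v i := by
  refine ⟨fun hlt => ?_, toLex_lt_of h⟩
  by_contra hn
  exact lt_asymm hlt (toLex_lt_of (fun j hj => (h j hj).symm)
    (lt_of_le_of_ne (not_lt.1 hn) hne.symm))

/-- `y` and `x` realize the same cut over `Z`. -/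
def SameCut {M : Type} [LT M] (Z : Set M) (y x : M) : Prop :=
  ∀ z ∈ Z, (z < y ↔ z < x) ∧ (y < z ↔ x < z)

theorem toLex_lt_congr {k : K} (huv : ∀ j ≤ k, u j = v j) (hz : ∃ j ≤ k, z j ≠ u j) :
    (toLex z < toLex u ↔ toLex z < toLex v) ∧ (toLex u < toLex z ↔ toLex v < toLex z) := by
  obtain ⟨j, hj, hzj⟩ := hz
  obtain ⟨i, hi, hzi⟩ := exists_first_diff (u := z) (v := u) (fun h => hzj (congrFun h j))
  have hik : i ≤ k := le_trans (not_lt.1 fun h => hzj (hi j h)) hj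
  have hv : ∀ l < i, z l = v l := fun l hl => (hi l hl).trans (huv l (hl.le.trans hik))
  have hvi : z i ≠ v i := by rwa [← huv i hik]
  constructor
  · rw [toLex_lt_iff hi hzi, toLex_lt_iff hv hvi, huv i hik]
  · rw [toLex_lt_iff (fun l hl => (hi l hl).symm) hzi.symm,
      toLex_lt_iff (fun l hl => (hv l hl).symm) hvi.symm, huv i hik]

end Lex

section Levels

variable {Λ X Y : Type} [LinearOrder Λ] {c : Cardinal.{0}}

theorem SmallFibers.prod (hc : ℵ₀ ≤ c) {l : X → Λ} {l' : Y → Λ} (hl : SmallFibers c l)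
    (hl' : SmallFibers c l') : SmallFibers c (fun t : X × Y => max (l t.1) (l' t.2)) := by
  intro γ
  refine lt_of_le_of_lt (mk_le_of_injective (β := {x | l x < γ} × {y | l' y < γ})
    (f := fun t => (⟨t.1.1, (le_max_left _ _).trans_lt t.2⟩,
      ⟨t.1.2, (le_max_right _ _).trans_lt t.2⟩)) ?_) ?_
  · rintro ⟨⟨x, y⟩, h⟩ ⟨⟨x', y'⟩, h'⟩ hxy
    simpa using hxy
  · simp only [mk_prod, lift_id]
    exact mul_lt_of_lt hc (hl γ) (hl' γ)

theorem SmallFibers.sum (hc : ℵ₀ ≤ c) {l : X → Λ} {l' : Y → Λ} (hl : SmallFibers c l)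
    (hl' : SmallFibers c l') : SmallFibers c (Sum.elim l l') := by
  intro γ
  refine lt_of_le_of_lt (mk_le_of_surjective (α := {x | l x < γ} ⊕ {y | l' y < γ})
    (f := Sum.elim (fun x => ⟨Sum.inl x.1, x.2⟩) (fun y => ⟨Sum.inr y.1, y.2⟩)) ?_) ?_
  · rintro ⟨x | y, h⟩
    · exact ⟨Sum.inl ⟨x, h⟩, rfl⟩
    · exact ⟨Sum.inr ⟨y, h⟩, rfl⟩
  · simp only [mk_sum, lift_id]
    exact add_lt_of_lt hc (hl γ) (hl' γ)

theorem SmallFibers.card_le (hΛ : RegLike c Λ) {l : X → Λ} (hl : SmallFibers c l) : #X ≤ c := by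
  have h : (⋃ γ, {x | l x < γ}) = Set.univ := by
    refine eq_univ_of_forall fun x => ?_
    obtain ⟨b, hb⟩ := hΛ.exists_gt (l x)
    exact mem_iUnion.2 ⟨b, hb⟩
  rw [← mk_univ, ← h]
  refine (mk_iUnion_le _).trans ?_
  rw [hΛ.card]
  exact mul_le_of_le hΛ.reg.aleph0_le le_rfl (ciSup_le' fun γ => (hl γ).le)

theorem SmallFibers.map [WellFoundedLT Λ] {l : X → Λ} (hl : SmallFibers c l) {f : X → Y}
    (hf : Function.Surjective f) : ∃ l' : Y → Λ, SmallFibers c l' ∧ (∀ x, l' (f x) ≤ l x) ∧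
      ∀ y, ∃ x, f x = y ∧ l' y = l x := by
  have h : ∀ y, ∃ x, f x = y ∧ ∀ x', f x' = y → l x ≤ l x' := fun y => by
    obtain ⟨_, ⟨x, hx, rfl⟩, hmin⟩ := exists_least (s := l '' {x | f x = y})
      (let ⟨x, hx⟩ := hf y; ⟨_, x, hx, rfl⟩)
    exact ⟨x, hx, fun x' hx' => hmin _ ⟨x', hx', rfl⟩⟩
  choose g hg hmin using h
  refine ⟨fun y => l (g y), fun γ => ?_, fun x => hmin _ x rfl, fun y => ⟨g y, hg y, rfl⟩⟩
  refine lt_of_le_of_lt (mk_le_mk_of_subset (t := f '' {x | l x < γ}) ?_)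
    (mk_image_le.trans_lt (hl γ))
  exact fun y hy => ⟨g y, hy, hg y⟩

end Levels

section CodedOrder

variable {K Λ B : Type} [LinearOrder K] [LinearOrder B]

open Classical in
/-- The value of `h` at the position that codes whether `k` belongs to `A`. -/
noncomputable def sel (p : Fin 4 → K → K) (A : Set K) (h : K → Λ) (k : K) : Λ :=
  if k ∈ A then h (p 2 k) else h (p 3 k)

/-- The point of `B` with the given index. -/
def val (b : Λ → B) (Q : Set B) : Λ ⊕ Q → B := Sum.elim b Subtype.val

/-- The sequence that follows `h` below `k`, takes the value `t` at `k`, and stops there. -/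
noncomputable def node (b : Λ → B) (p : Fin 4 → K → K) (A : Set K) (h : K → Λ) (k : K) (t : B) :
    K → WithBot B :=
  fun j => if j < k then (b (sel p A h j) : WithBot B) else if j = k then (t : WithBot B) else ⊥

variable {b : Λ → B} {p : Fin 4 → K → K} {A : Set K} {h : K → Λ} {j k : K} {t : B}

omit [LinearOrder B] in
theorem node_lt (hj : j < k) : node b p A h k t j = (b (sel p A h j) : WithBot B) := if_pos hj

omit [LinearOrder B] in
theorem node_self : node b p A h k t k = (t : WithBot B) := by simp [node]

omit [LinearOrder B] in
theorem node_gt (hj : k < j) : node b p A h k t j = ⊥ := by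
  simp [node, hj.ne', hj.not_gt]

variable [WellFoundedLT K] [LinearOrder Λ] [WellFoundedLT Λ] [OrderBot Λ] {κ c : Cardinal.{0}}
  {F : Λ → Set (K → Λ)} {a : Λ → K → Λ} {Q : Set B}

theorem exists_coded_order (hK : RegLike κ K) (hΛ : RegLike c Λ) (hkc : κ < c)
    (hG : Guessing c F a) (hB : Separated c b Q)
    (hp : ∀ i, p 0 i < p 1 i ∧ p 1 i < p 2 i ∧ p 2 i < p 3 i)
    (hp' : ∀ i j, i < j → p 3 i < p 0 j) (A : Set K) :
    ∃ (M : Type) (_ : LinearOrder M) (l : M → Λ) (x : Λ → M), SmallFibers c l ∧ #M = c ∧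
      ∀ δ, StrictMono (a δ) → (∀ i i', i < i' → res (a δ) i ∈ F (a δ i')) → ∀ k,
        a δ (p 3 k) ≤ l (x δ) ∧ (k ∈ A ↔ ∃ y, l y < a δ (p 3 k) ∧
          SameCut {z | l z < a δ (p 2 k)} y (x δ)) := by
  let H := {h : K → Λ // ∃ γ, h ∈ F γ}
  have hl : ∀ h : H, ∃ γ, h.1 ∈ F γ ∧ ∀ γ', h.1 ∈ F γ' → γ ≤ γ' := fun h =>
    let ⟨m, hm, hmin⟩ := exists_least (s := {γ | h.1 ∈ F γ}) h.2
    ⟨m, hm, fun γ' hγ' => hmin γ' hγ'⟩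
  choose lH hlH hlHmin using hl
  have hlHs : SmallFibers c lH := fun γ => by
    refine lt_of_le_of_lt (mk_le_of_injective (β := ⋃ γ' : Iio γ, F γ')
      (f := fun h => ⟨h.1.1, mem_iUnion.2 ⟨⟨_, h.2⟩, hlH h.1⟩⟩) ?_) ?_
    · intro h h' hh
      exact Subtype.ext (Subtype.ext (Subtype.mk.inj hh))
    · rw [card_iUnion_lt_iff_forall_of_isRegular hΛ.reg (hΛ.iio _)]
      exact fun γ' => hG.small γ'
  have hω := hΛ.reg.aleph0_le
  let lC : Λ ⊕ Q → Λ := Sum.elim (fun ξ => ξ) (fun _ => ⊥)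
  have hlC : SmallFibers c lC := (SmallFibers.id hΛ).sum hω (SmallFibers.const hB.small ⊥)
  let J := (H × K × (Λ ⊕ Q)) ⊕ Λ
  let lJ : J → Λ := Sum.elim (fun t => max (lH t.1) (max ⊥ (lC t.2.2))) (fun ξ => ξ)
  have hlJ : SmallFibers c lJ := (hlHs.prod hω ((SmallFibers.const (X := K)
    (by rw [hK.card]; exact hkc) ⊥).prod hω hlC)).sum hω (SmallFibers.id hΛ)
  let branch : Λ → K → WithBot B := fun δ j => (b (sel p A (a δ) j) : WithBot B)
  let pt : J → Lex (K → WithBot B) := Sum.elim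
    (fun t => toLex (node b p A t.1.1 t.2.1 (val b Q t.2.2))) (fun δ => toLex (branch δ))
  obtain ⟨l, hls, hle, heq⟩ := hlJ.map (rangeFactorization_surjective (f := pt))
  let u : range pt → K → WithBot B := fun m => ofLex m.1
  have hu : ∀ m m', u m = u m' → m = m' := fun m m' h => Subtype.ext h
  have hult : ∀ m m', m < m' ↔ toLex (u m) < toLex (u m') := fun _ _ => Iff.rfl
  let e : H → K → Λ ⊕ Q → range pt := fun h k t => ⟨_, ⟨Sum.inl (h, k, t), rfl⟩⟩
  let x : Λ → range pt := fun δ => ⟨_, ⟨Sum.inr δ, rfl⟩⟩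
  have hue : ∀ h k t, u (e h k t) = node b p A h.1 k (val b Q t) := fun _ _ _ => rfl
  have hux : ∀ δ, u (x δ) = branch δ := fun _ => rfl
  have hle_e : ∀ h k t, l (e h k t) ≤ max (lH h) (lC t) := fun h k t =>
    (hle (Sum.inl (h, k, t))).trans (max_le_max le_rfl (max_le bot_le le_rfl))
  have hrep : ∀ m, (∃ h k t, m = e h k t) ∨ ∃ δ, m = x δ := by
    rintro ⟨_, ⟨⟨h, k, t⟩ | δ, rfl⟩⟩
    · exact Or.inl ⟨h, k, t, rfl⟩
    · exact Or.inr ⟨δ, rfl⟩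
  have hselle : ∀ (h : K → Λ) γ, (∀ j, h j ≤ γ) → ∀ j, sel p A h j ≤ γ := fun h γ hh j => by
    rw [sel]
    split_ifs <;> exact hh _
  have hcoord : ∀ m i ξ, u m i = (b ξ : WithBot B) → ξ ≤ l m := by
    intro m i ξ hmi
    obtain ⟨s, rfl, hs⟩ := heq m
    rw [hs]
    rcases s with ⟨h, k, t⟩ | δ
    · have hmi' : node b p A h.1 k (val b Q t) i = (b ξ : WithBot B) := hmi
      rcases lt_trichotomy i k with hik | rfl | hik
      · rw [node_lt hik] at hmi'
        rw [← hB.inj (WithBot.coe_inj.1 hmi')]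
        exact le_max_of_le_left (hselle _ _ (hG.le _ _ (hlH h)) _)
      · rw [node_self] at hmi'
        rcases t with ξ' | q
        · rw [← hB.inj (WithBot.coe_inj.1 hmi')]
          exact le_max_of_le_right (le_max_right _ _)
        · exact absurd (WithBot.coe_inj.1 hmi').symm (hB.disj _ q.2 _)
      · rw [node_gt hik] at hmi'
        exact absurd hmi' WithBot.bot_ne_coe
    · have hmi' : (b (sel p A (a δ) i) : WithBot B) = (b ξ : WithBot B) := hmi
      rw [← hB.inj (WithBot.coe_inj.1 hmi')]
      exact hselle _ _ (hG.le_top δ) _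
  refine ⟨range pt, inferInstance, l, x, hls, le_antisymm (hls.card_le hΛ) ?_, ?_⟩
  · obtain ⟨δ, -, -, -, h⟩ := hG.guess Set.univ (club_univ hΛ)
    have hne : Nonempty K := mk_ne_zero_iff.1 (by rw [hK.card]; exact hK.reg.pos.ne')
    obtain ⟨k⟩ := hne
    obtain ⟨k', hk'⟩ := hK.exists_gt k
    rw [← hΛ.card]
    refine mk_le_of_injective (f := fun ξ => e ⟨_, _, h k k' hk'⟩ k (Sum.inl ξ)) ?_
    intro ξ ξ' hξ
    have h1 := congrFun (congrArg u hξ) k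
    simp only [hue, node_self] at h1
    exact hB.inj (WithBot.coe_inj.1 h1)
  intro δ hmono hres k
  have hsel2 : ∀ j, a δ (p 2 j) ≤ sel p A (a δ) j := fun j => by
    rw [sel]
    split_ifs
    · exact le_rfl
    · exact (hmono (hp j).2.2).le
  have hsel3 : ∀ j, sel p A (a δ) j ≤ a δ (p 3 j) := fun j => by
    rw [sel]
    split_ifs
    · exact (hmono (hp j).2.2).le
    · exact le_rfl
  let h : H := ⟨res (a δ) (p 0 k), _, hres _ _ (hp k).1⟩
  have hlh : lH h < a δ (p 2 k) := (hlHmin h _ (hres _ _ (hp k).1)).trans_lt (hmono (hp k).2.1)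
  have hselh : ∀ j < k, sel p A h.1 j = sel p A (a δ) j := fun j hj => by
    have h3 := hp' j k hj
    change sel p A (res (a δ) (p 0 k)) j = _
    rw [sel, sel, res_of_lt _ h3, res_of_lt _ ((hp j).2.2.trans h3)]
  have hsellt : ∀ j < k, sel p A (a δ) j < a δ (p 2 k) := fun j hj =>
    (hsel3 j).trans_lt (hmono ((hp' j k hj).trans ((hp k).1.trans (hp k).2.1)))
  have hbelow : ∀ i ≤ k, ∀ t, ∀ j < i, u (e h i t) j = u (x δ) j := fun i hi t j hj => by
    rw [hue, node_lt hj, hselh j (hj.trans_le hi), hux]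
  have hsmall : ∀ i t, lC t < a δ (p 2 k) → l (e h i t) < a δ (p 2 k) := fun i t ht =>
    (hle_e _ _ _).trans_lt (max_lt hlh ht)
  have hqsmall : ∀ i q, l (e h i (Sum.inr q)) < a δ (p 2 k) := fun i q =>
    hsmall i _ (bot_le.trans_lt hlh)
  refine ⟨?_, fun hkA => ?_, fun ⟨y, hy, hcut⟩ => by_contra fun hkA => ?_⟩
  · obtain ⟨k', hk'⟩ := hK.exists_gt k
    refine le_trans ?_ (hcoord (x δ) k' _ rfl)
    exact (hmono ((hp' k k' hk').trans ((hp k').1.trans (hp k').2.1))).le.trans (hsel2 k')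
  · have hselk : sel p A (a δ) k = a δ (p 2 k) := if_pos hkA
    refine ⟨e h k (Sum.inl (a δ (p 2 k))), (hle_e _ _ _).trans_lt
      (max_lt (hlh.trans (hmono (hp k).2.2)) (hmono (hp k).2.2)), fun z hz => ?_⟩
    have hek : u (e h k (Sum.inl (a δ (p 2 k)))) k = (b (a δ (p 2 k)) : WithBot B) := by
      rw [hue, node_self]; rfl
    simp only [hult]
    refine toLex_lt_congr (k := k) (fun j hj => ?_) ⟨k, le_rfl, fun hzk => ?_⟩
    · rcases hj.lt_or_eq with hj | rfl
      · exact hbelow k le_rfl _ j hj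
      · rw [hek, hux]
        simp only [branch, hselk]
    · exact (hcoord z k _ (hzk.trans hek)).not_gt hz
  have hselk : sel p A (a δ) k = a δ (p 3 k) := if_neg hkA
  have hyk : u y k ≠ u (x δ) k := fun hyk => by
    have := hcoord y k (sel p A (a δ) k) hyk
    rw [hselk] at this
    exact this.not_gt hy
  obtain ⟨i, hi, hyi⟩ := exists_first_diff (fun h => hyk (congrFun h k))
  have hik : i ≤ k := not_lt.1 fun h => hyk (hi k h)
  have hxi : ∀ i, u (x δ) i = (b (sel p A (a δ) i) : WithBot B) := fun _ => rfl
  have heq_y : ∀ t, ∀ j < i, u (e h i t) j = u y j := fun t j hj =>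
    (hbelow i hik t j hj).trans (hi j hj).symm
  have hei : ∀ q : Q, u (e h i (Sum.inr q)) i = ((q : B) : WithBot B) := fun q => by
    rw [hue, node_self]; rfl
  rcases lt_or_gt_of_ne hyi with hlt | hlt
  · have hyx : y < x δ := (hult _ _).2 (toLex_lt_of hi hlt)
    have hyl : ¬ l y < a δ (p 2 k) := fun hyl => lt_irrefl y (((hcut y hyl).1).2 hyx)
    have hnb : ∀ ξ, u y i ≠ (b ξ : WithBot B) := by
      intro ξ hξ
      rw [hξ, hxi, WithBot.coe_lt_coe] at hlt
      obtain ⟨q, hq, h1, h2⟩ := hB.sep _ _ hlt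
      have hzx : e h i (Sum.inr ⟨q, hq⟩) < x δ := (hult _ _).2 (toLex_lt_of (hbelow i hik _)
        (by rw [hei, hxi]; exact WithBot.coe_lt_coe.2 h2))
      have hyz : y < e h i (Sum.inr ⟨q, hq⟩) := (hult _ _).2
        (toLex_lt_of (fun j hj => (heq_y _ j hj).symm)
          (by rw [hei, hξ]; exact WithBot.coe_lt_coe.2 h1))
      exact lt_asymm hyz (((hcut _ (hqsmall i _)).1).2 hzx)
    rcases hrep y with ⟨h', k', t, rfl⟩ | ⟨δ', rfl⟩
    · have hagree : ∀ t', val b Q t' = val b Q t → k' ≤ i → e h' k' t = e h k' t' := by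
        intro t' ht' hki
        refine hu _ _ (funext fun j => ?_)
        rcases lt_trichotomy j k' with hj | rfl | hj
        · rw [hi j (hj.trans_le hki), hbelow k' (hki.trans hik) _ j hj]
        · rw [hue, hue, node_self, node_self, ht']
        · rw [hue, hue, node_gt hj, node_gt hj]
      rcases lt_trichotomy i k' with hik' | rfl | hik'
      · exact hnb _ (by rw [hue, node_lt hik'])
      · rcases t with ξ | q
        · exact hnb ξ (by rw [hue, node_self]; rfl)
        · rw [hagree _ rfl le_rfl] at hyl
          exact hyl (hqsmall _ _)
      · have h1 := hi k' hik'
        rw [hue, node_self, hxi] at h1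
        rw [hagree (Sum.inl (sel p A (a δ) k')) (WithBot.coe_inj.1 h1).symm hik'.le] at hyl
        exact hyl (hsmall _ _ (hsellt k' (hik'.trans_le hik)))
    · exact hnb (sel p A (a δ') i) rfl
  · have hq : ∃ q ∈ Q, u (x δ) i < ((q : B) : WithBot B) ∧ ((q : B) : WithBot B) ≤ u y i := by
      have hb : ∀ ξ, u y i = (b ξ : WithBot B) → ∃ q ∈ Q, u (x δ) i < ((q : B) : WithBot B) ∧
          ((q : B) : WithBot B) ≤ u y i := by
        intro ξ hξ
        rw [hξ, hxi, WithBot.coe_lt_coe] at hlt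
        obtain ⟨q, hq, h1, h2⟩ := hB.sep _ _ hlt
        refine ⟨q, hq, ?_, ?_⟩
        · rw [hxi]; exact WithBot.coe_lt_coe.2 h1
        · rw [hξ]; exact WithBot.coe_le_coe.2 h2.le
      rcases hrep y with ⟨h', k', t, rfl⟩ | ⟨δ', rfl⟩
      · rcases lt_trichotomy i k' with hik' | rfl | hik'
        · exact hb _ (by rw [hue, node_lt hik'])
        · rcases t with ξ | q
          · exact hb ξ (by rw [hue, node_self]; rfl)
          · exact ⟨q, q.2, by rwa [hue, node_self] at hlt, by rw [hue, node_self]; exact le_rfl⟩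
        · rw [hue, node_gt hik'] at hlt
          exact absurd hlt not_lt_bot
      · exact hb (sel p A (a δ') i) rfl
    obtain ⟨q, hq, h1, h2⟩ := hq
    have hxz : x δ < e h i (Sum.inr ⟨q, hq⟩) := (hult _ _).2
      (toLex_lt_of (fun j hj => (hbelow i hik _ j hj).symm) (by rw [hei]; exact h1))
    obtain ⟨j, hj, hlt'⟩ := ((hcut _ (hqsmall i _)).2).2 hxz
    have hlt'' : u y j < u (e h i (Sum.inr ⟨q, hq⟩)) j := hlt'
    rcases lt_trichotomy j i with hji | rfl | hji
    · rw [heq_y _ j hji] at hlt''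
      exact lt_irrefl _ hlt''
    · rw [hei] at hlt''
      exact h2.not_gt hlt''
    · rw [hue, node_gt hji] at hlt''
      exact not_lt_bot hlt''

end CodedOrder

section Preservation

variable {Λ M L : Type} [LinearOrder Λ] [LinearOrder M] [LinearOrder L]

/-- The levels `γ` and `γ'` are closed under the operations needed for `f` to preserve and reflect
whether a cut over level `γ` is realized at level `γ'`. -/
structure Reflecting (f : M → L) (lM : M → Λ) (lL : L → Λ) (γ γ' : Λ) : Prop where
  map : ∀ x, lM x < γ → lL (f x) < γ
  map' : ∀ x, lM x < γ' → lL (f x) < γ'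
  inv : ∀ x, lL (f x) < γ → lM x < γ
  inv' : ∀ x, lL (f x) < γ' → lM x < γ'
  le : γ ≤ γ'
  left : ∀ z z', lL z < γ → lL z' < γ → (∃ w, z < f w ∧ f w ≤ z') →
    ∃ w, lM w < γ ∧ z < f w ∧ f w ≤ z'
  right : ∀ z z', lL z < γ → lL z' < γ → (∃ w, f w < z ∧ z' ≤ f w) →
    ∃ w, lM w < γ ∧ f w < z ∧ z' ≤ f w
  above : ∀ z, lL z < γ' → (∃ x, z < f x ∧ ∀ w, lM w < γ → z < f w → x < w) →
    ∃ x, lM x < γ' ∧ z < f x ∧ ∀ w, lM w < γ → z < f w → x < w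
  below : ∀ z, lL z < γ' → (∃ x, f x < z ∧ ∀ w, lM w < γ → f w < z → w < x) →
    ∃ x, lM x < γ' ∧ f x < z ∧ ∀ w, lM w < γ → f w < z → w < x

variable {f : M → L} {lM : M → Λ} {lL : L → Λ} {γ γ' : Λ}

theorem Reflecting.dual (h : Reflecting f lM lL γ γ') :
    Reflecting (M := Mᵒᵈ) (L := Lᵒᵈ) f lM lL γ γ' where
  map := h.map
  map' := h.map'
  inv := h.inv
  inv' := h.inv'
  le := h.le
  left := h.right
  right := h.left
  above := h.below
  below := h.above

theorem SameCut.dual {Z : Set M} {y x : M} (h : SameCut Z y x) : SameCut (M := Mᵒᵈ) Z y x :=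
  fun z hz => (h z hz).symm

theorem Reflecting.preserves_of_lt (h : Reflecting f lM lL γ γ') (hf : StrictMono f) {x y : M}
    (hx : γ' ≤ lM x) (hy : lM y < γ') (hyx : SameCut {z | lM z < γ} y x) (hlt : y < x) :
    ∃ y', lL y' < γ' ∧ SameCut {z | lL z < γ} y' (f x) := by
  by_cases hc : ∃ z, lL z < γ ∧ f y < z ∧ z < f x
  · obtain ⟨z, hz, hyz, hzx⟩ := hc
    have hxw : ∀ w, lM w < γ → z < f w → x < w := fun w hw hzw =>
      ((hyx w hw).2).1 (hf.lt_iff_lt.1 (hyz.trans hzw))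
    obtain ⟨x', hx', hzx', hx'w⟩ := h.above z (hz.trans_le h.le) ⟨x, hzx, hxw⟩
    have hL : ∀ z', lL z' < γ → (z' < f x → z' < f x') ∧ (f x < z' → f x' < z') := by
      refine fun z' hz' => ⟨fun hlt' => lt_of_not_ge fun hle => ?_, fun hlt' => ?_⟩
      · obtain ⟨w, hw, hzw, hwz⟩ := h.left z z' hz hz' ⟨x', hzx', hle⟩
        exact ((hf (hxw w hw hzw)).trans_le hwz).not_gt hlt'
      · obtain ⟨w, hw, hzw, hwz⟩ := h.left z z' hz hz' ⟨x, hzx, hlt'.le⟩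
        exact (hf (hx'w w hw hzw)).trans_le hwz
    have hne : ∀ z', lL z' < γ → z' ≠ f x := by
      rintro _ hz' rfl
      exact hx.not_gt (h.inv' _ (hz'.trans_le h.le))
    refine ⟨f x', h.map' _ hx', fun z' hz' => ⟨⟨fun hlt' => ?_, (hL z' hz').1⟩,
      ⟨fun hlt' => ?_, (hL z' hz').2⟩⟩⟩
    · exact lt_of_le_of_ne (not_lt.1 fun h' => lt_asymm ((hL z' hz').2 h') hlt') (hne z' hz')
    · exact lt_of_le_of_ne (not_lt.1 fun h' => lt_asymm ((hL z' hz').1 h') hlt') (hne z' hz').symm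
  · push Not at hc
    have hyn : ∀ z, lL z < γ → z ≠ f y := by
      rintro _ hz rfl
      exact lt_irrefl y (((hyx y (h.inv _ hz)).1).2 hlt)
    have hxn : ∀ z, lL z < γ → z ≠ f x := by
      rintro _ hz rfl
      exact hx.not_gt (h.inv' _ (hz.trans_le h.le))
    refine ⟨f y, h.map' _ hy, fun z hz => ⟨⟨fun h' => h'.trans (hf hlt), fun h' => ?_⟩,
      ⟨fun h' => ?_, fun h' => (hf hlt).trans h'⟩⟩⟩
    · exact lt_of_le_of_ne (not_lt.1 fun h'' => (hc z hz h'').not_gt h') (hyn z hz)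
    · exact lt_of_le_of_ne (hc z hz h') (hxn z hz).symm

theorem Reflecting.reflects_of_lt (h : Reflecting f lM lL γ γ') (hf : StrictMono f) {x : M} {y : L}
    (hx : γ' ≤ lM x) (hy : lL y < γ') (hyx : SameCut {z | lL z < γ} y (f x)) (hlt : f x < y) :
    ∃ y', lM y' < γ' ∧ SameCut {z | lM z < γ} y' x := by
  obtain ⟨x', hx', hxy, hw⟩ := h.below y hy
    ⟨x, hlt, fun w hw hwy => hf.lt_iff_lt.1 (((hyx _ (h.map w hw)).1).1 hwy)⟩
  have h1 : ∀ w, lM w < γ → w < x' → w < x := fun w hw' hlt' =>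
    hf.lt_iff_lt.1 (((hyx _ (h.map w hw')).1).1 ((hf hlt').trans hxy))
  have h2 : ∀ w, lM w < γ → w < x → w < x' := fun w hw' hlt' => hw w hw' ((hf hlt').trans hlt)
  refine ⟨x', hx', fun w hw' => ⟨⟨h1 w hw', h2 w hw'⟩, ⟨fun hlt' => ?_, fun hlt' => ?_⟩⟩⟩
  · refine lt_of_le_of_ne (not_lt.1 fun h' => lt_asymm (h2 w hw' h') hlt') ?_
    rintro rfl
    exact hx.not_gt (hw'.trans_le h.le)
  · exact hf.lt_iff_lt.1 (hxy.trans (((hyx _ (h.map w hw')).2).2 (hf hlt')))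

theorem Reflecting.realized_iff (h : Reflecting f lM lL γ γ') (hf : StrictMono f) {x : M}
    (hx : γ' ≤ lM x) : (∃ y, lM y < γ' ∧ SameCut {z | lM z < γ} y x) ↔
      ∃ y, lL y < γ' ∧ SameCut {z | lL z < γ} y (f x) := by
  constructor
  · rintro ⟨y, hy, hyx⟩
    rcases lt_trichotomy y x with hlt | rfl | hlt
    · exact h.preserves_of_lt hf hx hy hyx hlt
    · exact absurd hy hx.not_gt
    · obtain ⟨y', hy', hc⟩ := h.dual.preserves_of_lt hf.dual hx hy hyx.dual hlt
      exact ⟨y', hy', hc.dual⟩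
  · rintro ⟨y, hy, hyx⟩
    rcases lt_trichotomy y (f x) with hlt | rfl | hlt
    · obtain ⟨y', hy', hc⟩ := h.dual.reflects_of_lt hf.dual hx hy hyx.dual hlt
      exact ⟨y', hy', hc.dual⟩
    · exact absurd (h.inv' x hy) hx.not_gt
    · exact h.reflects_of_lt hf hx hy hyx hlt

theorem exists_club_reflecting [WellFoundedLT Λ] [Nonempty M] {c : Cardinal.{0}}
    (hΛ : RegLike c Λ) (hc : ℵ₀ < c)
    (hM : SmallFibers c lM) (hL : SmallFibers c lL) (hf : StrictMono f) :
    ∃ E, Club E ∧ ∀ γ ∈ E, ∀ γ' ∈ E, γ < γ' → Reflecting f lM lL γ γ' := by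
  have hid := SmallFibers.id hΛ
  let ε : (M → Prop) → M := Classical.epsilon
  have hε : ∀ {p : M → Prop}, (∃ x, p x) → p (ε p) := fun h => Classical.epsilon_spec h
  have h1 := club_closed hΛ hc lL hM hM fun x _ => f x
  have h2 := club_closed hΛ hc lM hL hL fun y _ => ε fun x => f x = y
  have h3 := club_closed hΛ hc lM hL hL fun z z' => ε fun w => z < f w ∧ f w ≤ z'
  have h4 := club_closed hΛ hc lM hL hL fun z z' => ε fun w => f w < z ∧ z' ≤ f w
  have h5 := club_closed hΛ hc lM hid hL fun γ z =>
    ε fun x => z < f x ∧ ∀ w, lM w < γ → z < f w → x < w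
  have h6 := club_closed hΛ hc lM hid hL fun γ z =>
    ε fun x => f x < z ∧ ∀ w, lM w < γ → f w < z → w < x
  have hi := fun {E F : Set Λ} => club_inter (E := E) (F := F) hΛ hc
  refine ⟨_, hi h1 (hi h2 (hi h3 (hi h4 (hi h5 h6)))), ?_⟩
  rintro γ ⟨g1, g2, g3, g4, -, -⟩ γ' ⟨g1', g2', -, -, g5', g6'⟩ hγ
  have hinv : ∀ x, ε (fun x' => f x' = f x) = x := fun x =>
    hf.injective (hε (p := fun x' => f x' = f x) ⟨x, rfl⟩)
  exact
    { map := fun x hx => g1 x x hx hx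
      map' := fun x hx => g1' x x hx hx
      inv := fun x hx => by simpa only [hinv] using g2 _ _ hx hx
      inv' := fun x hx => by simpa only [hinv] using g2' _ _ hx hx
      le := hγ.le
      left := fun z z' hz hz' h => ⟨_, g3 z z' hz hz', hε h⟩
      right := fun z z' hz hz' h => ⟨_, g4 z z' hz hz', hε h⟩
      above := fun z hz h => ⟨_, g5' γ z hγ hz, hε h⟩
      below := fun z hz h => ⟨_, g6' γ z hγ hz, hε h⟩ }

end Preservation

theorem exists_not_embedding {κ c : Cardinal.{0}} {K Λ ι : Type} [LinearOrder K] [WellFoundedLT K]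
    [LinearOrder Λ] [WellFoundedLT Λ] [OrderBot Λ] (hK : RegLike κ K) (hΛ : RegLike c Λ)
    (hkc : κ < c) (hc2 : c < 2 ^ κ) (hG : Guess κ c Λ) (hι : #ι < 2 ^ κ) (L : ι → Type)
    [∀ i, LinearOrder (L i)] (hL : ∀ i, #(L i) = c) :
    ∃ (M : Type) (_ : LinearOrder M), #M = c ∧ ∀ i, ¬ ∃ f : M → L i, StrictMono f := by
  obtain ⟨F, a, hFa⟩ := hG.exists_guessing hK hΛ hkc
  obtain ⟨p, hp, hp'⟩ := exists_positions hK
  obtain ⟨B, _, b, Q, hB⟩ := exists_separated hΛ.reg hkc hc2.le hΛ.card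
  have hequiv : ∀ i, Nonempty (L i ≃ Λ) := fun i => Cardinal.eq.1 ((hL i).trans hΛ.card.symm)
  let l : ∀ i, L i → Λ := fun i => (hequiv i).some
  have hl : ∀ i, SmallFibers c (l i) := fun i γ =>
    (mk_le_of_injective (β := Iio γ) (f := fun x : {x | l i x < γ} => ⟨l i x, x.2⟩)
      fun x y h => Subtype.ext ((hequiv i).some.injective (Subtype.mk.inj h))).trans_lt (hΛ.iio γ)
  let inv : ι × Λ × Λ → Set K := fun t => {k | ∃ y, l t.1 y < a t.2.1 (p 3 k) ∧
    SameCut {z | l t.1 z < a t.2.1 (p 2 k)} y ((hequiv t.1).some.symm t.2.2)}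
  have hcard : #(ι × Λ × Λ) < #(Set K) := by
    have h2 : ℵ₀ ≤ (2 : Cardinal.{0}) ^ κ := hΛ.reg.aleph0_le.trans hc2.le
    rw [mk_set, hK.card, mk_prod, mk_prod, hΛ.card]
    simp only [lift_id]
    exact mul_lt_of_lt h2 hι (mul_lt_of_lt h2 hc2 hc2)
  obtain ⟨A, hA⟩ : ∃ A, ∀ t, inv t ≠ A := by
    by_contra! h
    exact (mk_le_of_surjective h).not_gt hcard
  obtain ⟨M, _, lM, x, hlM, hM, hx⟩ := exists_coded_order hK hΛ hkc hFa hB hp hp' A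
  refine ⟨M, inferInstance, hM, fun i ⟨f, hf⟩ => ?_⟩
  have : Nonempty M := mk_ne_zero_iff.1 (by rw [hM]; exact hΛ.reg.pos.ne')
  obtain ⟨E, hE, hEf⟩ := exists_club_reflecting hΛ (hK.reg.aleph0_le.trans_lt hkc) hlM (hl i) hf
  obtain ⟨δ, hmono, haE, -, hres⟩ := hFa.guess E hE
  refine hA (i, δ, (hequiv i).some (f (x δ))) (Set.ext fun k => ?_)
  obtain ⟨h1, h2⟩ := hx δ hmono hres k
  rw [h2, (hEf _ (haE _) _ (haE _) (hmono (hp k).2.2)).realized_iff hf h1]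
  simp only [inv, mem_ofPred_eq, Equiv.symm_apply_apply]

end KojmanShelah

/-- Kojman–Shelah: if `κ, lam` are regular, `lam < 2^κ`, and either
(a) `κ = ℵ₀`, `lam = ℵ₁` and there is an `S^{ℵ₁}_{ℵ₀}`-club guessing sequence, or
(b) `κ⁺ < lam`, then for every family of fewer than `2^κ` linear orders of cardinality
`lam` there is a linear order of cardinality `lam` embedding into none of them; in
particular the universality number of linear orders of cardinality `lam` is at least
`2^κ`. -/
theorem stmt_3 (κ lam : Cardinal.{0}) (hκ : κ.IsRegular) (hlam : lam.IsRegular)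
    (hlt : lam < 2 ^ κ)
    (hcase : (κ = Cardinal.aleph0 ∧ lam = Cardinal.aleph 1 ∧ ExistsClubGuessingOnOmega1) ∨
      Order.succ κ < lam)
    (ι : Type) (hι : Cardinal.mk ι < 2 ^ κ)
    (L : ι → Type) (r : ∀ i, L i → L i → Prop)
    (hr : ∀ i, IsStrictTotalOrder (L i) (r i))
    (hLcard : ∀ i, Cardinal.mk (L i) = lam) :
    ∃ (M : Type) (s : M → M → Prop), IsStrictTotalOrder M s ∧ Cardinal.mk M = lam ∧
      ∀ i, ¬ ∃ f : M → L i, Function.Injective f ∧ ∀ x y : M, s x y → r i (f x) (f y) := by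
  classical
  have hΛ := KojmanShelah.regLike_toType hlam
  have : Nonempty lam.ord.ToType :=
    Cardinal.mk_ne_zero_iff.1 (by rw [hΛ.card]; exact hlam.pos.ne')
  let _ : OrderBot lam.ord.ToType := WellFoundedLT.toOrderBot _
  have h : κ < lam ∧ KojmanShelah.Guess κ lam lam.ord.ToType := by
    rcases hcase with ⟨rfl, rfl, h⟩ | h
    · exact ⟨Cardinal.aleph0_lt_aleph_one, KojmanShelah.guess_omega_one h⟩
    · exact ⟨(Order.le_succ κ).trans_lt h, KojmanShelah.guess_of_succ_lt hκ h hΛ⟩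
  let _ : ∀ i, LinearOrder (L i) := fun i => linearOrderOfSTO (r i)
  obtain ⟨M, _, hM, hemb⟩ := KojmanShelah.exists_not_embedding (KojmanShelah.regLike_toType hκ)
    hΛ h.1 hlt h.2 hι L hLcard
  exact ⟨M, (· < ·), inferInstance, hM, fun i ⟨f, _, hf⟩ => hemb i ⟨f, fun x y => hf x y⟩⟩
end

section
/- If λ is an uncountable strong limit cardinal, then there exists a universal linear order of cardinality λ, i.e., a linear order of cardinality λ into which every linear order of cardinality λ admits an order-preserving injection. -/
/-- Sign sequences indexed by `I` that vanish from some point on, ordered lexicographically. -/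
abbrev BoundedSignSeq (I : Type) [LinearOrder I] : Type :=
  {s : Lex (I → SignType) // ∃ i, ∀ j, i ≤ j → ofLex s j = 0}

open Cardinal in
theorem BoundedSignSeq.mk_le {lam : Cardinal.{0}} (hunc : ℵ₀ ≤ lam)
    (hsl : ∀ μ < lam, 2 ^ μ < lam) : #(BoundedSignSeq lam.ord.ToType) ≤ lam := by
  let g : BoundedSignSeq lam.ord.ToType → Σ i : lam.ord.ToType, (Set.Iio i → SignType) :=
    fun s => ⟨s.2.choose, fun j => ofLex s.1 j⟩
  have hg : Function.Injective g := by
    intro s t h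
    have h₁ : s.2.choose = t.2.choose := congrArg Sigma.fst h
    have h₂ : ∀ (p q : Σ i : lam.ord.ToType, (Set.Iio i → SignType)), p = q →
        ∀ j (hp : j < p.1) (hq : j < q.1), p.2 ⟨j, hp⟩ = q.2 ⟨j, hq⟩ := by
      rintro p _ rfl j _ _
      rfl
    apply Subtype.ext
    apply ofLex.injective
    funext j
    rcases lt_or_ge j s.2.choose with hj | hj
    · exact h₂ _ _ h j hj (hj.trans_eq h₁)
    · rw [s.2.choose_spec j hj, t.2.choose_spec j (h₁.ge.trans hj)]
  have hfib (i : lam.ord.ToType) : #(Set.Iio i → SignType) ≤ lam := by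
    have hi : #(Set.Iio i) < lam := by simpa using mk_Iio_lt i (by simp)
    have h3 : #SignType ≤ 2 * 2 := by
      rw [mk_fintype]
      norm_num
      exact_mod_cast (by decide : Fintype.card SignType ≤ 4)
    calc #(Set.Iio i → SignType) = #SignType ^ #(Set.Iio i) := by simp
      _ ≤ (2 * 2) ^ #(Set.Iio i) := power_le_power_right h3
      _ = 2 ^ #(Set.Iio i) * 2 ^ #(Set.Iio i) := mul_power
      _ ≤ lam := (mul_lt_of_lt hunc (hsl _ hi) (hsl _ hi)).le
  calc #(BoundedSignSeq lam.ord.ToType)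
      ≤ #(Σ i : lam.ord.ToType, (Set.Iio i → SignType)) := mk_le_of_injective hg
    _ = sum fun i : lam.ord.ToType => #(Set.Iio i → SignType) := mk_sigma _
    _ ≤ sum fun _ : lam.ord.ToType => lam := sum_le_sum _ _ hfib
    _ = lam := by simp [mul_eq_self hunc]

/-- Each point is sent to the sequence of its comparisons with the previously enumerated points. -/
theorem BoundedSignSeq.exists_strictMono {I V : Type} [LinearOrder I] [WellFoundedLT I]
    [LinearOrder V] (e : V ≃ I) : ∃ f : V → BoundedSignSeq I, StrictMono f := by
  let c : V → I → SignType := fun x i =>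
    if i < e x then (if x < e.symm i then -1 else 1) else 0
  refine ⟨fun x => ⟨toLex (c x), e x, fun j hj => if_neg hj.not_gt⟩, fun x y hxy => ?_⟩
  have hmono (i : I) (hx : i < e x) (hy : i < e y) : c x i ≤ c y i := by
    simp only [c, if_pos hx, if_pos hy]
    split_ifs with h₁ h₂ h₂
    · exact le_rfl
    · decide
    · exact absurd (hxy.trans h₂) h₁
    · exact le_rfl
  have hle : ∀ i, i ≤ min (e x) (e y) → c x i ≤ c y i := by
    intro i hi
    rcases hi.lt_or_eq with hi | rfl
    · exact hmono i (hi.trans_le (min_le_left _ _)) (hi.trans_le (min_le_right _ _))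
    · rcases le_total (e x) (e y) with h | h
      · simp only [min_eq_left h, c, lt_irrefl, if_false, Equiv.symm_apply_apply,
          if_neg hxy.not_gt]
        split_ifs <;> decide
      · simp only [min_eq_right h, c, lt_irrefl, if_false, Equiv.symm_apply_apply, if_pos hxy]
        split_ifs <;> decide
  have hne : c x (min (e x) (e y)) ≠ c y (min (e x) (e y)) := by
    rcases (e.injective.ne hxy.ne).lt_or_gt with h | h
    · simp [min_eq_left h.le, c, h, hxy.not_gt]
    · simp [min_eq_right h.le, c, h, hxy]
  change toLex (c x) < toLex (c y)
  obtain ⟨i, hi, hmin⟩ := WellFounded.has_min (wellFounded_lt (α := I)) {i | c x i ≠ c y i}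
    ⟨_, hne⟩
  refine ⟨i, fun j hj => by_contra fun h => hmin j h hj, ?_⟩
  exact lt_of_le_of_ne (hle i (not_lt.1 (hmin _ hne))) hi

/-- if `lam` is an uncountable strong limit cardinal then there is a
universal linear order of cardinality `lam`. -/
theorem stmt_7 (lam : Cardinal.{0}) (hunc : Cardinal.aleph0 < lam)
    (hsl : ∀ μ < lam, 2 ^ μ < lam) :
    ∃ (W : Type) (rW : W → W → Prop), IsStrictTotalOrder W rW ∧ Cardinal.mk W = lam ∧
      ∀ (V : Type) (rV : V → V → Prop), IsStrictTotalOrder V rV → Cardinal.mk V = lam →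
        ∃ f : V → W, Function.Injective f ∧ ∀ x y : V, rV x y → rW (f x) (f y) := by
  classical
  refine ⟨BoundedSignSeq lam.ord.ToType, (· < ·), inferInstance, ?_, ?_⟩
  · apply le_antisymm (BoundedSignSeq.mk_le hunc.le hsl)
    obtain ⟨f, hf⟩ := BoundedSignSeq.exists_strictMono (Equiv.refl lam.ord.ToType)
    simpa using Cardinal.mk_le_of_injective hf.injective
  · intro V rV hV hcard
    let : LinearOrder V := linearOrderOfSTO rV
    obtain ⟨e⟩ : Nonempty (V ≃ lam.ord.ToType) := Cardinal.eq.1 (by simp [hcard])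
    obtain ⟨f, hf⟩ := BoundedSignSeq.exists_strictMono e
    exact ⟨f, hf.injective, fun x y h => hf h⟩
end
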